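/- Let 𝓕 be a finite family of maps I → ℝⁿ each nondegenerate at every point of a compact interval I₀ ⊆ I satisfying Property F with constants c₀, c₁, and let γ = γ(r) = max{r₁,…,rₙ}. Then there exist constants K₀ > 0 and 0 < κ₀ < 1 such that for any f ∈ 𝓕, any r ∈ R_n, t ∈ ℕ, 0 ≤ ε < γ, b > 1 and 0 < κ < κ₀, the set D² = {x ∈ I₀ : ∃ a ∈ ℤⁿ \ {0} and a₀ ∈ ℤ with |a₀ + a·f(x)| < κ b^{−t}, |a·f′(x)| < n c₁ b^{(γ−ε)t}, and |aᵢ| < b^{rᵢ t} for 1 ≤ i ≤ n} can be covered by a collection 𝓓² of intervals such that |Δ| ≤ δ_t for every Δ ∈ 𝓓² and #𝓓² ≤ K₀ (κ b^{−εt})^α / δ_t, where δ_t = κ b^{−t(1+γ−ε)} and α = 1/((n+1)(2n−1)). -/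

import Mathlib

/-- Property F for a family of maps `f = (f₁,…,fₙ) : ℝ → ℝⁿ` on `I₀`, with
constants `0 < c₀ < 1 < c₁`: the Wronskian-type determinant `det(f_j^{(i)})`
and the first derivatives are bounded below, and all derivatives of orders
`1,…,n` are bounded above. -/
def PropertyF {n : ℕ} (F : Set (ℝ → Fin n → ℝ)) (I₀ : Set ℝ) (c₀ c₁ : ℝ) : Prop :=
  0 < c₀ ∧ c₀ < 1 ∧ 1 < c₁ ∧
  ∀ f ∈ F, ∀ x ∈ I₀,
    c₀ < |Matrix.det (Matrix.of fun i j : Fin n =>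
      iteratedDeriv (i.1 + 1) (fun y => f y j) x)| ∧
    ∀ j : Fin n, c₀ < |deriv (fun y => f y j) x| ∧
      ∀ i : Fin n, |iteratedDeriv (i.1 + 1) (fun y => f y j) x| < c₁

/-- The maximum of the absolute values of the components of an integer vector. -/
def intMaxAbs {n : ℕ} (a : Fin n → ℤ) : ℕ := Finset.univ.sup fun j => (a j).natAbs

/-- The set `R_n` of weight vectors: nonnegative components summing to `1`. -/
def Weights (n : ℕ) : Set (Fin n → ℝ) := {r | (∑ i, r i) = 1 ∧ ∀ i, 0 ≤ r i}

/-- `γ(r) = max {r₁, …, rₙ}`. -/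
noncomputable def gammaW {n : ℕ} (r : Fin n → ℝ) : ℝ := sSup (Set.range r)

/-- A map `f = (f₁,…,fₙ) : ℝ → ℝⁿ` is nondegenerate at `x₀` if it is `Cⁿ` on a
neighbourhood of `x₀` and the Wronskian of `f₁',…,fₙ'` does not vanish at `x₀`. -/
def NondegAt {n : ℕ} (f : ℝ → Fin n → ℝ) (x₀ : ℝ) : Prop :=
  (∃ U ∈ nhds x₀, ∀ j : Fin n, ContDiffOn ℝ n (fun x => f x j) U) ∧
  Matrix.det (Matrix.of fun i j : Fin n =>
    iteratedDeriv (i.1 + 1) (fun x => f x j) x₀) ≠ 0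

section
open MeasureTheory Set
open scoped ENNReal

lemma interval_subfamily {ι : Type*} [DecidableEq ι] (p q : ι → ℝ) (t : Finset ι) :
    ∃ t' : Finset ι, (⋃ i ∈ t, Ioo (p i) (q i)) ⊆ (⋃ i ∈ t', Ioo (p i) (q i)) ∧ t' ⊆ t ∧
      ∀ x : ℝ, (t'.filter (fun i => x ∈ Ioo (p i) (q i))).card ≤ 2 := by
  induction t using Finset.strongInduction with
  | H t ih =>
  by_cases hm : ∀ x : ℝ, (t.filter (fun i => x ∈ Ioo (p i) (q i))).card ≤ 2
  · exact ⟨t, subset_rfl, subset_rfl, hm⟩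
  push Not at hm
  obtain ⟨x, hx⟩ := hm
  set s := t.filter (fun i => x ∈ Ioo (p i) (q i)) with hs
  have hne : s.Nonempty := Finset.card_pos.mp (by omega)
  obtain ⟨i, hi, hi'⟩ := s.exists_min_image p hne
  obtain ⟨j, hj, hj'⟩ := s.exists_max_image q hne
  have : ∃ k ∈ s, k ≠ i ∧ k ≠ j := by
    by_contra hcon
    push Not at hcon
    have hsub : s ⊆ {i, j} := by
      intro k hk
      by_cases hki : k = i
      · simp [hki]
      · simp [hcon k hk hki]
    have := (Finset.card_le_card hsub).trans Finset.card_le_two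
    omega
  obtain ⟨k, hk, hki, hkj⟩ := this
  have hkt : k ∈ t := (Finset.mem_filter.mp hk).1
  obtain ⟨t', h1, h2, h3⟩ := ih (t.erase k) (Finset.erase_ssubset hkt)
  refine ⟨t', subset_trans ?_ h1, h2.trans (Finset.erase_subset _ _), h3⟩
  intro y hy
  simp only [mem_iUnion] at hy ⊢
  obtain ⟨l, hl, hyl⟩ := hy
  by_cases hlk : l = k
  · subst hlk
    have hxi := (Finset.mem_filter.mp hi)
    have hxj := (Finset.mem_filter.mp hj)
    by_cases hyi : y < q i
    · exact ⟨i, Finset.mem_erase.mpr ⟨hki.symm, hxi.1⟩, lt_of_le_of_lt (hi' l hk) hyl.1, hyi⟩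
    · push Not at hyi
      exact ⟨j, Finset.mem_erase.mpr ⟨hkj.symm, hxj.1⟩,
        (hxj.2.1.trans hxi.2.2).trans_le hyi, hyl.2.trans_le (hj' l hk)⟩
  · exact ⟨l, Finset.mem_erase.mpr ⟨hlk, hl⟩, hyl⟩

lemma sum_len_le {ι : Type*} [DecidableEq ι] (p q : ι → ℝ) (t : Finset ι) (X : Set ℝ)
    (hX : ∀ i ∈ t, Ioo (p i) (q i) ⊆ X)
    (hm : ∀ x : ℝ, (t.filter (fun i => x ∈ Ioo (p i) (q i))).card ≤ 2) :
    ∑ i ∈ t, ENNReal.ofReal (q i - p i) ≤ 2 * volume X := by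
  have hmeas : MeasurableSet (⋃ i ∈ t, Ioo (p i) (q i)) :=
    Finset.measurableSet_biUnion _ fun _ _ => measurableSet_Ioo
  calc ∑ i ∈ t, ENNReal.ofReal (q i - p i)
      = ∑ i ∈ t, ∫⁻ x, (Ioo (p i) (q i)).indicator 1 x := by
        refine Finset.sum_congr rfl fun i _ => ?_
        rw [lintegral_indicator_one measurableSet_Ioo, Real.volume_Ioo]
    _ = ∫⁻ x, ∑ i ∈ t, (Ioo (p i) (q i)).indicator (1 : ℝ → ℝ≥0∞) x := by
        rw [lintegral_finsetSum]
        intro i _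
        exact measurable_one.indicator measurableSet_Ioo
    _ ≤ ∫⁻ x, 2 * (⋃ i ∈ t, Ioo (p i) (q i)).indicator 1 x := by
        refine lintegral_mono fun x => ?_
        have e : ∑ i ∈ t, (Ioo (p i) (q i)).indicator (1 : ℝ → ℝ≥0∞) x =
            ((t.filter (fun i => x ∈ Ioo (p i) (q i))).card : ℝ≥0∞) := by
          rw [Finset.card_filter]
          push_cast
          refine Finset.sum_congr rfl fun i _ => ?_
          simp [indicator_apply]
        by_cases hx : x ∈ ⋃ i ∈ t, Ioo (p i) (q i)
        · show _ ≤ 2 * (⋃ i ∈ t, Ioo (p i) (q i)).indicator 1 x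
          rw [e, indicator_of_mem hx]
          simpa using (by exact_mod_cast hm x : ((t.filter (fun i => x ∈ Ioo (p i) (q i))).card : ℝ≥0∞) ≤ 2)
        · show _ ≤ 2 * (⋃ i ∈ t, Ioo (p i) (q i)).indicator 1 x
          rw [e]
          have : t.filter (fun i => x ∈ Ioo (p i) (q i)) = ∅ := by
            ext i
            simp only [mem_iUnion, not_exists] at hx
            simp only [Finset.mem_filter, Finset.notMem_empty, iff_false, not_and]
            exact fun hi h => hx i hi h
          rw [this]
          simp
    _ = 2 * volume (⋃ i ∈ t, Ioo (p i) (q i)) := by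
        rw [lintegral_const_mul _ (measurable_one.indicator hmeas), lintegral_indicator_one hmeas]
    _ ≤ 2 * volume X := by
        gcongr
        exact iUnion₂_subset hX

lemma cover_lemma (Z X : Set ℝ) (θ : ℝ≥0∞)
    (h : ∀ y ∈ Z, ∃ p q : ℝ, p < y ∧ y < q ∧ Ioo p q ⊆ X ∧
      volume (Z ∩ Ioo p q) ≤ θ * ENNReal.ofReal (q - p)) :
    volume Z ≤ 2 * θ * volume X := by
  classical
  rcases Z.eq_empty_or_nonempty with rfl | ⟨z0, hz0⟩
  · simp
  choose! p q hp hq hX hZ using h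
  obtain ⟨T, hT, hTU⟩ := TopologicalSpace.isOpen_iUnion_countable
    (fun y : Z => Ioo (p y) (q y)) (fun _ => isOpen_Ioo)
  have hcov : Z ⊆ ⋃ y ∈ T, Ioo (p y) (q y) := by
    rw [hTU]
    intro y hy
    exact mem_iUnion.mpr ⟨⟨y, hy⟩, hp y hy, hq y hy⟩
  have hTne : T.Nonempty := by
    have := hcov hz0
    simp only [mem_iUnion] at this
    obtain ⟨i, hi, _⟩ := this
    exact ⟨i, hi⟩
  obtain ⟨e, he⟩ := hT.exists_eq_range hTne
  have hZeq : Z = ⋃ N : ℕ, Z ∩ ⋃ i ∈ Finset.range N, Ioo (p (e i)) (q (e i)) := by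
    apply subset_antisymm
    · intro y hy
      have := hcov hy
      rw [he] at this
      simp only [mem_iUnion, mem_range] at this
      obtain ⟨i, ⟨k, rfl⟩, hi⟩ := this
      simp only [mem_iUnion]
      refine ⟨k + 1, hy, ?_⟩
      simp only [mem_iUnion]
      exact ⟨k, Finset.mem_range.mpr (Nat.lt_succ_self k), hi⟩
    · exact iUnion_subset fun N => inter_subset_left
  have hmono : Monotone (fun N : ℕ => Z ∩ ⋃ i ∈ Finset.range N, Ioo (p (e i)) (q (e i))) := by
    intro a b hab
    refine inter_subset_inter_right _ ?_
    exact biUnion_subset_biUnion_left (fun i hi =>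
      Finset.mem_range.mpr (lt_of_lt_of_le (Finset.mem_range.mp hi) hab))
  rw [hZeq, hmono.measure_iUnion]
  refine iSup_le fun N => ?_
  obtain ⟨t', h1, -, h3⟩ := interval_subfamily (fun i => p (e i)) (fun i => q (e i))
    (Finset.range N)
  calc volume (Z ∩ ⋃ i ∈ Finset.range N, Ioo (p (e i)) (q (e i)))
      ≤ volume (⋃ i ∈ t', Z ∩ Ioo (p (e i)) (q (e i))) := by
        apply measure_mono
        rw [← inter_iUnion₂]
        exact inter_subset_inter_right _ h1
    _ ≤ ∑ i ∈ t', volume (Z ∩ Ioo (p (e i)) (q (e i))) := measure_biUnion_finset_le _ _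
    _ ≤ ∑ i ∈ t', θ * ENNReal.ofReal (q (e i) - p (e i)) :=
        Finset.sum_le_sum fun i _ => hZ _ (e i).2
    _ = θ * ∑ i ∈ t', ENNReal.ofReal (q (e i) - p (e i)) := by rw [Finset.mul_sum]
    _ ≤ θ * (2 * volume X) := by
        gcongr
        exact sum_len_le (fun i => p (e i)) (fun i => q (e i)) t' X
          (fun i _ => hX _ (e i).2) h3
    _ = 2 * θ * volume X := by ring

lemma comp_right (h : ℝ → ℝ) (y v ρ : ℝ) (hc : ContinuousOn h (Icc y v)) (hyv : y < v)
    (hy : h y < ρ) : ∃ q, y < q ∧ q ≤ v ∧ (∀ z ∈ Ico y q, h z < ρ) ∧ h q ≤ ρ ∧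
      (h q = ρ ∨ (q = v ∧ ∀ z ∈ Icc y v, h z < ρ)) := by
  by_cases hall : ∀ z ∈ Icc y v, h z < ρ
  · exact ⟨v, hyv, le_rfl, fun z hz => hall z ⟨hz.1, hz.2.le⟩, (hall v ⟨hyv.le, le_rfl⟩).le,
      Or.inr ⟨rfl, hall⟩⟩
  push Not at hall
  set A := Icc y v ∩ h ⁻¹' (Ici ρ) with hA
  have hAcl : IsClosed A := hc.preimage_isClosed_of_isClosed isClosed_Icc isClosed_Ici
  have hAne : A.Nonempty := by
    obtain ⟨z, hz, hz'⟩ := hall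
    exact ⟨z, hz, hz'⟩
  have hbd : BddBelow A := ⟨y, fun z hz => hz.1.1⟩
  have hq : sInf A ∈ A := hAcl.csInf_mem hAne hbd
  set q := sInf A with hqdef
  have hlt : ∀ z ∈ Ico y q, h z < ρ := by
    intro z hz
    by_contra hcon
    push Not at hcon
    have : z ∈ A := ⟨⟨hz.1, hz.2.le.trans hq.1.2⟩, hcon⟩
    exact absurd (csInf_le hbd this) (not_le.mpr hz.2)
  have hyq : y < q := by
    rcases eq_or_lt_of_le hq.1.1 with h' | h'
    · have : ρ ≤ h q := hq.2
      rw [← h'] at this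
      linarith
    · exact h'
  have heq : h q = ρ := by
    have hiv := intermediate_value_Icc hyq.le (hc.mono (Icc_subset_Icc_right hq.1.2))
    obtain ⟨z, hz, hz'⟩ := hiv ⟨hy.le, hq.2⟩
    have hzA : z ∈ A := ⟨⟨hz.1, hz.2.trans hq.1.2⟩, hz'.ge⟩
    have : z = q := le_antisymm hz.2 (csInf_le hbd hzA)
    rw [← this, hz']
  exact ⟨q, hyq, hq.1.2, hlt, heq.le, Or.inl heq⟩

lemma comp_left (h : ℝ → ℝ) (u y ρ : ℝ) (hc : ContinuousOn h (Icc u y)) (huy : u < y)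
    (hy : h y < ρ) : ∃ p, u ≤ p ∧ p < y ∧ (∀ z ∈ Ioc p y, h z < ρ) ∧ h p ≤ ρ ∧
      (h p = ρ ∨ (p = u ∧ ∀ z ∈ Icc u y, h z < ρ)) := by
  obtain ⟨q, h1, h2, h3, h4, h5⟩ := comp_right (fun z => h (-z)) (-y) (-u) ρ
    (hc.comp continuousOn_neg (fun z hz => ⟨by linarith [hz.2], by linarith [hz.1]⟩))
    (by linarith) (by simpa using hy)
  refine ⟨-q, by linarith, by linarith, fun z hz => ?_, h4, ?_⟩
  · simpa using h3 (-z) ⟨by linarith [hz.2], by linarith [hz.1]⟩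
  · rcases h5 with h5 | ⟨h5, h6⟩
    · exact Or.inl h5
    · refine Or.inr ⟨by linarith, fun z hz => ?_⟩
      simpa using h6 (-z) ⟨by linarith [hz.2], by linarith [hz.1]⟩

lemma component (h : ℝ → ℝ) (u v y ρ : ℝ) (hc : ContinuousOn h (Icc u v)) (hy : y ∈ Ioo u v)
    (hyρ : h y < ρ) (hx : ∃ x ∈ Icc u v, ρ ≤ h x) :
    ∃ p q, u ≤ p ∧ p < y ∧ y < q ∧ q ≤ v ∧ (∀ z ∈ Icc p q, h z ≤ ρ) ∧
      (∀ z ∈ Ioo p q, h z < ρ) ∧ (h p = ρ ∨ p = u) ∧ (h q = ρ ∨ q = v) ∧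
      (h p = ρ ∨ h q = ρ) := by
  obtain ⟨q, q1, q2, q3, q4, q5⟩ := comp_right h y v ρ
    (hc.mono (Icc_subset_Icc_left hy.1.le)) hy.2 hyρ
  obtain ⟨p, p1, p2, p3, p4, p5⟩ := comp_left h u y ρ
    (hc.mono (Icc_subset_Icc_right hy.2.le)) hy.1 hyρ
  have hlt : ∀ z ∈ Ioo p q, h z < ρ := by
    intro z hz
    rcases le_total z y with hzy | hzy
    · exact p3 z ⟨hz.1, hzy⟩
    · exact q3 z ⟨hzy, hz.2⟩
  refine ⟨p, q, p1, p2, q1, q2, ?_, hlt, ?_, ?_, ?_⟩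
  · intro z hz
    rcases eq_or_lt_of_le hz.1 with rfl | h1
    · exact p4
    rcases eq_or_lt_of_le hz.2 with rfl | h2
    · exact q4
    exact (hlt z ⟨h1, h2⟩).le
  · exact p5.imp_right And.left
  · exact q5.imp_right And.left
  · rcases p5 with p5 | p5
    · exact Or.inl p5
    rcases q5 with q5 | q5
    · exact Or.inr q5
    exfalso
    obtain ⟨x, hx, hx'⟩ := hx
    rcases le_total x y with hxy | hxy
    · exact absurd (p5.2 x ⟨hx.1, hxy⟩) (not_lt.mpr hx')
    · exact absurd (q5.2 x ⟨hxy, hx.2⟩) (not_lt.mpr hx')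

def GoodOn (C α a b : ℝ) (g : ℝ → ℝ) : Prop :=
  ∀ u v, a ≤ u → u < v → v ≤ b → ∀ x ∈ Icc u v, ∀ ε : ℝ, 0 < ε →
    volume {y ∈ Icc u v | |g y| < ε * |g x|} ≤ ENNReal.ofReal (C * ε ^ α * (v - u))

lemma one_step_iter (g : ℝ → ℝ) (a b ε₀ θ : ℝ) (hε₀ : 0 < ε₀) (hε₁ : ε₀ < 1) (hθ : 0 ≤ θ)
    (hg : ContinuousOn g (Icc a b))
    (hos : ∀ u v, a ≤ u → u < v → v ≤ b → ∀ x ∈ Icc u v,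
      volume {y ∈ Icc u v | |g y| < ε₀ * |g x|} ≤ ENNReal.ofReal (θ * (v - u)))
    (u v : ℝ) (hau : a ≤ u) (huv : u < v) (hvb : v ≤ b) (x : ℝ) (hx : x ∈ Icc u v) (m : ℕ) :
    volume {y ∈ Icc u v | |g y| < ε₀ ^ m * |g x|} ≤ ENNReal.ofReal ((2 * θ) ^ m * (v - u)) := by
  induction m with
  | zero =>
    calc volume {y ∈ Icc u v | |g y| < ε₀ ^ 0 * |g x|} ≤ volume (Icc u v) :=
          measure_mono (sep_subset _ _)
      _ = _ := by simp
  | succ m ih =>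
    rcases eq_or_lt_of_le (abs_nonneg (g x)) with h0 | h0
    · have : {y ∈ Icc u v | |g y| < ε₀ ^ (m + 1) * |g x|} = ∅ := by
        ext y
        simp only [← h0, mul_zero, mem_setOf_eq, mem_empty_iff_false, iff_false, not_and, not_lt]
        exact fun _ => abs_nonneg _
      rw [this]
      simp
    set s := |g x| with hs
    have hcov := cover_lemma {y ∈ Ioo u v | |g y| < ε₀ ^ (m + 1) * s}
      {y ∈ Icc u v | |g y| < ε₀ ^ m * s} (ENNReal.ofReal θ) (by
        rintro y ⟨hy, hy'⟩
        have hpm : 0 < ε₀ ^ m := pow_pos hε₀ m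
        have hle : ε₀ ^ m ≤ 1 := pow_le_one₀ hε₀.le hε₁.le
        obtain ⟨p, q, h1, h2, h3, h4, h5, h6, -, -, h9⟩ := component (fun z => |g z|) u v y
          (ε₀ ^ m * s) ((hg.mono (Icc_subset_Icc hau hvb)).abs) hy
          (hy'.trans (by rw [pow_succ]; nlinarith [mul_pos hpm h0])) ⟨x, hx, by
            show ε₀ ^ m * s ≤ s
            nlinarith⟩
        refine ⟨p, q, h2, h3, fun z hz => ⟨⟨h1.trans hz.1.le, hz.2.le.trans h4⟩, h6 z hz⟩, ?_⟩
        rw [← ENNReal.ofReal_mul hθ]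
        have key : ∃ w ∈ Icc p q, |g w| = ε₀ ^ m * s := by
          rcases h9 with h9 | h9
          · exact ⟨p, ⟨le_rfl, (h2.trans h3).le⟩, h9⟩
          · exact ⟨q, ⟨(h2.trans h3).le, le_rfl⟩, h9⟩
        obtain ⟨w, hw, hw'⟩ := key
        refine le_trans (measure_mono ?_) (hos p q (hau.trans h1) (h2.trans h3) (h4.trans hvb) w hw)
        rintro z ⟨⟨hz1, hz2⟩, hz3⟩
        refine ⟨⟨hz3.1.le, hz3.2.le⟩, ?_⟩
        rw [hw']
        calc |g z| < ε₀ ^ (m + 1) * s := hz2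
          _ = _ := by ring)
    calc volume {y ∈ Icc u v | |g y| < ε₀ ^ (m + 1) * s}
        ≤ volume ({y ∈ Ioo u v | |g y| < ε₀ ^ (m + 1) * s} ∪ {u, v}) := by
          apply measure_mono
          rintro y ⟨hy, hy'⟩
          by_cases h1 : y = u
          · right; simp [h1]
          by_cases h2 : y = v
          · right; simp [h2]
          left
          exact ⟨⟨lt_of_le_of_ne hy.1 (Ne.symm h1), lt_of_le_of_ne hy.2 h2⟩, hy'⟩
      _ ≤ volume {y ∈ Ioo u v | |g y| < ε₀ ^ (m + 1) * s} + volume ({u, v} : Set ℝ) :=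
          measure_union_le _ _
      _ = volume {y ∈ Ioo u v | |g y| < ε₀ ^ (m + 1) * s} := by
          rw [(Set.Finite.measure_zero (by simp) volume : volume ({u, v} : Set ℝ) = 0), add_zero]
      _ ≤ 2 * ENNReal.ofReal θ * ENNReal.ofReal ((2 * θ) ^ m * (v - u)) :=
          hcov.trans (by gcongr)
      _ = ENNReal.ofReal ((2 * θ) ^ (m + 1) * (v - u)) := by
          rw [show (2 : ℝ≥0∞) = ENNReal.ofReal 2 by simp, ← ENNReal.ofReal_mul (by norm_num),
            ← ENNReal.ofReal_mul (by positivity)]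
          congr 1
          ring

lemma one_step_good (g : ℝ → ℝ) (a b ε₀ θ α : ℝ) (hε₀ : 0 < ε₀) (hε₁ : ε₀ < 1) (hθ : 0 ≤ θ)
    (hα : 0 < α) (hθα : 2 * θ ≤ ε₀ ^ α)
    (hg : ContinuousOn g (Icc a b))
    (hos : ∀ u v, a ≤ u → u < v → v ≤ b → ∀ x ∈ Icc u v,
      volume {y ∈ Icc u v | |g y| < ε₀ * |g x|} ≤ ENNReal.ofReal (θ * (v - u))) :
    GoodOn (ε₀ ^ (-α)) α a b g := by
  intro u v hau huv hvb x hx ε hε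
  rcases le_total 1 ε with h1 | h1
  · calc volume {y ∈ Icc u v | |g y| < ε * |g x|} ≤ volume (Icc u v) :=
          measure_mono (sep_subset _ _)
      _ = ENNReal.ofReal (v - u) := Real.volume_Icc
      _ ≤ _ := by
        apply ENNReal.ofReal_le_ofReal
        have a1 : 1 ≤ ε₀ ^ (-α) := Real.one_le_rpow_of_pos_of_le_one_of_nonpos hε₀ hε₁.le (by linarith)
        have a2 : 1 ≤ ε ^ α := Real.one_le_rpow h1 hα.le
        have := one_le_mul_of_one_le_of_one_le a1 a2
        nlinarith
  obtain ⟨m, hm1, hm2⟩ := exists_nat_pow_near_of_lt_one hε h1 hε₀ hε₁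
  calc volume {y ∈ Icc u v | |g y| < ε * |g x|}
      ≤ volume {y ∈ Icc u v | |g y| < ε₀ ^ m * |g x|} := by
        apply measure_mono
        rintro y ⟨hy, hy'⟩
        exact ⟨hy, hy'.trans_le (by gcongr)⟩
    _ ≤ ENNReal.ofReal ((2 * θ) ^ m * (v - u)) :=
        one_step_iter g a b ε₀ θ hε₀ hε₁ hθ hg hos u v hau huv hvb x hx m
    _ ≤ _ := by
        apply ENNReal.ofReal_le_ofReal
        have : (2 * θ) ^ m ≤ ε₀ ^ (-α) * ε ^ α := by
          calc (2 * θ) ^ m ≤ (ε₀ ^ α) ^ m := by gcongr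
            _ = ε₀ ^ (-α) * (ε₀ ^ (m + 1)) ^ α := by
              rw [← Real.rpow_natCast, ← Real.rpow_natCast, ← Real.rpow_mul hε₀.le,
                ← Real.rpow_mul hε₀.le, ← Real.rpow_add hε₀]
              congr 1
              push_cast
              ring
            _ ≤ ε₀ ^ (-α) * ε ^ α := by gcongr
        have h2 : 0 ≤ v - u := by linarith
        gcongr
end

section
open MeasureTheory Set
open scoped ENNReal

/-- `x` is marked by a chain in `S`. -/
def QMarked {P : Type*} [PartialOrder P] (S : Finset P) (ψ : P → ℝ → ℝ) (ε ρ x : ℝ) : Prop :=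
  ∃ M : Finset P, M ⊆ S ∧ IsChain (· ≤ ·) (M : Set P) ∧ (∀ s ∈ M, ε ≤ ψ s x ∧ ψ s x ≤ ρ) ∧
    ∀ s ∈ S, s ∉ M → (∀ s' ∈ M, s ≤ s' ∨ s' ≤ s) → ρ ≤ ψ s x

lemma qnd {P : Type*} [PartialOrder P] [DecidableEq P] (ψ : P → ℝ → ℝ) (ε ρ θ a b : ℝ)
    (hθ : 0 ≤ θ) (S₀ : Finset P)
    (hc : ∀ s ∈ S₀, ContinuousOn (ψ s) (Icc a b))
    (hgood : ∀ s ∈ S₀, ∀ u v, a ≤ u → u < v → v ≤ b → (∃ x ∈ Icc u v, ρ ≤ ψ s x) →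
      volume {y ∈ Icc u v | ψ s y < ε} ≤ ENNReal.ofReal (θ * (v - u))) (k : ℕ) :
    ∀ S ⊆ S₀, (∀ M ⊆ S, IsChain (· ≤ ·) (M : Set P) → M.card ≤ k) →
      ∀ u v, a ≤ u → u < v → v ≤ b → (∀ s ∈ S, ∃ x ∈ Icc u v, ρ ≤ ψ s x) →
      volume {x ∈ Icc u v | ¬ QMarked S ψ ε ρ x} ≤
        ENNReal.ofReal ((2 ^ (k + 1) - 2) * θ * (v - u)) := by
  classical
  induction k with
  | zero =>
    intro S hS hk u v _ _ _ _
    have hSe : S = ∅ := by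
      by_contra hne
      obtain ⟨s, hs⟩ := Finset.nonempty_iff_ne_empty.mpr hne
      have := hk {s} (by simpa using hs) (by simp)
      simp at this
    have : {x ∈ Icc u v | ¬ QMarked S ψ ε ρ x} = ∅ := by
      ext x
      simp only [mem_sep_iff, mem_empty_iff_false, iff_false, not_and, not_not]
      intro _
      exact ⟨∅, by simp, by simp, by simp, by simp [hSe]⟩
    rw [this]
    simp
  | succ k ih =>
    intro S hS hk u v hau huv hvb hsup
    have hck : (0 : ℝ) ≤ 2 ^ (k + 1) - 2 := by
      have : (1 : ℝ) ≤ 2 ^ k := one_le_pow₀ (by norm_num)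
      rw [pow_succ]
      linarith
    have hcov := cover_lemma {x ∈ Ioo u v | ¬ QMarked S ψ ε ρ x} (Icc u v)
      (ENNReal.ofReal ((2 ^ (k + 1) - 2 + 1) * θ)) (by
        rintro y ⟨hy, hy'⟩
        set E := S.filter (fun s => ψ s y < ρ) with hE
        have hEne : E.Nonempty := by
          by_contra hne
          rw [Finset.not_nonempty_iff_eq_empty] at hne
          refine hy' ⟨∅, by simp, by simp, by simp, fun s hs _ _ => ?_⟩
          by_contra hlt
          have : s ∈ E := Finset.mem_filter.mpr ⟨hs, not_le.mp hlt⟩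
          simp [hne] at this
        have hcomp : ∀ s ∈ E, ∃ p q, u ≤ p ∧ p < y ∧ y < q ∧ q ≤ v ∧ (∀ z ∈ Icc p q, ψ s z ≤ ρ) ∧
            (ψ s p = ρ ∨ p = u) ∧ (ψ s q = ρ ∨ q = v) ∧ (ψ s p = ρ ∨ ψ s q = ρ) := by
          intro s hs
          obtain ⟨hs1, hs2⟩ := Finset.mem_filter.mp hs
          obtain ⟨p, q, h1, h2, h3, h4, h5, -, h7, h8, h9⟩ := component (ψ s) u v y ρ
            ((hc s (hS hs1)).mono (Icc_subset_Icc hau hvb)) hy hs2 (hsup s hs1)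
          exact ⟨p, q, h1, h2, h3, h4, h5, h7, h8, h9⟩
        choose! p q h1 h2 h3 h4 h5 h7 h8 h9 using hcomp
        obtain ⟨s, hs, hmax⟩ := E.exists_max_image (fun s => q s - p s) hEne
        have hsS : s ∈ S := (Finset.mem_filter.mp hs).1
        refine ⟨p s, q s, h2 s hs, h3 s hs, fun z hz => ⟨(h1 s hs).trans hz.1.le,
          hz.2.le.trans (h4 s hs)⟩, ?_⟩
        have hpq : p s < q s := (h2 s hs).trans (h3 s hs)
        have hsup' : ∀ s' ∈ S, ∃ x ∈ Icc (p s) (q s), ρ ≤ ψ s' x := by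
          intro s' hs'
          by_cases hys : ψ s' y < ρ
          · have hs'E : s' ∈ E := Finset.mem_filter.mpr ⟨hs', hys⟩
            have hm := hmax s' hs'E
            have k2 := h2 s' hs'E
            have k3 := h3 s' hs'E
            have l2 := h2 s hs
            have l3 := h3 s hs
            by_cases hp : p s' < p s
            · have hq : q s' < q s := by linarith
              rcases h8 s' hs'E with h | h
              · exact ⟨q s', ⟨by linarith, hq.le⟩, h.ge⟩
              · exact absurd (h4 s hs) (by linarith)
            by_cases hq : q s < q s'
            · have hp' : p s < p s' := by linarith
              rcases h7 s' hs'E with h | h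
              · exact ⟨p s', ⟨hp'.le, by linarith⟩, h.ge⟩
              · exact absurd (h1 s hs) (by linarith)
            push Not at hp hq
            rcases h9 s' hs'E with h | h
            · exact ⟨p s', ⟨hp, by linarith⟩, h.ge⟩
            · exact ⟨q s', ⟨by linarith, hq⟩, h.ge⟩
          · exact ⟨y, ⟨(h2 s hs).le, (h3 s hs).le⟩, not_lt.mp hys⟩
        set S' := S.filter (fun s' => s' ≠ s ∧ (s' ≤ s ∨ s ≤ s')) with hS'
        have hS'S : S' ⊆ S := Finset.filter_subset _ _
        have hih := ih S' (hS'S.trans hS) (by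
          intro M hM hMc
          have hsM : s ∉ M := fun h => (Finset.mem_filter.mp (hM h)).2.1 rfl
          have := hk (insert s M) (Finset.insert_subset hsS (hM.trans hS'S)) (by
            rw [Finset.coe_insert]
            refine hMc.insert fun t ht _ => ?_
            exact (Finset.mem_filter.mp (hM ht)).2.2.symm)
          rw [Finset.card_insert_of_notMem hsM] at this
          omega) (p s) (q s) (hau.trans (h1 s hs)) hpq ((h4 s hs).trans hvb)
          (fun s' hs' => hsup' s' (hS'S hs'))
        have hg := hgood s (hS hsS) (p s) (q s) (hau.trans (h1 s hs)) hpq ((h4 s hs).trans hvb)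
          (hsup' s hsS)
        calc volume ({x ∈ Ioo u v | ¬ QMarked S ψ ε ρ x} ∩ Ioo (p s) (q s))
            ≤ volume ({x ∈ Icc (p s) (q s) | ¬ QMarked S' ψ ε ρ x} ∪
                {x ∈ Icc (p s) (q s) | ψ s x < ε}) := by
              apply measure_mono
              rintro x ⟨⟨hx1, hx2⟩, hx3⟩
              have hx4 : x ∈ Icc (p s) (q s) := ⟨hx3.1.le, hx3.2.le⟩
              by_cases hxs : ψ s x < ε
              · exact Or.inr ⟨hx4, hxs⟩
              left
              refine ⟨hx4, fun hM => hx2 ?_⟩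
              obtain ⟨M, hM1, hM2, hM3, hM4⟩ := hM
              refine ⟨insert s M, Finset.insert_subset hsS (hM1.trans hS'S), ?_, ?_, ?_⟩
              · rw [Finset.coe_insert]
                refine hM2.insert fun t ht _ => ?_
                exact (Finset.mem_filter.mp (hM1 ht)).2.2.symm
              · intro t ht
                rcases Finset.mem_insert.mp ht with rfl | ht
                · exact ⟨not_lt.mp hxs, h5 _ hs x hx4⟩
                · exact hM3 t ht
              · intro t ht htM htc
                have hts : t ≠ s := fun h => htM (h ▸ Finset.mem_insert_self _ _)
                refine hM4 t (Finset.mem_filter.mpr ⟨ht, hts, htc s (Finset.mem_insert_self _ _)⟩)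
                  (fun h => htM (Finset.mem_insert_of_mem h))
                  (fun s' hs' => htc s' (Finset.mem_insert_of_mem hs'))
          _ ≤ _ := measure_union_le _ _
          _ ≤ ENNReal.ofReal ((2 ^ (k + 1) - 2) * θ * (q s - p s)) +
                ENNReal.ofReal (θ * (q s - p s)) := add_le_add hih hg
          _ = ENNReal.ofReal ((2 ^ (k + 1) - 2 + 1) * θ) * ENNReal.ofReal (q s - p s) := by
              have : 0 ≤ q s - p s := by linarith
              rw [← ENNReal.ofReal_add (by positivity) (by positivity),
                ← ENNReal.ofReal_mul (by positivity)]
              congr 1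
              ring)
    calc volume {x ∈ Icc u v | ¬ QMarked S ψ ε ρ x}
        ≤ volume ({x ∈ Ioo u v | ¬ QMarked S ψ ε ρ x} ∪ {u, v}) := by
          apply measure_mono
          rintro y ⟨hy, hy'⟩
          by_cases h1 : y = u
          · right; simp [h1]
          by_cases h2 : y = v
          · right; simp [h2]
          left
          exact ⟨⟨lt_of_le_of_ne hy.1 (Ne.symm h1), lt_of_le_of_ne hy.2 h2⟩, hy'⟩
      _ ≤ volume {x ∈ Ioo u v | ¬ QMarked S ψ ε ρ x} + volume ({u, v} : Set ℝ) :=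
          measure_union_le _ _
      _ = volume {x ∈ Ioo u v | ¬ QMarked S ψ ε ρ x} := by
          rw [(Set.Finite.measure_zero (by simp) volume : volume ({u, v} : Set ℝ) = 0), add_zero]
      _ ≤ 2 * ENNReal.ofReal ((2 ^ (k + 1) - 2 + 1) * θ) * ENNReal.ofReal (v - u) := by
          rw [Real.volume_Icc] at hcov
          exact hcov
      _ = _ := by
          rw [show (2 : ℝ≥0∞) = ENNReal.ofReal 2 by simp, ← ENNReal.ofReal_mul (by norm_num),
            ← ENNReal.ofReal_mul (by positivity)]
          congr 1
          ring
end

section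
open MeasureTheory Set
open scoped ENNReal

lemma exists_separated (Z : Set ℝ) (h : ℝ) (hh : 0 ≤ h) (N : ℕ)
    (hZ : ENNReal.ofReal (2 * (N + 1) * h) < volume Z) (k : ℕ) (hk : k ≤ N + 1) :
    ∃ s : Finset ℝ, s.card = k ∧ (∀ z ∈ s, z ∈ Z) ∧ ∀ z ∈ s, ∀ w ∈ s, z ≠ w → h < |z - w| := by
  induction k with
  | zero => exact ⟨∅, by simp⟩
  | succ k ih =>
    obtain ⟨s, hs1, hs2, hs3⟩ := ih (by omega)
    have : ¬ Z ⊆ ⋃ z ∈ s, Icc (z - h) (z + h) := by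
      intro hsub
      have h1 : volume Z ≤ ENNReal.ofReal (2 * (N + 1) * h) := by
        calc volume Z ≤ volume (⋃ z ∈ s, Icc (z - h) (z + h)) := measure_mono hsub
          _ ≤ ∑ z ∈ s, volume (Icc (z - h) (z + h)) := measure_biUnion_finset_le _ _
          _ = ∑ z ∈ s, ENNReal.ofReal (2 * h) := by
            refine Finset.sum_congr rfl fun z _ => ?_
            rw [Real.volume_Icc]
            congr 1
            ring
          _ = ENNReal.ofReal (k * (2 * h)) := by
            rw [Finset.sum_const, hs1, ENNReal.ofReal_mul (by positivity)]
            simp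
          _ ≤ _ := by
            apply ENNReal.ofReal_le_ofReal
            have : (k : ℝ) ≤ N + 1 := by exact_mod_cast (by omega : k ≤ N + 1)
            nlinarith
      exact absurd hZ (not_lt.mpr h1)
    obtain ⟨w, hwZ, hw⟩ := not_subset.mp this
    simp only [mem_iUnion, not_exists] at hw
    have hw' : ∀ z ∈ s, h < |z - w| := by
      intro z hz
      by_contra hcon
      push Not at hcon
      rw [abs_le] at hcon
      exact hw z hz ⟨by linarith, by linarith⟩
    have hws : w ∉ s := by
      intro hcon
      have := hw' w hcon
      simp at this
      linarith
    refine ⟨insert w s, by rw [Finset.card_insert_of_notMem hws, hs1], ?_, ?_⟩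
    · intro z hz
      rcases Finset.mem_insert.mp hz with rfl | hz
      · exact hwZ
      · exact hs2 z hz
    · intro z hz y hy hzy
      rcases Finset.mem_insert.mp hz with hz1 | hz1 <;> rcases Finset.mem_insert.mp hy with hy1 | hy1
      · exact absurd (hz1.trans hy1.symm) hzy
      · rw [abs_sub_comm, hz1]; exact hw' y hy1
      · rw [hy1]; exact hw' z hz1
      · exact hs3 z hz1 y hy1 hzy

open Polynomial in
lemma remez (N : ℕ) (hN : 1 ≤ N) (q : ℝ[X]) (hq : q.natDegree ≤ N) (u v : ℝ) (huv : u < v)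
    (x : ℝ) (hx : x ∈ Icc u v) (ε : ℝ) (hε : 0 < ε) (hM : 0 < |q.eval x|) :
    volume {y ∈ Icc u v | |q.eval y| ≤ ε * |q.eval x|} ≤
      ENNReal.ofReal (4 * (N + 1) * ((N + 1) * ε) ^ ((N : ℝ)⁻¹) * (v - u)) := by
  by_contra hcon
  push Not at hcon
  set L := v - u with hL
  have hLpos : 0 < L := by linarith
  set h := 2 * ((N + 1) * ε) ^ ((N : ℝ)⁻¹) * L with hh
  have hhpos : 0 < h := by positivity
  obtain ⟨s, hs1, hs2, hs3⟩ := exists_separated _ h hhpos.le N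
    (by convert hcon using 2; rw [hh]; ring) (N + 1) le_rfl
  set M := |q.eval x| with hMdef
  have hinterp := Lagrange.eq_interpolate (s := s) (v := id) (f := q) (Function.injective_id.injOn) (by
    refine lt_of_le_of_lt degree_le_natDegree ?_
    rw [hs1]
    exact_mod_cast (by omega : q.natDegree < N + 1))
  have hev : q.eval x = ∑ i ∈ s, q.eval i * ∏ j ∈ s.erase i, ((i - j)⁻¹ * (x - j)) := by
    conv_lhs => rw [hinterp, Lagrange.interpolate_apply]
    simp [eval_finsetSum, Lagrange.basis, Lagrange.basisDivisor, eval_prod]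
  have hhN : h ^ N = 2 ^ N * ((N + 1) * ε) * L ^ N := by
    rw [hh, mul_pow, mul_pow, Real.rpow_inv_natCast_pow (by positivity) (by omega)]
  have hb : M ≤ (N + 1) * (ε * M * (L / h) ^ N) := by
    calc M = |∑ i ∈ s, q.eval i * ∏ j ∈ s.erase i, ((i - j)⁻¹ * (x - j))| := by rw [← hev]
      _ ≤ ∑ i ∈ s, |q.eval i * ∏ j ∈ s.erase i, ((i - j)⁻¹ * (x - j))| :=
        Finset.abs_sum_le_sum_abs _ _
      _ ≤ ∑ i ∈ s, ε * M * (L / h) ^ N := by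
        refine Finset.sum_le_sum fun i hi => ?_
        rw [abs_mul, Finset.abs_prod]
        have h1 : ∏ j ∈ s.erase i, |(i - j)⁻¹ * (x - j)| ≤ ∏ j ∈ s.erase i, (L / h) := by
          refine Finset.prod_le_prod (fun _ _ => abs_nonneg _) fun j hj => ?_
          obtain ⟨hji, hj⟩ := Finset.mem_erase.mp hj
          have hsep := hs3 i hi j hj (Ne.symm hji)
          rw [abs_mul, abs_inv, div_eq_inv_mul]
          have : |x - j| ≤ L := by
            have := (hs2 j hj).1
            rw [abs_le]
            constructor <;> linarith [hx.1, hx.2, this.1, this.2]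
          gcongr
        rw [Finset.prod_const, Finset.card_erase_of_mem hi, hs1, Nat.add_sub_cancel] at h1
        exact mul_le_mul (hs2 i hi).2 h1 (Finset.prod_nonneg fun _ _ => abs_nonneg _)
          (by positivity)
      _ = _ := by
        rw [Finset.sum_const, hs1]
        simp
  rw [div_pow, hhN] at hb
  have h2 : (N + 1) * (ε * M * (L ^ N / (2 ^ N * ((N + 1) * ε) * L ^ N))) = M / 2 ^ N := by
    field_simp
  rw [h2, le_div_iff₀ (by positivity)] at hb
  have h3 : (2 : ℝ) ≤ 2 ^ N := by
    calc (2 : ℝ) = 2 ^ 1 := by norm_num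
      _ ≤ 2 ^ N := pow_le_pow_right₀ (by norm_num) hN
  nlinarith

open Polynomial in
lemma wronskian_zero (p q : ℝ[X]) (h : p * derivative q - derivative p * q = 0) :
    ∃ a b : ℝ, (a ≠ 0 ∨ b ≠ 0) ∧ C a * p + C b * q = 0 := by
  classical
  by_cases hq : q = 0
  · exact ⟨0, 1, by simp, by simp [hq]⟩
  have hcop := isCoprime_div_gcd_div_gcd (p := p) (q := q) hq
  have hg : gcd p q ≠ 0 := fun h => hq ((gcd_eq_zero_iff p q).mp h).2
  set g := gcd p q with hgdef
  have h1 : p = g * (p / g) := (EuclideanDomain.mul_div_cancel' hg (gcd_dvd_left p q)).symm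
  have h2 : q = g * (q / g) := (EuclideanDomain.mul_div_cancel' hg (gcd_dvd_right p q)).symm
  set p1 := p / g with hp1
  set q1 := q / g with hq1
  have hw : p1.wronskian q1 = 0 := by
    have : g ^ 2 * p1.wronskian q1 = 0 := by
      rw [← h, wronskian, h1, h2, derivative_mul, derivative_mul]
      ring
    exact (mul_eq_zero.mp this).resolve_left (pow_ne_zero 2 hg)
  obtain ⟨hd1, hd2⟩ := hcop.wronskian_eq_zero_iff.mp hw
  have e1 := eq_C_of_derivative_eq_zero hd1
  have e2 := eq_C_of_derivative_eq_zero hd2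
  set a := p1.coeff 0
  set b := q1.coeff 0
  have hb : b ≠ 0 := by
    intro hb
    rw [hb] at e2
    apply hq
    rw [h2, e2]
    simp
  refine ⟨b, -a, Or.inl hb, ?_⟩
  rw [h1, h2, e1, e2, C_neg]
  ring

/-- Polynomial with coefficient vector `p`. -/
noncomputable def vpoly {m : ℕ} (p : Fin m → ℝ) : Polynomial ℝ :=
  ∑ i : Fin m, Polynomial.C (p i) * Polynomial.X ^ (i : ℕ)

open Polynomial

lemma vpoly_coeff {m : ℕ} (p : Fin m → ℝ) (i : Fin m) : (vpoly p).coeff i = p i := by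
  simp [vpoly, finsetSum_coeff, coeff_X_pow, Fin.val_inj]

lemma vpoly_eval {m : ℕ} (p : Fin m → ℝ) (s : ℝ) :
    (vpoly p).eval s = ∑ i : Fin m, p i * s ^ (i : ℕ) := by
  simp [vpoly, eval_finsetSum]

lemma vpoly_deriv_eval {m : ℕ} (p : Fin m → ℝ) (s : ℝ) :
    (derivative (vpoly p)).eval s = ∑ i : Fin m, p i * ((i : ℕ) * s ^ ((i : ℕ) - 1)) := by
  simp [vpoly, eval_finsetSum, derivative_X_pow]

lemma vpoly_natDegree {n : ℕ} (p : Fin (n + 1) → ℝ) : (vpoly p).natDegree ≤ n := by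
  refine natDegree_sum_le_of_forall_le _ _ fun i _ => ?_
  exact (natDegree_C_mul_X_pow_le _ _).trans (by omega)

lemma vpoly_eq_zero {m : ℕ} (p : Fin m → ℝ) (h : vpoly p = 0) : p = 0 := by
  ext i
  rw [← vpoly_coeff p i, h]
  simp

lemma vpoly_lin {m : ℕ} (p q : Fin m → ℝ) (a b : ℝ) :
    vpoly (a • p + b • q) = C a * vpoly p + C b * vpoly q := by
  simp [vpoly, Finset.mul_sum, ← Finset.sum_add_distrib, add_mul, mul_assoc]

/-- Wronskian of two polynomials given by coefficient vectors. -/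
noncomputable def vwr {m : ℕ} (p q : Fin m → ℝ) : Polynomial ℝ :=
  vpoly p * derivative (vpoly q) - derivative (vpoly p) * vpoly q

lemma vwr_natDegree {n : ℕ} (hn : 1 ≤ n) (p q : Fin (n + 1) → ℝ) :
    (vwr p q).natDegree ≤ 2 * n - 2 := by
  have hp := vpoly_natDegree p
  have hq := vpoly_natDegree q
  have hp' : (derivative (vpoly p)).natDegree ≤ n - 1 :=
    (natDegree_derivative_le _).trans (by omega)
  have hq' : (derivative (vpoly q)).natDegree ≤ n - 1 :=
    (natDegree_derivative_le _).trans (by omega)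
  rw [natDegree_le_iff_coeff_eq_zero]
  intro N hN
  rcases eq_or_lt_of_le (by omega : 2 * n - 1 ≤ N) with h | h
  · have e1 : N = n + (n - 1) := by omega
    have e2 : N = (n - 1) + n := by omega
    rw [vwr, coeff_sub]
    conv_lhs => arg 1; rw [e1]
    conv_lhs => arg 2; rw [e2]
    rw [coeff_mul_add_eq_of_natDegree_le hp hq', coeff_mul_add_eq_of_natDegree_le hp' hq, coeff_derivative,
      coeff_derivative]
    rw [Nat.sub_add_cancel hn]
    ring
  · refine coeff_eq_zero_of_natDegree_lt (lt_of_le_of_lt ?_ h)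
    refine (natDegree_sub_le _ _).trans (max_le ?_ ?_)
    · exact (natDegree_mul_le_of_le hp hq').trans (by omega)
    · exact (natDegree_mul_le_of_le hp' hq).trans (by omega)

lemma vwr_eval {m : ℕ} (p q : Fin m → ℝ) (s : ℝ) :
    (vwr p q).eval s = (vpoly p).eval s * (derivative (vpoly q)).eval s -
      (derivative (vpoly p)).eval s * (vpoly q).eval s := by
  simp [vwr]

lemma vpoly_smul {m : ℕ} (p : Fin m → ℝ) (a : ℝ) : vpoly (a • p) = C a * vpoly p := by
  simp [vpoly, Finset.mul_sum, mul_assoc]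

lemma vwr_smul {m : ℕ} (p q : Fin m → ℝ) (a b : ℝ) :
    vwr (a • p) (b • q) = C (a * b) * vwr p q := by
  simp only [vwr, vpoly_smul, derivative_mul, derivative_C, zero_mul, zero_add, C_mul]
  ring

/-- The node `i / (N+1)`. -/
noncomputable def node (N : ℕ) (i : Fin (N + 1)) : ℝ := (i : ℝ) / (N + 1)

lemma node_mem (N : ℕ) (i : Fin (N + 1)) : node N i ∈ Icc (0 : ℝ) 1 := by
  unfold node
  have : (i : ℝ) ≤ N + 1 := by exact_mod_cast i.2.le
  refine ⟨by positivity, ?_⟩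
  rw [div_le_one (by positivity)]
  exact this

lemma node_inj (N : ℕ) : Function.Injective (node N) := by
  intro i j h
  unfold node at h
  have h2 : (N : ℝ) + 1 ≠ 0 := by positivity
  rw [div_left_inj' h2] at h
  exact Fin.ext (by exact_mod_cast h)

lemma vpoly_lower (n : ℕ) : ∃ c : ℝ, 0 < c ∧ ∀ p : Fin (n + 1) → ℝ,
    ∃ s ∈ Icc (0 : ℝ) 1, c * ‖p‖ ≤ |(vpoly p).eval s| := by
  have hK : IsCompact (Metric.sphere (0 : Fin (n + 1) → ℝ) 1) := isCompact_sphere _ _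
  obtain ⟨c, hc, hc'⟩ := hK.exists_forall_le' (a := 0)
    (f := fun p => ‖fun i : Fin (n + 1) => (vpoly p).eval (node n i)‖) (by
      simp only [vpoly_eval]
      fun_prop) (by
      intro p hp
      rw [norm_pos_iff]
      intro h0
      have : vpoly p = 0 := eq_zero_of_natDegree_lt_card_of_eval_eq_zero _ (node_inj n)
        (fun i => congrFun h0 i) (by simpa using Nat.lt_succ_of_le (vpoly_natDegree p))
      rw [vpoly_eq_zero p this] at hp
      simp at hp)
  refine ⟨c, hc, fun p => ?_⟩
  by_cases hp : p = 0
  · exact ⟨0, by simp, by simp [hp]⟩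
  have hpn : ‖p‖ ≠ 0 := norm_ne_zero_iff.mpr hp
  have h1 := hc' (‖p‖⁻¹ • p) (by simp [norm_smul, hpn])
  obtain ⟨i, hi⟩ : ∃ i : Fin (n + 1), c ≤ |(vpoly (‖p‖⁻¹ • p)).eval (node n i)| := by
    by_contra hcon
    push Not at hcon
    exact absurd h1 (not_le.mpr ((pi_norm_lt_iff hc).mpr hcon))
  refine ⟨node n i, node_mem n i, ?_⟩
  rw [vpoly_smul, eval_mul, eval_C, abs_mul, abs_inv, abs_norm, ← div_eq_inv_mul,
    le_div_iff₀ (by positivity)] at hi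
  exact hi

lemma vwr_lower (n : ℕ) (hn : 1 ≤ n) : ∃ c : ℝ, 0 < c ∧ ∀ p q : Fin (n + 1) → ℝ, p ⬝ᵥ q = 0 →
    ∃ s ∈ Icc (0 : ℝ) 1, c * (‖p‖ * ‖q‖) ≤ |(vwr p q).eval s| := by
  have hK : IsCompact ((Metric.sphere (0 : Fin (n + 1) → ℝ) 1 ×ˢ
      Metric.sphere (0 : Fin (n + 1) → ℝ) 1) ∩ {z | z.1 ⬝ᵥ z.2 = 0}) := by
    refine ((isCompact_sphere _ _).prod (isCompact_sphere _ _)).inter_right ?_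
    refine isClosed_eq ?_ continuous_const
    simp only [dotProduct]
    fun_prop
  obtain ⟨c, hc, hc'⟩ := hK.exists_forall_le' (a := 0)
    (f := fun z => ‖fun i : Fin (2 * n + 1) => (vwr z.1 z.2).eval (node (2 * n) i)‖) (by
      simp only [vwr_eval, vpoly_eval, vpoly_deriv_eval]
      fun_prop) (by
      rintro ⟨p, q⟩ ⟨⟨hp, hq⟩, hpq⟩
      rw [norm_pos_iff]
      intro h0
      have hp0 : p ≠ 0 := by rintro rfl; simp at hp
      have hq0 : q ≠ 0 := by rintro rfl; simp at hq
      have : vwr p q = 0 := eq_zero_of_natDegree_lt_card_of_eval_eq_zero _ (node_inj (2 * n))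
        (fun i => congrFun h0 i) (by
          have := vwr_natDegree hn p q
          simp only [Fintype.card_fin]
          omega)
      obtain ⟨a, b, hab, h⟩ := wronskian_zero _ _ this
      rw [← vpoly_lin] at h
      have hz := vpoly_eq_zero _ h
      have hpq' : p ⬝ᵥ q = 0 := hpq
      have h1 : a * (p ⬝ᵥ p) = 0 := by
        have := congrArg (fun w => p ⬝ᵥ w) hz
        simpa [hpq'] using this
      have h2 : b * (q ⬝ᵥ q) = 0 := by
        have := congrArg (fun w => q ⬝ᵥ w) hz
        simpa [dotProduct_comm q p, hpq'] using this
      have h3 : p ⬝ᵥ p ≠ 0 := fun h => hp0 (dotProduct_self_eq_zero.mp h)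
      have h4 : q ⬝ᵥ q ≠ 0 := fun h => hq0 (dotProduct_self_eq_zero.mp h)
      rcases hab with h | h
      · exact h ((mul_eq_zero.mp h1).resolve_right h3)
      · exact h ((mul_eq_zero.mp h2).resolve_right h4))
  refine ⟨c, hc, fun p q hpq => ?_⟩
  by_cases hp : p = 0
  · exact ⟨0, by simp, by simp [hp]⟩
  by_cases hq : q = 0
  · exact ⟨0, by simp, by simp [hq]⟩
  have hpn : ‖p‖ ≠ 0 := norm_ne_zero_iff.mpr hp
  have hqn : ‖q‖ ≠ 0 := norm_ne_zero_iff.mpr hq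
  have h1 := hc' (‖p‖⁻¹ • p, ‖q‖⁻¹ • q) (by
    refine ⟨⟨by simp [norm_smul, hpn], by simp [norm_smul, hqn]⟩, ?_⟩
    simp [hpq])
  obtain ⟨i, hi⟩ : ∃ i : Fin (2 * n + 1),
      c ≤ |(vwr (‖p‖⁻¹ • p) (‖q‖⁻¹ • q)).eval (node (2 * n) i)| := by
    by_contra hcon
    push Not at hcon
    exact absurd h1 (not_le.mpr ((pi_norm_lt_iff hc).mpr hcon))
  refine ⟨node (2 * n) i, node_mem _ i, ?_⟩
  rw [vwr_smul, eval_mul, eval_C, ← mul_inv, abs_mul, abs_inv, abs_of_nonneg (by positivity : 0 ≤ ‖p‖ * ‖q‖),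
    ← div_eq_inv_mul, le_div_iff₀ (by positivity)] at hi
  exact hi
end

section
open MeasureTheory Set Polynomial
open scoped ENNReal Nat

lemma taylor_aux (n : ℕ) : ∀ (g : ℕ → ℝ → ℝ) (u v ω : ℝ), u ≤ v →
    (∀ i < n, ∀ y ∈ Icc u v, HasDerivAt (g i) (g (i + 1) y) y) →
    (∀ y ∈ Icc u v, |g n y - g n u| ≤ ω) →
    ∀ y ∈ Icc u v, |g 0 y - ∑ i ∈ Finset.range (n + 1), g i u / i ! * (y - u) ^ i| ≤
      ω * (v - u) ^ n := by
  induction n with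
  | zero =>
    intro g u v ω huv _ h y hy
    simpa using h y hy
  | succ n ih =>
    intro g u v ω huv hd h y hy
    have ih' := ih (fun i => g (i + 1)) u v ω huv (fun i hi y hy => hd (i + 1) (by omega) y hy) h
    set T : ℝ → ℝ := fun y => g 0 y - ∑ i ∈ Finset.range (n + 2), g i u / i ! * (y - u) ^ i with hT
    have hTd : ∀ z ∈ Icc u v, HasDerivAt T (g 1 z -
        ∑ i ∈ Finset.range (n + 1), g (i + 1) u / i ! * (z - u) ^ i) z := by
      intro z hz
      refine (hd 0 (by omega) z hz).sub ?_
      have : ∀ i ∈ Finset.range (n + 2), HasDerivAt (fun y => g i u / i ! * (y - u) ^ i)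
          (g i u / i ! * (i * (z - u) ^ (i - 1))) z := by
        intro i _
        have h1 := (((hasDerivAt_id z).sub_const u).pow i).const_mul (g i u / i !)
        simpa using h1
      have hs := HasDerivAt.fun_sum this
      convert hs using 1
      rw [Finset.sum_range_succ' _ (n + 1)]
      simp only [Nat.cast_zero, zero_mul, mul_zero, add_zero]
      refine Finset.sum_congr rfl fun i _ => ?_
      rw [Nat.factorial_succ]
      push_cast
      have h1 : (i ! : ℝ) ≠ 0 := by positivity
      have h2 : (i : ℝ) + 1 ≠ 0 := by positivity
      field_simp
    have hTu : T u = 0 := by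
      simp [hT, Finset.sum_range_succ']
    have hb := (convex_Icc u v).norm_image_sub_le_of_norm_hasDerivWithin_le
      (fun z hz => (hTd z hz).hasDerivWithinAt) (C := ω * (v - u) ^ n)
      (fun z hz => by rw [Real.norm_eq_abs]; exact ih' z hz) (left_mem_Icc.mpr huv) hy
    rw [hTu, sub_zero, Real.norm_eq_abs, Real.norm_eq_abs] at hb
    refine hb.trans ?_
    have hω : 0 ≤ ω := (abs_nonneg _).trans (h u (left_mem_Icc.mpr huv))
    have h1 : |y - u| ≤ v - u := by
      rw [abs_of_nonneg (by linarith [hy.1])]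
      linarith [hy.2]
    have h2 : 0 ≤ v - u := by linarith
    calc ω * (v - u) ^ n * |y - u| ≤ ω * (v - u) ^ n * (v - u) := by gcongr
      _ = _ := by ring

/-- The coefficient map: Taylor coefficients at `u`, rescaled to unit length. -/
noncomputable def coefMap {n : ℕ} (Φ : ℕ → Fin (n + 1) → ℝ → ℝ) (u ℓ : ℝ) :
    (Fin (n + 1) → ℝ) →ₗ[ℝ] (Fin (n + 1) → ℝ) where
  toFun c := fun i => ℓ ^ (i : ℕ) / (i : ℕ)! * ∑ j, c j * Φ i j u
  map_add' c d := by
    ext i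
    simp [add_mul, Finset.sum_add_distrib, mul_add]
  map_smul' a c := by
    ext i
    simp only [Pi.smul_apply, smul_eq_mul, RingHom.id_apply, mul_assoc, ← Finset.mul_sum]
    ring

/-- `c · Φ`. -/
noncomputable def Ufun {n : ℕ} (Φ : ℕ → Fin (n + 1) → ℝ → ℝ) (i : ℕ) (c : Fin (n + 1) → ℝ)
    (y : ℝ) : ℝ := ∑ j, c j * Φ i j y

lemma coef_close {n : ℕ} (hn : 1 ≤ n) (Φ : ℕ → Fin (n + 1) → ℝ → ℝ) (u v ω : ℝ) (huv : u < v)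
    (hd : ∀ i < n, ∀ j, ∀ y ∈ Icc u v, HasDerivAt (Φ i j) (Φ (i + 1) j y) y)
    (hω : ∀ j, ∀ y ∈ Icc u v, |Φ n j y - Φ n j u| ≤ ω) (c : Fin (n + 1) → ℝ) (y : ℝ)
    (hy : y ∈ Icc u v) :
    |Ufun Φ 0 c y - (vpoly (coefMap Φ u (v - u) c)).eval ((y - u) / (v - u))| ≤
      (n + 1) * ω * ‖c‖ * (v - u) ^ n ∧
    |(v - u) * Ufun Φ 1 c y -
      (derivative (vpoly (coefMap Φ u (v - u) c))).eval ((y - u) / (v - u))| ≤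
      (n + 1) * ω * ‖c‖ * (v - u) ^ n := by
  have hℓ : 0 < v - u := by linarith
  have hdU : ∀ i < n, ∀ y ∈ Icc u v, HasDerivAt (Ufun Φ i c) (Ufun Φ (i + 1) c y) y := by
    intro i hi y hy
    exact HasDerivAt.fun_sum fun j _ => (hd i hi j y hy).const_mul (c j)
  have hωU : ∀ y ∈ Icc u v, |Ufun Φ n c y - Ufun Φ n c u| ≤ (n + 1) * ω * ‖c‖ := by
    intro y hy
    unfold Ufun
    rw [← Finset.sum_sub_distrib]
    calc |∑ j, (c j * Φ n j y - c j * Φ n j u)| ≤ ∑ j, |c j * Φ n j y - c j * Φ n j u| :=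
          Finset.abs_sum_le_sum_abs _ _
      _ ≤ ∑ j : Fin (n + 1), ‖c‖ * ω := by
          refine Finset.sum_le_sum fun j _ => ?_
          rw [← mul_sub, abs_mul]
          exact mul_le_mul (norm_le_pi_norm c j) (hω j y hy) (abs_nonneg _) (norm_nonneg _)
      _ = _ := by
          simp
          ring
  constructor
  · have h := taylor_aux n (fun i => Ufun Φ i c) u v _ huv.le hdU hωU y hy
    convert h using 3
    rw [vpoly_eval, Finset.sum_range]
    refine Finset.sum_congr rfl fun i _ => ?_
    simp only [coefMap, LinearMap.coe_mk, AddHom.coe_mk, Ufun, div_pow]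
    field_simp
  · obtain ⟨m, rfl⟩ : ∃ m, n = m + 1 := ⟨n - 1, by omega⟩
    have h := taylor_aux m (fun i => Ufun Φ (i + 1) c) u v _ huv.le
      (fun i hi => hdU (i + 1) (by omega)) hωU y hy
    have e : (v - u) * Ufun Φ 1 c y -
      (derivative (vpoly (coefMap Φ u (v - u) c))).eval ((y - u) / (v - u)) =
      (v - u) * (Ufun Φ 1 c y - ∑ i ∈ Finset.range (m + 1), Ufun Φ (i + 1) c u / i ! * (y - u) ^ i) := by
      rw [mul_sub, vpoly_deriv_eval, Fin.sum_univ_succ, Finset.sum_range]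
      congr 1
      simp only [Fin.val_zero, Nat.cast_zero, zero_mul, mul_zero, zero_add, Finset.mul_sum]
      refine Finset.sum_congr rfl fun i _ => ?_
      simp only [coefMap, LinearMap.coe_mk, AddHom.coe_mk, Ufun, div_pow, Fin.val_succ,
        Nat.factorial_succ, Nat.add_sub_cancel]
      push_cast
      have h2 : ((i : ℕ) : ℝ) + 1 ≠ 0 := by positivity
      field_simp
      ring
    rw [e, abs_mul, abs_of_pos hℓ]
    calc (v - u) * _ ≤ (v - u) * ((((m + 1 : ℕ) : ℝ) + 1) * ω * ‖c‖ * (v - u) ^ m) := by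
          gcongr
      _ = _ := by ring

lemma coef_lower {n : ℕ} (Φ : ℕ → Fin (n + 1) → ℝ → ℝ) (u ℓ κ : ℝ) (hℓ : 0 < ℓ) (hℓ1 : ℓ ≤ 1)
    (c : Fin (n + 1) → ℝ)
    (hκ : ∃ i : Fin (n + 1), κ * ‖c‖ ≤ |Ufun Φ i c u|) :
    κ * ‖c‖ * ℓ ^ n ≤ n ! * ‖coefMap Φ u ℓ c‖ := by
  obtain ⟨i, hi⟩ := hκ
  have h1 := norm_le_pi_norm (coefMap Φ u ℓ c) i
  have h2 : ‖coefMap Φ u ℓ c i‖ = ℓ ^ (i : ℕ) / (i : ℕ)! * |Ufun Φ i c u| := by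
    simp only [coefMap, LinearMap.coe_mk, AddHom.coe_mk, Ufun, Real.norm_eq_abs, abs_mul]
    rw [abs_of_nonneg (by positivity)]
  rw [h2] at h1
  have hin : (i : ℕ) ≤ n := by omega
  have h3 : ((i : ℕ)! : ℝ) ≤ n ! := by exact_mod_cast Nat.factorial_le hin
  have h4 : ℓ ^ n ≤ ℓ ^ (i : ℕ) := pow_le_pow_of_le_one hℓ.le hℓ1 hin
  have h5 : ℓ ^ (i : ℕ) * |Ufun Φ i c u| ≤ (i : ℕ)! * ‖coefMap Φ u ℓ c‖ := by
    have : (0 : ℝ) < (i : ℕ)! := by positivity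
    rw [div_mul_eq_mul_div, div_le_iff₀ this] at h1
    linarith
  calc κ * ‖c‖ * ℓ ^ n ≤ |Ufun Φ i c u| * ℓ ^ (i : ℕ) := by gcongr
    _ ≤ (i : ℕ)! * ‖coefMap Φ u ℓ c‖ := by linarith
    _ ≤ _ := by gcongr

lemma exists_eps0 (N : ℕ) (hN : 1 ≤ N) : ∃ ε₀ : ℝ, 0 < ε₀ ∧ ε₀ < 1 ∧
    2 * (4 * (N + 1) * ((N + 1) * (3 * ε₀)) ^ ((N : ℝ)⁻¹)) ≤ ε₀ ^ (((N : ℝ) + 1)⁻¹) := by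
  set A : ℝ := 8 * (N + 1) * (3 * (N + 1)) ^ ((N : ℝ)⁻¹) with hA
  have hApos : 0 < A := by positivity
  have hN0 : (0 : ℝ) < N := by exact_mod_cast hN
  set e : ℝ := (N : ℝ)⁻¹ - ((N : ℝ) + 1)⁻¹ with he
  have hepos : 0 < e := by
    rw [he, sub_pos]
    exact inv_strictAnti₀ hN0 (by linarith)
  refine ⟨(A + 1) ^ (-e⁻¹), by positivity, ?_, ?_⟩
  · exact Real.rpow_lt_one_of_one_lt_of_neg (by linarith) (by simpa using hepos)
  set ε₀ : ℝ := (A + 1) ^ (-e⁻¹) with hε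
  have hεpos : 0 < ε₀ := by positivity
  have h1 : ε₀ ^ e = (A + 1)⁻¹ := by
    rw [hε, ← Real.rpow_mul (by positivity)]
    rw [neg_mul, inv_mul_cancel₀ hepos.ne', Real.rpow_neg_one]
  have h2 : ε₀ ^ ((N : ℝ)⁻¹) = (A + 1)⁻¹ * ε₀ ^ (((N : ℝ) + 1)⁻¹) := by
    rw [← h1, ← Real.rpow_add hεpos]
    congr 1
    rw [he]
    ring
  have h3 : 2 * (4 * (N + 1) * ((N + 1) * (3 * ε₀)) ^ ((N : ℝ)⁻¹)) = A * ε₀ ^ ((N : ℝ)⁻¹) := by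
    rw [show (N + 1) * (3 * ε₀) = (3 * ((N : ℝ) + 1)) * ε₀ by ring,
      Real.mul_rpow (by positivity) hεpos.le, hA]
    ring
  rw [h3, h2, ← mul_assoc]
  have h4 : A * (A + 1)⁻¹ ≤ 1 := by
    rw [← div_eq_mul_inv, div_le_one (by positivity)]
    linarith
  have h5 : 0 ≤ ε₀ ^ (((N : ℝ) + 1)⁻¹) := by positivity
  nlinarith

/-- One step from closeness to a polynomial. -/
lemma os_of_close (N : ℕ) (hN : 1 ≤ N) (q : ℝ[X]) (hq : q.natDegree ≤ N) (H : ℝ → ℝ) (u v ε₀ B : ℝ)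
    (huv : u < v) (hε₀ : 0 < ε₀) (hε₁ : ε₀ < 1)
    (hB : ∃ s ∈ Icc (0 : ℝ) 1, B ≤ |q.eval s|)
    (hH : ∀ y ∈ Icc u v, |H y - q.eval ((y - u) / (v - u))| ≤ ε₀ * B) (x : ℝ) (hx : x ∈ Icc u v) :
    volume {y ∈ Icc u v | |H y| < ε₀ * |H x|} ≤
      ENNReal.ofReal (4 * (N + 1) * ((N + 1) * (3 * ε₀)) ^ ((N : ℝ)⁻¹) * (v - u)) := by
  have hℓ : 0 < v - u := by linarith
  obtain ⟨z, hz, hzmax⟩ := isCompact_Icc.exists_isMaxOn (s := Icc u v)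
    (f := fun y => |q.eval ((y - u) / (v - u))|) (nonempty_Icc.mpr huv.le) (by fun_prop)
  set Q : ℝ[X] := q.comp (C (v - u)⁻¹ * (X - C u)) with hQ
  have hQe : ∀ y, Q.eval y = q.eval ((y - u) / (v - u)) := by
    intro y
    rw [hQ, eval_comp]
    simp [div_eq_inv_mul]
  have hQd : Q.natDegree ≤ N := by
    refine natDegree_comp_le.trans ?_
    have : (C (v - u)⁻¹ * (X - C u)).natDegree ≤ 1 := by
      refine (natDegree_C_mul_le _ _).trans ?_
      exact natDegree_X_sub_C_le u
    calc _ ≤ N * 1 := Nat.mul_le_mul hq this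
      _ = N := by ring
  set M := |Q.eval z| with hM
  have hmax : ∀ y ∈ Icc u v, |Q.eval y| ≤ M := by
    intro y hy
    rw [hM, hQe, hQe]
    exact hzmax hy
  have hBM : B ≤ M := by
    obtain ⟨s, hs, hs'⟩ := hB
    have h1 : u + s * (v - u) ∈ Icc u v := ⟨by nlinarith [hs.1], by nlinarith [hs.2]⟩
    have h2 := hmax _ h1
    rw [hQe, show (u + s * (v - u) - u) / (v - u) = s by field_simp; ring] at h2
    exact hs'.trans h2
  have hHQ : ∀ y ∈ Icc u v, |H y - Q.eval y| ≤ ε₀ * M := by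
    intro y hy
    rw [hQe]
    exact (hH y hy).trans (by gcongr)
  have hHM : |H x| ≤ M + ε₀ * M := by
    calc |H x| = |Q.eval x + (H x - Q.eval x)| := by ring_nf
      _ ≤ _ := (abs_add_le _ _).trans (add_le_add (hmax x hx) (hHQ x hx))
  rcases eq_or_lt_of_le (abs_nonneg (Q.eval z)) with h0 | h0
  · have hM0 : M = 0 := h0.symm
    have : {y ∈ Icc u v | |H y| < ε₀ * |H x|} = ∅ := by
      ext y
      simp only [mem_sep_iff, mem_empty_iff_false, iff_false, not_and, not_lt]
      intro _
      have : |H x| ≤ 0 := by simpa [hM0] using hHM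
      nlinarith [abs_nonneg (H y)]
    rw [this]
    simp
  · refine le_trans (measure_mono ?_) (remez N hN Q hQd u v huv z hz (3 * ε₀) (by positivity) h0)
    rintro y ⟨hy, hy'⟩
    refine ⟨hy, ?_⟩
    have h1 : |Q.eval y| ≤ |H y| + ε₀ * M := by
      calc |Q.eval y| = |H y + -(H y - Q.eval y)| := by ring_nf
        _ ≤ _ := (abs_add_le _ _).trans (by rw [abs_neg]; exact add_le_add le_rfl (hHQ y hy))
    show |Q.eval y| ≤ 3 * ε₀ * M
    have h2 : ε₀ * |H x| ≤ ε₀ * (M + ε₀ * M) := by gcongr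
    have hMp : 0 < M := h0
    nlinarith [mul_pos hε₀ hMp]
end

section
open MeasureTheory Set Polynomial
open scoped ENNReal Nat

/-- Wronskian-type function. -/
noncomputable def Gfun {n : ℕ} (Φ : ℕ → Fin (n + 1) → ℝ → ℝ) (c d : Fin (n + 1) → ℝ)
    (y : ℝ) : ℝ := Ufun Φ 0 c y * Ufun Φ 1 d y - Ufun Φ 1 c y * Ufun Φ 0 d y

lemma Ufun_lin {n : ℕ} (Φ : ℕ → Fin (n + 1) → ℝ → ℝ) (i : ℕ) (c d : Fin (n + 1) → ℝ) (a y : ℝ) :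
    Ufun Φ i (d - a • c) y = Ufun Φ i d y - a * Ufun Φ i c y := by
  simp [Ufun, sub_mul, Finset.sum_sub_distrib, Finset.mul_sum, mul_assoc]

lemma Gfun_shift {n : ℕ} (Φ : ℕ → Fin (n + 1) → ℝ → ℝ) (c d : Fin (n + 1) → ℝ) (a : ℝ) :
    Gfun Φ c (d - a • c) = Gfun Φ c d := by
  ext y
  simp only [Gfun, Ufun_lin]
  ring

lemma Gfun_zero {n : ℕ} (Φ : ℕ → Fin (n + 1) → ℝ → ℝ) (d : Fin (n + 1) → ℝ) :
    Gfun Φ 0 d = fun _ => 0 := by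
  ext y
  simp [Gfun, Ufun]

/-- Uniform smallness hypotheses on a box. -/
structure Box {n : ℕ} (Φ : ℕ → Fin (n + 1) → ℝ → ℝ) (a b ω κ : ℝ) : Prop where
  hab : a < b
  hlen : b - a ≤ 1
  hω : 0 ≤ ω
  hκ : 0 < κ
  hd : ∀ i < n, ∀ j, ∀ y ∈ Icc a b, HasDerivAt (Φ i j) (Φ (i + 1) j y) y
  hosc : ∀ j, ∀ y ∈ Icc a b, ∀ u ∈ Icc a b, |Φ n j y - Φ n j u| ≤ ω
  hlow : ∀ u ∈ Icc a b, ∀ c : Fin (n + 1) → ℝ, ∃ i : Fin (n + 1), κ * ‖c‖ ≤ |Ufun Φ i c u|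

lemma Box.close {n : ℕ} (hn : 1 ≤ n) {Φ : ℕ → Fin (n + 1) → ℝ → ℝ} {a b ω κ : ℝ}
    (h : Box Φ a b ω κ) (u v : ℝ) (hau : a ≤ u) (huv : u < v) (hvb : v ≤ b)
    (c : Fin (n + 1) → ℝ) :
    κ * ‖c‖ * (v - u) ^ n ≤ n ! * ‖coefMap Φ u (v - u) c‖ ∧
    ∀ y ∈ Icc u v,
    |Ufun Φ 0 c y - (vpoly (coefMap Φ u (v - u) c)).eval ((y - u) / (v - u))| ≤
      ((n + 1) * ω * n ! / κ) * ‖coefMap Φ u (v - u) c‖ ∧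
    |(v - u) * Ufun Φ 1 c y -
      (derivative (vpoly (coefMap Φ u (v - u) c))).eval ((y - u) / (v - u))| ≤
      ((n + 1) * ω * n ! / κ) * ‖coefMap Φ u (v - u) c‖ := by
  have hsub : Icc u v ⊆ Icc a b := Icc_subset_Icc hau hvb
  have hu : u ∈ Icc u v := left_mem_Icc.mpr huv.le
  have h1 := coef_lower Φ u (v - u) κ (by linarith) (by linarith [h.hlen]) c
    (h.hlow u (hsub hu) c)
  refine ⟨h1, fun y hy => ?_⟩
  have h2 := coef_close hn Φ u v ω huv (fun i hi j y hy => h.hd i hi j y (hsub hy))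
    (fun j y hy => h.hosc j y (hsub hy) u (hsub hu)) c y hy
  have h3 : (n + 1) * ω * ‖c‖ * (v - u) ^ n ≤
      ((n + 1) * ω * n ! / κ) * ‖coefMap Φ u (v - u) c‖ := by
    have := h.hκ
    have hw := h.hω
    rw [div_mul_eq_mul_div, le_div_iff₀ this]
    calc (n + 1) * ω * ‖c‖ * (v - u) ^ n * κ = (n + 1) * ω * (κ * ‖c‖ * (v - u) ^ n) := by ring
      _ ≤ (n + 1) * ω * (n ! * ‖coefMap Φ u (v - u) c‖) := by gcongr
      _ = _ := by ring
  exact ⟨h2.1.trans h3, h2.2.trans h3⟩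

lemma vpoly_bound {n : ℕ} (p : Fin (n + 1) → ℝ) (s : ℝ) (hs : s ∈ Icc (0 : ℝ) 1) :
    |(vpoly p).eval s| ≤ (n + 1) ^ 2 * ‖p‖ ∧ |(derivative (vpoly p)).eval s| ≤ (n + 1) ^ 2 * ‖p‖ := by
  have hs' : ∀ k : ℕ, |s ^ k| ≤ 1 := by
    intro k
    rw [abs_of_nonneg (pow_nonneg hs.1 k)]
    exact pow_le_one₀ hs.1 hs.2
  constructor
  · rw [vpoly_eval]
    calc _ ≤ ∑ i : Fin (n + 1), |p i * s ^ (i : ℕ)| := Finset.abs_sum_le_sum_abs _ _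
      _ ≤ ∑ i : Fin (n + 1), ‖p‖ * 1 := by
        refine Finset.sum_le_sum fun i _ => ?_
        rw [abs_mul]
        exact mul_le_mul (norm_le_pi_norm p i) (hs' _) (abs_nonneg _) (norm_nonneg _)
      _ = (n + 1) * ‖p‖ := by simp
      _ ≤ _ := by
        have : (0 : ℝ) ≤ n := by positivity
        nlinarith [mul_nonneg (mul_nonneg this (by linarith : (0 : ℝ) ≤ n + 1)) (norm_nonneg p)]
  · rw [vpoly_deriv_eval]
    calc _ ≤ ∑ i : Fin (n + 1), |p i * (i * s ^ ((i : ℕ) - 1))| := Finset.abs_sum_le_sum_abs _ _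
      _ ≤ ∑ i : Fin (n + 1), ‖p‖ * ((n + 1) * 1) := by
        refine Finset.sum_le_sum fun i _ => ?_
        rw [abs_mul, abs_mul]
        have hi : |((i : ℕ) : ℝ)| ≤ n + 1 := by
          rw [abs_of_nonneg (by positivity)]
          exact_mod_cast i.2.le
        exact mul_le_mul (norm_le_pi_norm p i) (mul_le_mul hi (hs' _) (abs_nonneg _) (by positivity))
          (by positivity) (norm_nonneg _)
      _ = _ := by
        simp
        ring

lemma mul_close {U P V Q η D p q : ℝ} (hp : 0 ≤ p) (hq : 0 ≤ q) (hη : 0 ≤ η) (hη1 : η ≤ 1)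
    (hD : 0 ≤ D)
    (h1 : |U - P| ≤ η * p) (h2 : |V - Q| ≤ η * q) (h3 : |P| ≤ D * p) (h4 : |Q| ≤ D * q) :
    |U * V - P * Q| ≤ η * (2 * D + 1) * (p * q) := by
  have e : U * V - P * Q = (U - P) * (V - Q) + (U - P) * Q + P * (V - Q) := by ring
  have hb1 : |(U - P) * (V - Q)| ≤ η * p * (1 * q) := by
    rw [abs_mul]
    exact mul_le_mul h1 (h2.trans (by gcongr)) (abs_nonneg _) (by positivity)
  have hb2 : |(U - P) * Q| ≤ η * p * (D * q) := by
    rw [abs_mul]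
    exact mul_le_mul h1 h4 (abs_nonneg _) (by positivity)
  have hb3 : |P * (V - Q)| ≤ D * p * (η * q) := by
    rw [abs_mul]
    exact mul_le_mul h3 h2 (abs_nonneg _) (by positivity)
  rw [e]
  refine (abs_add_three _ _ _).trans ?_
  calc _ ≤ η * p * (1 * q) + η * p * (D * q) + D * p * (η * q) := by gcongr
    _ = _ := by ring

lemma Box.closeG {n : ℕ} (hn : 1 ≤ n) {Φ : ℕ → Fin (n + 1) → ℝ → ℝ} {a b ω κ : ℝ}
    (h : Box Φ a b ω κ) (hη1 : (n + 1) * ω * n ! / κ ≤ 1)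
    (u v : ℝ) (hau : a ≤ u) (huv : u < v) (hvb : v ≤ b)
    (c d : Fin (n + 1) → ℝ) : ∀ y ∈ Icc u v,
    |(v - u) * Gfun Φ c d y - (vwr (coefMap Φ u (v - u) c) (coefMap Φ u (v - u) d)).eval
      ((y - u) / (v - u))| ≤ ((n + 1) * ω * n ! / κ) * (2 * (2 * (n + 1) ^ 2 + 1)) *
      (‖coefMap Φ u (v - u) c‖ * ‖coefMap Φ u (v - u) d‖) := by
  intro y hy
  have hℓ : 0 < v - u := by linarith
  have hs : (y - u) / (v - u) ∈ Icc (0 : ℝ) 1 :=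
    ⟨div_nonneg (by linarith [hy.1]) hℓ.le, (div_le_one hℓ).mpr (by linarith [hy.2])⟩
  set p := coefMap Φ u (v - u) c
  set q := coefMap Φ u (v - u) d
  set s := (y - u) / (v - u)
  set η := (n + 1) * ω * n ! / κ with hη
  have hη0 : 0 ≤ η := by
    have := h.hκ
    have := h.hω
    positivity
  obtain ⟨c1, c2⟩ := (h.close hn u v hau huv hvb c).2 y hy
  obtain ⟨d1, d2⟩ := (h.close hn u v hau huv hvb d).2 y hy
  obtain ⟨p1, p2⟩ := vpoly_bound p s hs
  obtain ⟨q1, q2⟩ := vpoly_bound q s hs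
  have hD : (0 : ℝ) ≤ (n + 1) ^ 2 := by positivity
  have e1 := mul_close (norm_nonneg p) (norm_nonneg q) hη0 hη1 hD c1 d2 p1 q2
  have e2 := mul_close (norm_nonneg p) (norm_nonneg q) hη0 hη1 hD c2 d1 p2 q1
  have : (v - u) * Gfun Φ c d y - (vwr p q).eval s =
    (Ufun Φ 0 c y * ((v - u) * Ufun Φ 1 d y) - (vpoly p).eval s * (derivative (vpoly q)).eval s) -
    ((v - u) * Ufun Φ 1 c y * Ufun Φ 0 d y - (derivative (vpoly p)).eval s * (vpoly q).eval s) := by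
    rw [vwr, Gfun]
    simp only [eval_sub, eval_mul]
    ring
  rw [this]
  refine (abs_sub _ _).trans ?_
  linarith

lemma ortho_shift {m : ℕ} (p q : Fin m → ℝ) (hp : p ≠ 0) : ∃ a : ℝ, p ⬝ᵥ (q - a • p) = 0 := by
  refine ⟨(p ⬝ᵥ q) / (p ⬝ᵥ p), ?_⟩
  have : p ⬝ᵥ p ≠ 0 := by
    rwa [Ne, dotProduct_self_eq_zero]
  rw [dotProduct_sub, dotProduct_smul, smul_eq_mul]
  field_simp
  ring

lemma Box.ne_zero {n : ℕ} (hn : 1 ≤ n) {Φ : ℕ → Fin (n + 1) → ℝ → ℝ} {a b ω κ : ℝ}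
    (h : Box Φ a b ω κ) (u v : ℝ) (hau : a ≤ u) (huv : u < v) (hvb : v ≤ b)
    (c : Fin (n + 1) → ℝ) (hc : c ≠ 0) : coefMap Φ u (v - u) c ≠ 0 := by
  intro h0
  have h1 := (h.close hn u v hau huv hvb c).1
  rw [h0, norm_zero, mul_zero] at h1
  have := h.hκ
  have h2 : 0 < ‖c‖ := norm_pos_iff.mpr hc
  have : 0 < v - u := by linarith
  have : 0 < κ * ‖c‖ * (v - u) ^ n := by positivity
  linarith

/-- The local goodness theorem under box hypotheses. -/
lemma box_good {n : ℕ} (hn : 2 ≤ n) : ∃ η₀ C : ℝ, 0 < η₀ ∧ 0 < C ∧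
    ∀ (Φ : ℕ → Fin (n + 1) → ℝ → ℝ) (a b ω κ : ℝ), Box Φ a b ω κ →
      (n + 1) * ω * n ! / κ ≤ η₀ →
      (∀ c, GoodOn C (2 * (n : ℝ) - 1)⁻¹ a b (Ufun Φ 0 c)) ∧
      (∀ c d, GoodOn C (2 * (n : ℝ) - 1)⁻¹ a b (Gfun Φ c d)) ∧
      ∃ κ' : ℝ, 0 < κ' ∧ (∀ c, ∃ x ∈ Icc a b, κ' * ‖c‖ ≤ |Ufun Φ 0 c x|) ∧
        (∀ c d, ∀ i j, ∃ x ∈ Icc a b, κ' * |c i * d j - c j * d i| ≤ |Gfun Φ c d x|) := by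
  set N : ℕ := 2 * n - 2 with hN
  have hN1 : 1 ≤ N := by omega
  obtain ⟨ε₀, hε0, hε1, hε2⟩ := exists_eps0 N hN1
  obtain ⟨c₁, hc1, hlow1⟩ := vpoly_lower n
  obtain ⟨c₂, hc2, hlow2⟩ := vwr_lower n (by omega)
  set D : ℝ := 2 * (2 * (n + 1) ^ 2 + 1) with hD
  have hDpos : 0 < D := by positivity
  have hα : (2 * (n : ℝ) - 1)⁻¹ = ((N : ℝ) + 1)⁻¹ := by
    rw [hN, Nat.cast_sub (by omega)]
    push_cast
    ring_nf
  have hα0 : (0 : ℝ) < ((N : ℝ) + 1)⁻¹ := by positivity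
  refine ⟨min 1 (min (ε₀ * c₁) (ε₀ * c₂ / D)), ε₀ ^ (-((N : ℝ) + 1)⁻¹), by positivity, by positivity, ?_⟩
  intro Φ a b ω κ h hη
  rw [hα]
  set η := (n + 1) * ω * n ! / κ with hηd
  have hη1 : η ≤ 1 := hη.trans (min_le_left _ _)
  have hη2 : η ≤ ε₀ * c₁ := hη.trans ((min_le_right _ _).trans (min_le_left _ _))
  have hη3 : η * D ≤ ε₀ * c₂ := by
    rw [← le_div_iff₀ hDpos]
    exact hη.trans ((min_le_right _ _).trans (min_le_right _ _))
  have hκ := h.hκ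
  have hω := h.hω
  have hab := h.hab
  have hUc : ∀ i ≤ 1, ∀ c, ContinuousOn (Ufun Φ i c) (Icc a b) := by
    intro i hi c
    refine continuousOn_finsetSum _ fun j _ => ContinuousOn.mul continuousOn_const ?_
    intro y hy
    exact (h.hd i (by omega) j y hy).continuousAt.continuousWithinAt
  have hGc : ∀ c d, ContinuousOn (Gfun Φ c d) (Icc a b) := by
    intro c d
    exact ((hUc 0 (by omega) c).mul (hUc 1 le_rfl d)).sub ((hUc 1 le_rfl c).mul (hUc 0 (by omega) d))
  -- key closeness for U
  have keyU : ∀ u v, a ≤ u → u < v → v ≤ b → ∀ c, ∀ y ∈ Icc u v,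
      |Ufun Φ 0 c y - (vpoly (coefMap Φ u (v - u) c)).eval ((y - u) / (v - u))| ≤
      ε₀ * (c₁ * ‖coefMap Φ u (v - u) c‖) := by
    intro u v hau huv hvb c y hy
    refine ((h.close (by omega) u v hau huv hvb c).2 y hy).1.trans ?_
    rw [← mul_assoc]
    gcongr
  have keyG : ∀ u v, a ≤ u → u < v → v ≤ b → ∀ c d, ∀ y ∈ Icc u v,
      |(v - u) * Gfun Φ c d y - (vwr (coefMap Φ u (v - u) c) (coefMap Φ u (v - u) d)).eval
      ((y - u) / (v - u))| ≤
      ε₀ * (c₂ * (‖coefMap Φ u (v - u) c‖ * ‖coefMap Φ u (v - u) d‖)) := by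
    intro u v hau huv hvb c d y hy
    refine (h.closeG (by omega) hη1 u v hau huv hvb c d y hy).trans ?_
    rw [← mul_assoc ε₀]
    gcongr
  refine ⟨?_, ?_, ?_⟩
  · intro c
    refine one_step_good _ a b ε₀ _ _ hε0 hε1 (by positivity) hα0 hε2 (hUc 0 (by omega) c) ?_
    intro u v hau huv hvb x hx
    exact os_of_close N hN1 (vpoly (coefMap Φ u (v - u) c))
      ((vpoly_natDegree _).trans (by omega)) _ u v ε₀ (c₁ * ‖coefMap Φ u (v - u) c‖) huv hε0 hε1
      (hlow1 _) (keyU u v hau huv hvb c) x hx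
  · intro c d
    refine one_step_good _ a b ε₀ _ _ hε0 hε1 (by positivity) hα0 hε2 (hGc c d) ?_
    intro u v hau huv hvb x hx
    by_cases hc : c = 0
    · subst hc
      rw [Gfun_zero]
      simp
    obtain ⟨l, hl⟩ := ortho_shift (coefMap Φ u (v - u) c) (coefMap Φ u (v - u) d)
      (h.ne_zero (by omega) u v hau huv hvb c hc)
    rw [← map_smul, ← map_sub] at hl
    rw [← Gfun_shift Φ c d l]
    set d' := d - l • c
    have := os_of_close N hN1 (vwr (coefMap Φ u (v - u) c) (coefMap Φ u (v - u) d'))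
      (vwr_natDegree (by omega) _ _) (fun y => (v - u) * Gfun Φ c d' y) u v ε₀ _ huv hε0 hε1
      (hlow2 _ _ hl) (keyG u v hau huv hvb c d') x hx
    convert this using 3
    ext y
    have hℓ : 0 < v - u := by linarith
    simp only [abs_mul, abs_of_pos hℓ]
    rw [mul_left_comm, mul_lt_mul_iff_right₀ hℓ]
  · have hℓ : 0 < b - a := by linarith
    set m : ℝ := κ * (b - a) ^ n / n ! with hm
    have hmpos : 0 < m := by positivity
    have hcoef : ∀ c, m * ‖c‖ ≤ ‖coefMap Φ a (b - a) c‖ := by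
      intro c
      have := (h.close (by omega) a b le_rfl hab le_rfl c).1
      rw [hm, div_mul_eq_mul_div, div_le_iff₀ (by positivity)]
      linarith
    have h1ε : 0 < 1 - ε₀ := by linarith
    have hpt : ∀ s ∈ Icc (0 : ℝ) 1, a + s * (b - a) ∈ Icc a b ∧
        (a + s * (b - a) - a) / (b - a) = s := by
      intro s hs
      refine ⟨⟨by nlinarith [hs.1], by nlinarith [hs.2]⟩, by field_simp; ring⟩
    refine ⟨min ((1 - ε₀) * c₁ * m) ((1 - ε₀) * c₂ * (m * m) / 2), by positivity, ?_, ?_⟩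
    · intro c
      obtain ⟨s, hs, hs'⟩ := hlow1 (coefMap Φ a (b - a) c)
      obtain ⟨hx, hx'⟩ := hpt s hs
      refine ⟨_, hx, ?_⟩
      have h1 := keyU a b le_rfl hab le_rfl c _ hx
      rw [hx'] at h1
      have h2 := abs_sub_abs_le_abs_sub ((vpoly (coefMap Φ a (b - a) c)).eval s) (Ufun Φ 0 c (a + s * (b - a)))
      rw [abs_sub_comm] at h2
      calc _ ≤ (1 - ε₀) * c₁ * m * ‖c‖ := by
            gcongr
            exact min_le_left _ _
        _ = (1 - ε₀) * c₁ * (m * ‖c‖) := by ring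
        _ ≤ (1 - ε₀) * c₁ * ‖coefMap Φ a (b - a) c‖ := by
            gcongr
            exact hcoef c
        _ ≤ _ := by linarith
    · intro c d i j
      by_cases hc : c = 0
      · subst hc
        exact ⟨a, left_mem_Icc.mpr hab.le, by simp⟩
      obtain ⟨l, hl⟩ := ortho_shift (coefMap Φ a (b - a) c) (coefMap Φ a (b - a) d)
        (h.ne_zero (by omega) a b le_rfl hab le_rfl c hc)
      rw [← map_smul, ← map_sub] at hl
      rw [← Gfun_shift Φ c d l]
      set d' := d - l • c with hd'
      have hdet : c i * d j - c j * d i = c i * d' j - c j * d' i := by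
        simp [hd']
        ring
      have hdetle : |c i * d j - c j * d i| ≤ 2 * (‖c‖ * ‖d'‖) := by
        rw [hdet]
        refine (abs_sub _ _).trans ?_
        rw [abs_mul, abs_mul]
        have i1 : |c i| ≤ ‖c‖ := norm_le_pi_norm c i
        have i2 : |c j| ≤ ‖c‖ := norm_le_pi_norm c j
        have i3 : |d' i| ≤ ‖d'‖ := norm_le_pi_norm d' i
        have i4 : |d' j| ≤ ‖d'‖ := norm_le_pi_norm d' j
        have j1 := mul_le_mul i1 i4 (abs_nonneg _) (norm_nonneg _)
        have j2 := mul_le_mul i2 i3 (abs_nonneg _) (norm_nonneg _)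
        linarith
      obtain ⟨s, hs, hs'⟩ := hlow2 _ _ hl
      obtain ⟨hx, hx'⟩ := hpt s hs
      refine ⟨_, hx, ?_⟩
      have h1 := keyG a b le_rfl hab le_rfl c d' _ hx
      rw [hx'] at h1
      set x := a + s * (b - a)
      have h2 := abs_sub_abs_le_abs_sub ((vwr (coefMap Φ a (b - a) c) (coefMap Φ a (b - a) d')).eval s)
        ((b - a) * Gfun Φ c d' x)
      rw [abs_sub_comm] at h2
      have h3 : |(b - a) * Gfun Φ c d' x| ≤ |Gfun Φ c d' x| := by
        rw [abs_mul, abs_of_pos hℓ]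
        have := h.hlen
        nlinarith [abs_nonneg (Gfun Φ c d' x)]
      calc _ ≤ (1 - ε₀) * c₂ * (m * m) / 2 * (2 * (‖c‖ * ‖d'‖)) := by
            gcongr
            exact min_le_right _ _
        _ = (1 - ε₀) * c₂ * ((m * ‖c‖) * (m * ‖d'‖)) := by ring
        _ ≤ (1 - ε₀) * c₂ * (‖coefMap Φ a (b - a) c‖ * ‖coefMap Φ a (b - a) d'‖) := by
            gcongr
            · exact hcoef c
            · exact hcoef d'
        _ ≤ _ := by linarith
end

section
open MeasureTheory Set Polynomial
open scoped ENNReal Nat Topology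

lemma exists_box {n : ℕ} (Φ : ℕ → Fin (n + 1) → ℝ → ℝ) (x0 : ℝ)
    (hd : ∀ᶠ y in 𝓝 x0, ∀ i < n, ∀ j, HasDerivAt (Φ i j) (Φ (i + 1) j y) y)
    (hc : ∀ i : Fin (n + 1), ∀ j, ContinuousAt (Φ i j) x0)
    (hdet : (Matrix.of fun (i j : Fin (n + 1)) => Φ i j x0).det ≠ 0) (η₀ : ℝ) (hη₀ : 0 < η₀) :
    ∃ a b ω κ, a < x0 ∧ x0 < b ∧ Box Φ a b ω κ ∧ (n + 1) * ω * n ! / κ ≤ η₀ := by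
  set A := Matrix.of fun (i j : Fin (n + 1)) => Φ i j x0 with hA
  have hAu : IsUnit A.det := isUnit_iff_ne_zero.mpr hdet
  -- bound for the inverse
  set K : ℝ := ∑ i, ∑ j, |A⁻¹ i j| + 1 with hK
  have hKpos : 0 < K := by positivity
  set κ : ℝ := (2 * K)⁻¹ with hκ
  have hκpos : 0 < κ := by positivity
  have hlow0 : ∀ c : Fin (n + 1) → ℝ, ∃ i : Fin (n + 1), 2 * κ * ‖c‖ ≤ |Ufun Φ i c x0| := by
    intro c
    have hmv : ∀ i : Fin (n + 1), (A.mulVec c) i = Ufun Φ i c x0 := by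
      intro i
      simp [Matrix.mulVec, dotProduct, Ufun, hA, mul_comm]
    obtain ⟨i, -, hi⟩ := Finset.exists_max_image Finset.univ (fun i : Fin (n + 1) => |Ufun Φ i c x0|)
      Finset.univ_nonempty
    refine ⟨i, ?_⟩
    have h1 : ‖c‖ ≤ K * |Ufun Φ i c x0| := by
      rw [pi_norm_le_iff_of_nonneg (by positivity)]
      intro k
      have h2 : c k = ∑ j, A⁻¹ k j * Ufun Φ j c x0 := by
        have : c = A⁻¹.mulVec (A.mulVec c) := by
          rw [Matrix.mulVec_mulVec, Matrix.nonsing_inv_mul _ hAu, Matrix.one_mulVec]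
        conv_lhs => rw [this]
        simp only [Matrix.mulVec, dotProduct] at hmv ⊢
        simp only [hmv]
      rw [h2, Real.norm_eq_abs]
      calc _ ≤ ∑ j, |A⁻¹ k j * Ufun Φ j c x0| := Finset.abs_sum_le_sum_abs _ _
        _ ≤ ∑ j, |A⁻¹ k j| * |Ufun Φ i c x0| := by
          refine Finset.sum_le_sum fun j hj => ?_
          rw [abs_mul]
          exact mul_le_mul_of_nonneg_left (hi j hj) (abs_nonneg _)
        _ = (∑ j, |A⁻¹ k j|) * |Ufun Φ i c x0| := by rw [Finset.sum_mul]
        _ ≤ _ := by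
          gcongr
          have := Finset.single_le_sum (f := fun k => ∑ j, |A⁻¹ k j|)
            (fun k _ => Finset.sum_nonneg fun j _ => abs_nonneg _) (Finset.mem_univ k)
          rw [hK]
          linarith
    rw [hκ]
    calc 2 * (2 * K)⁻¹ * ‖c‖ ≤ 2 * (2 * K)⁻¹ * (K * |Ufun Φ i c x0|) := by gcongr
      _ = _ := by field_simp
  set ω : ℝ := η₀ * κ / ((n + 1) * n !) with hω
  have hωpos : 0 < ω := by positivity
  set σ : ℝ := min (κ / (n + 1)) (ω / 2) with hσ
  have hσpos : 0 < σ := by positivity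
  have hcont : ∀ᶠ y in 𝓝 x0, ∀ i : Fin (n + 1), ∀ j, |Φ i j y - Φ i j x0| < σ := by
    rw [Filter.eventually_all]
    intro i
    rw [Filter.eventually_all]
    intro j
    have := Metric.continuousAt_iff'.mp (hc i j) σ hσpos
    simpa [Real.dist_eq] using this
  obtain ⟨δ, hδ, hball⟩ := Metric.eventually_nhds_iff.mp (hd.and hcont)
  set s : ℝ := min (δ / 2) (1 / 2) with hs
  have hspos : 0 < s := by positivity
  have hs1 : s ≤ δ / 2 := min_le_left _ _
  have hs2 : s ≤ 1 / 2 := min_le_right _ _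
  have hin : ∀ y ∈ Icc (x0 - s) (x0 + s), dist y x0 < δ := by
    intro y hy
    rw [Real.dist_eq, abs_lt]
    constructor <;> linarith [hy.1, hy.2]
  refine ⟨x0 - s, x0 + s, ω, κ, by linarith, by linarith, ⟨by linarith, by linarith, hωpos.le, hκpos, ?_, ?_, ?_⟩, ?_⟩
  · intro i hi j y hy
    exact (hball (hin y hy)).1 i hi j
  · intro j y hy u hu
    have h1 := (hball (hin y hy)).2 (Fin.last n) j
    have h2 := (hball (hin u hu)).2 (Fin.last n) j
    simp only [Fin.val_last] at h1 h2
    have h3 : σ ≤ ω / 2 := min_le_right _ _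
    rw [abs_lt] at h1 h2
    rw [abs_le]
    constructor <;> linarith [h1.1, h1.2, h2.1, h2.2]
  · intro u hu c
    obtain ⟨i, hi⟩ := hlow0 c
    refine ⟨i, ?_⟩
    have h1 : |Ufun Φ i c u - Ufun Φ i c x0| ≤ κ * ‖c‖ := by
      unfold Ufun
      rw [← Finset.sum_sub_distrib]
      calc _ ≤ ∑ j, |c j * Φ i j u - c j * Φ i j x0| := Finset.abs_sum_le_sum_abs _ _
        _ ≤ ∑ j : Fin (n + 1), ‖c‖ * (κ / (n + 1)) := by
          refine Finset.sum_le_sum fun j _ => ?_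
          rw [← mul_sub, abs_mul]
          exact mul_le_mul (norm_le_pi_norm c j)
            (((hball (hin u hu)).2 i j).le.trans (min_le_left _ _)) (abs_nonneg _) (norm_nonneg _)
        _ = _ := by
          simp
          field_simp
    have h2 := abs_sub_abs_le_abs_sub (Ufun Φ i c x0) (Ufun Φ i c u)
    rw [abs_sub_comm] at h2
    linarith
  · rw [hω]
    apply le_of_eq
    field_simp

/-- The local package. -/
structure Loc {n : ℕ} (Φ : ℕ → Fin (n + 1) → ℝ → ℝ) (a b C α κ : ℝ) : Prop where
  hab : a < b
  hC : 0 < C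
  hα : 0 < α
  hκ : 0 < κ
  c0 : ∀ j, ContinuousOn (Φ 0 j) (Icc a b)
  c1 : ∀ j, ContinuousOn (Φ 1 j) (Icc a b)
  one : ∀ y, Φ 0 0 y = 1
  zero : ∀ y, Φ 1 0 y = 0
  goodU : ∀ c, GoodOn C α a b (Ufun Φ 0 c)
  goodG : ∀ c d, GoodOn C α a b (Gfun Φ c d)
  lowU : ∀ c, ∃ x ∈ Icc a b, κ * ‖c‖ ≤ |Ufun Φ 0 c x|
  lowG : ∀ c d, ∀ i j, ∃ x ∈ Icc a b, κ * |c i * d j - c j * d i| ≤ |Gfun Φ c d x|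

lemma exists_loc {n : ℕ} (hn : 2 ≤ n) (Φ : ℕ → Fin (n + 1) → ℝ → ℝ) (x0 : ℝ)
    (hd : ∀ᶠ y in 𝓝 x0, ∀ i < n, ∀ j, HasDerivAt (Φ i j) (Φ (i + 1) j y) y)
    (hc : ∀ i : Fin (n + 1), ∀ j, ContinuousAt (Φ i j) x0)
    (hdet : (Matrix.of fun (i j : Fin (n + 1)) => Φ i j x0).det ≠ 0)
    (one : ∀ y, Φ 0 0 y = 1) (zero : ∀ y, Φ 1 0 y = 0) :
    ∃ a b C κ, a < x0 ∧ x0 < b ∧ Loc Φ a b C (2 * (n : ℝ) - 1)⁻¹ κ := by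
  obtain ⟨η₀, C, hη₀, hC, H⟩ := box_good hn
  obtain ⟨a, b, ω, κ, ha, hb, hbox, hη⟩ := exists_box Φ x0 hd hc hdet η₀ hη₀
  obtain ⟨h1, h2, κ', hκ', h3, h4⟩ := H Φ a b ω κ hbox hη
  have h2n : (2 : ℝ) ≤ n := by exact_mod_cast hn
  exact ⟨a, b, C, κ', ha, hb, hbox.hab, hC, inv_pos.mpr (by linarith), hκ',
    fun j y hy => (hbox.hd 0 (by omega) j y hy).continuousAt.continuousWithinAt,
    fun j y hy => (hbox.hd 1 (by omega) j y hy).continuousAt.continuousWithinAt,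
    one, zero, h1, h2, h3, h4⟩
end

section
open MeasureTheory Set
open scoped ENNReal Topology

/-- cast an integer vector -/
def zc {m : ℕ} (v : Fin m → ℤ) : Fin m → ℝ := fun i => (v i : ℝ)

/-- rows -/
noncomputable def Drow {k : ℕ} (M : Fin k → Fin k → ℝ) : ℝ := Matrix.detRowAlternating M

lemma Drow_eq {k : ℕ} (M : Fin k → Fin k → ℝ) : Drow M = (Matrix.of M).det := rfl

lemma Drow_scale {m k : ℕ} (A A' : Fin k → Fin m → ℝ)
    (h : ∀ r, A' r ∈ Submodule.span ℝ (range A)) :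
    ∃ d : ℝ, ∀ g : Fin k → ((Fin m → ℝ) →ₗ[ℝ] ℝ),
      Drow (fun s r => g s (A' r)) = d * Drow (fun s r => g s (A r)) := by
  have h' : ∀ r, ∃ c : Fin k → ℝ, ∑ i, c i • A i = A' r := fun r =>
    (Submodule.mem_span_range_iff_exists_fun ℝ).mp (h r)
  choose P hP using h'
  refine ⟨(Matrix.of P).det, fun g => ?_⟩
  rw [Drow_eq, Drow_eq, mul_comm, ← Matrix.det_transpose (Matrix.of P), ← Matrix.det_mul]
  congr 1
  ext s r
  simp only [Matrix.of_apply, Matrix.mul_apply, Matrix.transpose_apply]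
  rw [← hP r, map_sum]
  refine Finset.sum_congr rfl fun i _ => ?_
  rw [map_smul, smul_eq_mul, mul_comm]

lemma exists_minor {m k : ℕ} (A : Fin k → Fin m → ℝ) (hA : LinearIndependent ℝ A) :
    ∃ τ : Fin k → Fin m, Drow (fun s r => A r (τ s)) ≠ 0 := by
  -- columns span
  set col : Fin m → (Fin k → ℝ) := fun j r => A r j with hcol
  have hspan : Submodule.span ℝ (range col) = ⊤ := by
    by_contra hne
    obtain ⟨f, hf, hf'⟩ := Submodule.exists_le_ker_of_lt_top _ (lt_top_iff_ne_top.mpr hne)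
    apply hf
    have hz : ∀ j, f (col j) = 0 := fun j => hf' (Submodule.subset_span ⟨j, rfl⟩)
    have hsum : ∑ r, f (Pi.single r 1) • A r = 0 := by
      ext j
      have := hz j
      rw [LinearMap.pi_apply_eq_sum_univ f (col j)] at this
      simp only [Finset.sum_apply, Pi.smul_apply, smul_eq_mul, Pi.zero_apply]
      rw [← this]
      refine Finset.sum_congr rfl fun r _ => ?_
      simp only [hcol, smul_eq_mul, mul_comm]
      congr 2
      ext i
      simp [Pi.single_apply, eq_comm]
    have h0 := Fintype.linearIndependent_iff.mp hA _ hsum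
    apply LinearMap.pi_ext'
    intro r
    ext
    simpa using h0 r
  obtain ⟨ι, a, hinj, hsp, hli⟩ := exists_linearIndependent' ℝ col
  have hsp' : ⊤ ≤ Submodule.span ℝ (range (col ∘ a)) := by rw [hsp, hspan]
  let B := Module.Basis.mk hli hsp'
  have : Fintype ι := Fintype.ofInjective a hinj
  have hcard : Fintype.card ι = k := by
    have := Module.finrank_eq_card_basis B
    simpa using this.symm
  let e : Fin k ≃ ι := (Fintype.equivFinOfCardEq hcard).symm
  refine ⟨a ∘ e, ?_⟩
  have hli2 : LinearIndependent ℝ (fun s => col (a (e s))) := hli.comp e e.injective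
  have := hli2
  rw [Drow_eq]
  have hu := (Matrix.linearIndependent_rows_iff_isUnit (A := Matrix.of fun s r => A r ((a ∘ e) s))).mp hli2
  exact ((Matrix.isUnit_iff_isUnit_det _).mp hu).ne_zero

/-- Integer representative of a subspace -/
def IRep {m : ℕ} (W : Submodule ℝ (Fin m → ℝ)) (k : ℕ) (A : Fin k → Fin m → ℤ) : Prop :=
  LinearIndependent ℝ (fun r => zc (A r)) ∧ Submodule.span ℝ (range fun r => zc (A r)) = W

lemma IRep.finrank {m : ℕ} {W : Submodule ℝ (Fin m → ℝ)} {k : ℕ} {A : Fin k → Fin m → ℤ}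
    (h : IRep W k A) : Module.finrank ℝ W = k := by
  rw [← h.2, finrank_span_eq_card h.1, Fintype.card_fin]

def iminor {m k : ℕ} (A : Fin k → Fin m → ℤ) (τ : Fin k → Fin m) : ℤ :=
  (Matrix.of fun s r => A r (τ s)).det

lemma iminor_cast {m k : ℕ} (A : Fin k → Fin m → ℤ) (τ : Fin k → Fin m) :
    Drow (fun s r => zc (A r) (τ s)) = (iminor A τ : ℝ) := by
  rw [Drow_eq, iminor]
  have := (Int.castRingHom ℝ).map_det (Matrix.of fun s r => A r (τ s))
  simp only [eq_intCast] at this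
  rw [this]
  rfl

def Nsup {m k : ℕ} (A : Fin k → Fin m → ℤ) : ℕ := Finset.univ.sup fun τ => (iminor A τ).natAbs

lemma IRep.exists_iminor {m : ℕ} {W : Submodule ℝ (Fin m → ℝ)} {k : ℕ} {A : Fin k → Fin m → ℤ}
    (h : IRep W k A) : ∃ τ, iminor A τ ≠ 0 := by
  obtain ⟨τ, hτ⟩ := exists_minor _ h.1
  rw [iminor_cast] at hτ
  exact ⟨τ, by exact_mod_cast hτ⟩

lemma IRep.Nsup_pos {m : ℕ} {W : Submodule ℝ (Fin m → ℝ)} {k : ℕ} {A : Fin k → Fin m → ℤ}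
    (h : IRep W k A) : 0 < Nsup A := by
  obtain ⟨τ, hτ⟩ := h.exists_iminor
  have : (iminor A τ).natAbs ≤ Nsup A :=
    Finset.le_sup (f := fun τ => (iminor A τ).natAbs) (Finset.mem_univ τ)
  have := Int.natAbs_pos.mpr hτ
  omega

lemma IRep.scale {m : ℕ} {W : Submodule ℝ (Fin m → ℝ)} {k : ℕ} {A A' : Fin k → Fin m → ℤ}
    (h : IRep W k A) (h' : IRep W k A') (hN : Nsup A ≤ Nsup A')
    (g : Fin k → ((Fin m → ℝ) →ₗ[ℝ] ℝ)) :
    |Drow (fun s r => g s (zc (A r)))| ≤ |Drow (fun s r => g s (zc (A' r)))| := by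
  obtain ⟨d, hd⟩ := Drow_scale (fun r => zc (A r)) (fun r => zc (A' r)) (fun r => by
    rw [h.2, ← h'.2]
    exact Submodule.subset_span ⟨r, rfl⟩)
  have h1 : (Nsup A' : ℝ) ≤ |d| * Nsup A := by
    obtain ⟨τ, -, hτ⟩ := Finset.exists_mem_eq_sup (Finset.univ : Finset (Fin k → Fin m))
      ⟨h.exists_iminor.choose, Finset.mem_univ _⟩ (fun τ => (iminor A' τ).natAbs)
    have e1 : (Nsup A' : ℝ) = |(iminor A' τ : ℝ)| := by
      rw [Nsup, hτ, Nat.cast_natAbs, Int.cast_abs]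
    have e2 : (iminor A' τ : ℝ) = d * (iminor A τ : ℝ) := by
      rw [← iminor_cast, ← iminor_cast]
      exact hd fun s => LinearMap.proj (τ s)
    rw [e1, e2, abs_mul]
    gcongr
    have : (iminor A τ).natAbs ≤ Nsup A :=
      Finset.le_sup (f := fun τ => (iminor A τ).natAbs) (Finset.mem_univ τ)
    have h3 : (((iminor A τ).natAbs : ℕ) : ℝ) ≤ Nsup A := by exact_mod_cast this
    rwa [Nat.cast_natAbs, Int.cast_abs] at h3
  have hpos : (0 : ℝ) < Nsup A := by exact_mod_cast h.Nsup_pos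
  have hN' : (Nsup A : ℝ) ≤ Nsup A' := by exact_mod_cast hN
  have hd1 : 1 ≤ |d| := by
    by_contra hlt
    push Not at hlt
    nlinarith
  rw [hd, abs_mul]
  nlinarith [abs_nonneg (Drow (fun s r => g s (zc (A r))))]

/-- sup of all minors with respect to a finite family of functionals -/
noncomputable def nuf {m k : ℕ} {ι : Type} [Fintype ι] (R : ι → ((Fin m → ℝ) →ₗ[ℝ] ℝ))
    (A : Fin k → Fin m → ℤ) : ℝ :=
  ‖fun σ : Fin k → ι => Drow (fun s r => R (σ s) (zc (A r)))‖

def HasRep {m : ℕ} (W : Submodule ℝ (Fin m → ℝ)) : Prop := ∃ k A, IRep W k A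

lemma exists_min_rep {m : ℕ} (W : Submodule ℝ (Fin m → ℝ)) (h : HasRep W) :
    ∃ k A, IRep W k A ∧ ∀ A' : Fin k → Fin m → ℤ, IRep W k A' → Nsup A ≤ Nsup A' := by
  obtain ⟨k, A₀, hA₀⟩ := h
  have hne : {A : Fin k → Fin m → ℤ | IRep W k A}.Nonempty := ⟨A₀, hA₀⟩
  refine ⟨k, Function.argminOn Nsup _ hne, Function.argminOn_mem Nsup _ hne, fun A' hA' => ?_⟩
  exact Function.argminOn_le Nsup _ hA'

lemma psi_exists {m : ℕ} (ι : Type) [Fintype ι] (W : Submodule ℝ (Fin m → ℝ)) :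
    ∃ Q : Σ k : ℕ, (Fin k → Fin m → ℤ), HasRep W → IRep W Q.1 Q.2 ∧
      ∀ k' A', IRep W k' A' → ∀ R : ι → ((Fin m → ℝ) →ₗ[ℝ] ℝ), nuf R Q.2 ≤ nuf R A' := by
  by_cases h : HasRep W
  · obtain ⟨k, A, hA, hmin⟩ := exists_min_rep W h
    refine ⟨⟨k, A⟩, fun _ => ⟨hA, fun k' A' hA' R => ?_⟩⟩
    obtain rfl : k = k' := by rw [← hA.finrank, hA'.finrank]
    unfold nuf
    rw [pi_norm_le_iff_of_nonneg (norm_nonneg _)]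
    intro σ
    refine le_trans ?_ (norm_le_pi_norm _ σ)
    exact hA.scale hA' (hmin A' hA') fun s => R (σ s)
  · exact ⟨⟨0, Fin.elim0⟩, fun h' => absurd h' h⟩

noncomputable def chosen {m : ℕ} (ι : Type) [Fintype ι] (W : Submodule ℝ (Fin m → ℝ)) :
    Σ k : ℕ, (Fin k → Fin m → ℤ) := (psi_exists ι W).choose

lemma chosen_spec {m : ℕ} (ι : Type) [Fintype ι] (W : Submodule ℝ (Fin m → ℝ)) (h : HasRep W) :
    IRep W (chosen ι W).1 (chosen ι W).2 ∧
      ∀ k' A', IRep W k' A' → ∀ R : ι → ((Fin m → ℝ) →ₗ[ℝ] ℝ), nuf R (chosen ι W).2 ≤ nuf R A' :=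
  (psi_exists ι W).choose_spec h

noncomputable def psi {m : ℕ} {ι : Type} [Fintype ι] (R : ι → ((Fin m → ℝ) →ₗ[ℝ] ℝ))
    (W : Submodule ℝ (Fin m → ℝ)) : ℝ := nuf R (chosen ι W).2

lemma rep_bot {m : ℕ} : IRep (⊥ : Submodule ℝ (Fin m → ℝ)) 0 Fin.elim0 := by
  refine ⟨linearIndependent_empty_type, ?_⟩
  rw [Submodule.span_eq_bot]
  rintro _ ⟨r, _⟩
  exact r.elim0

lemma psi_bot {m : ℕ} {ι : Type} [Fintype ι] (R : ι → ((Fin m → ℝ) →ₗ[ℝ] ℝ)) :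
    psi R ⊥ ≤ 1 := by
  refine ((chosen_spec ι (⊥ : Submodule ℝ (Fin m → ℝ)) ⟨_, _, rep_bot⟩).2 _ _ rep_bot R).trans ?_
  unfold nuf
  rw [pi_norm_le_iff_of_nonneg zero_le_one]
  intro σ
  simp [Drow_eq]

lemma rep_cons {m k : ℕ} {W : Submodule ℝ (Fin m → ℝ)} {A : Fin k → Fin m → ℤ} (h : IRep W k A)
    (v : Fin m → ℤ) (hv : zc v ∉ W) :
    IRep (W ⊔ Submodule.span ℝ {zc v}) (k + 1) (Fin.cons v A) := by
  have e : (fun r => zc ((Fin.cons v A : Fin (k + 1) → Fin m → ℤ) r)) =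
      (Fin.cons (zc v) (fun r => zc (A r)) : Fin (k + 1) → Fin m → ℝ) := by
    ext r
    refine Fin.cases ?_ (fun i => ?_) r <;> simp
  unfold IRep
  rw [e]
  constructor
  · rw [linearIndependent_finCons]
    exact ⟨h.1, by rwa [h.2]⟩
  · rw [Fin.range_cons, Submodule.span_insert, h.2, sup_comm]

lemma nuf_cons {m k : ℕ} {ι : Type} [Fintype ι] (R : ι → ((Fin m → ℝ) →ₗ[ℝ] ℝ))
    (A : Fin k → Fin m → ℤ) (v : Fin m → ℤ) (ε : ℝ) (hε : 0 ≤ ε) (hv : ∀ o, |R o (zc v)| ≤ ε) :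
    nuf R (Fin.cons v A : Fin (k + 1) → Fin m → ℤ) ≤ (k + 1) * ε * nuf R A := by
  have hn0 : 0 ≤ nuf R A := norm_nonneg _
  conv_lhs => unfold nuf
  rw [pi_norm_le_iff_of_nonneg (by positivity)]
  intro σ
  rw [Drow_eq, Matrix.det_succ_column_zero, Real.norm_eq_abs]
  refine (Finset.abs_sum_le_sum_abs _ _).trans ?_
  have : ∀ i ∈ (Finset.univ : Finset (Fin (k + 1))), |(-1) ^ (i : ℕ) *
      Matrix.of (fun s r => R (σ s) (zc ((Fin.cons v A : Fin (k + 1) → Fin m → ℤ) r))) i 0 *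
      ((Matrix.of fun s r => R (σ s) (zc ((Fin.cons v A : Fin (k + 1) → Fin m → ℤ) r))).submatrix
        i.succAbove Fin.succ).det| ≤ ε * nuf R A := fun i _ => by
    rw [abs_mul, abs_mul, abs_pow, abs_neg, abs_one, one_pow, one_mul]
    refine mul_le_mul ?_ ?_ (abs_nonneg _) hε
    · simpa using hv (σ i)
    · have := norm_le_pi_norm (fun σ : Fin k → ι => Drow (fun s r => R (σ s) (zc (A r))))
        (fun s => σ (i.succAbove s))
      exact this
  refine (Finset.sum_le_sum this).trans ?_
  simp
  linarith

lemma psi_cons {m : ℕ} {ι : Type} [Fintype ι] (R : ι → ((Fin m → ℝ) →ₗ[ℝ] ℝ))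
    (W : Submodule ℝ (Fin m → ℝ)) (hW : HasRep W)
    (v : Fin m → ℤ) (hv : zc v ∉ W) (ε : ℝ) (hε : 0 ≤ ε) (hvε : ∀ o, |R o (zc v)| ≤ ε) :
    psi R (W ⊔ Submodule.span ℝ {zc v}) ≤ (m + 1) * ε * psi R W := by
  obtain ⟨h1, -⟩ := chosen_spec ι W hW
  have h2 := rep_cons h1 v hv
  have h3 := (chosen_spec ι _ ⟨_, _, h2⟩).2 _ _ h2 R
  refine h3.trans ((nuf_cons R _ v ε hε hvε).trans ?_)
  have hk : (chosen ι W).1 ≤ m := by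
    rw [← h1.finrank]
    simpa using Submodule.finrank_le W
  have hk' : ((chosen ι W).1 : ℝ) ≤ m := by exact_mod_cast hk
  have : 0 ≤ nuf R (chosen ι W).2 := norm_nonneg _
  unfold psi
  gcongr

lemma hasRep_span {m : ℕ} (s : Set (Fin m → ℤ)) (hs : s.Finite) :
    HasRep (Submodule.span ℝ (zc '' s)) := by
  induction s, hs using Set.Finite.induction_on with
  | empty =>
    simp only [image_empty, Submodule.span_empty]
    exact ⟨_, _, rep_bot⟩
  | insert _ _ ih =>
    rename_i v s _ _
    rw [image_insert_eq, Submodule.span_insert, sup_comm]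
    obtain ⟨k, A, hA⟩ := ih
    by_cases hv : zc v ∈ Submodule.span ℝ (zc '' s)
    · rw [sup_eq_left.mpr]
      · exact ⟨k, A, hA⟩
      · rwa [Submodule.span_singleton_le_iff_mem]
    · exact ⟨_, _, rep_cons hA v hv⟩
end

section
open MeasureTheory Set
open scoped ENNReal Topology

lemma Drow_update_sum {k : ℕ} {ι : Type*} [Fintype ι] (M : Fin k → Fin k → ℝ) (P : Fin k) (a : ι → ℝ)
    (c : ι → Fin k → ℝ) :
    Drow (Function.update M P (∑ i, a i • c i)) = ∑ i, a i * Drow (Function.update M P (c i)) := by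
  unfold Drow
  rw [AlternatingMap.map_update_sum]
  refine Finset.sum_congr rfl fun i _ => ?_
  rw [AlternatingMap.map_update_smul, smul_eq_mul]

lemma plucker2 {k : ℕ} (M : Fin k → Fin k → ℝ) (P Q : Fin k) (hPQ : P ≠ Q) (hM : Drow M ≠ 0)
    (c1 c2 : Fin k → ℝ) :
    Drow M * Drow (Function.update (Function.update M P c1) Q c2) =
      Drow (Function.update M P c1) * Drow (Function.update M Q c2) -
      Drow (Function.update M P c2) * Drow (Function.update M Q c1) := by
  have hu : IsUnit (Matrix.of M).det := isUnit_iff_ne_zero.mpr hM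
  obtain ⟨a, ha⟩ : ∃ a : Fin k → ℝ, c1 = ∑ s, a s • M s := by
    refine ⟨Matrix.vecMul c1 (Matrix.of M)⁻¹, ?_⟩
    have := Matrix.vecMul_eq_sum (Matrix.vecMul c1 (Matrix.of M)⁻¹) (Matrix.of M)
    rw [Matrix.vecMul_vecMul, Matrix.nonsing_inv_mul _ hu, Matrix.vecMul_one] at this
    exact this
  have hself : ∀ (N : Fin k → Fin k → ℝ) (P s : Fin k), s ≠ P → Drow (Function.update N P (N s)) = 0 := by
    intro N P s hs
    exact AlternatingMap.map_update_self _ _ hs.symm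
  have e1 : Drow (Function.update M P c1) = a P * Drow M := by
    rw [ha, Drow_update_sum, Finset.sum_eq_single P]
    · rw [Function.update_eq_self]
    · intro s _ hs
      rw [hself M P s hs, mul_zero]
    · simp
  have e2 : Drow (Function.update M Q c1) = a Q * Drow M := by
    rw [ha, Drow_update_sum, Finset.sum_eq_single Q]
    · rw [Function.update_eq_self]
    · intro s _ hs
      rw [hself M Q s hs, mul_zero]
    · simp
  set N := Function.update M Q c2 with hN
  have hsw : Drow (Function.update N P (M Q)) = - Drow (Function.update M P c2) := by
    have := AlternatingMap.map_swap Matrix.detRowAlternating (Function.update M P c2) hPQ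
    unfold Drow
    rw [← this]
    congr 1
    ext s : 1
    simp only [Function.comp, hN, Function.update_apply, Equiv.swap_apply_def]
    by_cases h1 : s = P
    · subst h1
      simp [hPQ.symm]
    · by_cases h2 : s = Q
      · subst h2
        simp [hPQ.symm]
      · simp [h1, h2]
  have e3 : Drow (Function.update (Function.update M P c1) Q c2) =
      a P * Drow N - a Q * Drow (Function.update M P c2) := by
    rw [Function.update_comm hPQ, ha, Drow_update_sum, ← hN]
    rw [← Finset.add_sum_erase _ _ (Finset.mem_univ P),
      ← Finset.add_sum_erase _ _ (Finset.mem_erase.mpr ⟨hPQ.symm, Finset.mem_univ Q⟩)]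
    rw [Finset.sum_eq_zero, hsw]
    · have : Function.update N P (M P) = N := by
        rw [hN, Function.update_comm hPQ.symm, Function.update_eq_self]
      rw [this]
      ring
    · intro s hs
      simp only [Finset.mem_erase, Finset.mem_univ, and_true] at hs
      have : N s = M s := by rw [hN, Function.update_of_ne hs.1]
      rw [← this, hself N P s hs.2, mul_zero]
  rw [e1, e2, e3]
  ring

variable {n : ℕ}

/-- the unweighted functionals -/
noncomputable def Lrow (Φ : ℕ → Fin (n + 1) → ℝ → ℝ) (x : ℝ) :
    Option (Fin (n + 1)) → ((Fin (n + 1) → ℝ) →ₗ[ℝ] ℝ)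
  | none => ∑ j, Φ 1 j x • LinearMap.proj j
  | some i => if i = 0 then ∑ j, Φ 0 j x • LinearMap.proj j else LinearMap.proj i

lemma Lrow_none (Φ : ℕ → Fin (n + 1) → ℝ → ℝ) (x : ℝ) (v) : Lrow Φ x none v = Ufun Φ 1 v x := by
  simp [Lrow, Ufun, mul_comm]

lemma Lrow_zero (Φ : ℕ → Fin (n + 1) → ℝ → ℝ) (x : ℝ) (v) :
    Lrow Φ x (some 0) v = Ufun Φ 0 v x := by
  simp [Lrow, Ufun, mul_comm]

lemma Lrow_ne (Φ : ℕ → Fin (n + 1) → ℝ → ℝ) (x : ℝ) (v) (i) (hi : i ≠ 0) :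
    Lrow Φ x (some i) v = v i := by
  simp [Lrow, hi]

noncomputable def Rrow (w : Option (Fin (n + 1)) → ℝ) (Φ : ℕ → Fin (n + 1) → ℝ → ℝ) (x : ℝ)
    (o : Option (Fin (n + 1))) : (Fin (n + 1) → ℝ) →ₗ[ℝ] ℝ := w o • Lrow Φ x o

lemma Drow_R {k : ℕ} (w : Option (Fin (n + 1)) → ℝ) (Φ : ℕ → Fin (n + 1) → ℝ → ℝ) (x : ℝ)
    (σ : Fin k → Option (Fin (n + 1))) (A : Fin k → Fin (n + 1) → ℤ) :
    Drow (fun s r => Rrow w Φ x (σ s) (zc (A r))) =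
      (∏ s, w (σ s)) * Drow (fun s r => Lrow Φ x (σ s) (zc (A r))) := by
  rw [Drow_eq, Drow_eq, ← Matrix.det_mul_column]
  rfl

/-- base matrix of rows with trivial rows at the non-constant spots -/
def baseRow {k : ℕ} (σ : Fin k → Option (Fin (n + 1))) (A : Fin k → Fin (n + 1) → ℤ) :
    Fin k → Fin k → ℝ := fun s r => match σ s with
  | none => 0
  | some i => zc (A r) i

lemma rowU {k : ℕ} (Φ : ℕ → Fin (n + 1) → ℝ → ℝ) (x : ℝ) (i : ℕ) (A : Fin k → Fin (n + 1) → ℤ) :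
    (fun r => Ufun Φ i (zc (A r)) x) = ∑ j, Φ i j x • (fun r => zc (A r) j) := by
  ext r
  simp [Ufun, mul_comm]

/-- exactly one nonconstant row -/
lemma Drow_one {k : ℕ} (Φ : ℕ → Fin (n + 1) → ℝ → ℝ) (σ : Fin k → Option (Fin (n + 1)))
    (A : Fin k → Fin (n + 1) → ℤ) (P : Fin k) (e : ℕ)
    (hP : ∀ x v, Lrow Φ x (σ P) v = Ufun Φ e v x)
    (hne : ∀ s ≠ P, σ s ≠ none ∧ σ s ≠ some 0) (x : ℝ) :
    Drow (fun s r => Lrow Φ x (σ s) (zc (A r))) =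
      Ufun Φ e (fun j => Drow (Function.update (baseRow σ A) P (fun r => zc (A r) j))) x := by
  have : (fun s r => Lrow Φ x (σ s) (zc (A r))) =
      Function.update (baseRow σ A) P (∑ j, Φ e j x • (fun r => zc (A r) j)) := by
    ext s r
    by_cases hs : s = P
    · subst hs
      rw [Function.update_self, ← rowU, hP]
    · rw [Function.update_of_ne hs]
      obtain ⟨h1, h2⟩ := hne s hs
      unfold baseRow
      rcases hσ : σ s with _ | i
      · exact absurd hσ h1
      · simp only
        rw [Lrow_ne]
        rintro rfl
        exact h2 hσ
  rw [this, Drow_update_sum]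
  simp [Ufun, mul_comm]

lemma Drow_two {k : ℕ} (Φ : ℕ → Fin (n + 1) → ℝ → ℝ) (σ : Fin k → Option (Fin (n + 1)))
    (A : Fin k → Fin (n + 1) → ℤ) (P Q : Fin k)
    (hP : σ P = some 0) (hQ : σ Q = none)
    (hne : ∀ s, s ≠ P → s ≠ Q → σ s ≠ none ∧ σ s ≠ some 0) :
    ∃ c d : Fin (n + 1) → ℝ,
    (∀ x, Drow (fun s r => Lrow Φ x (σ s) (zc (A r))) = Gfun Φ c d x) ∧
    ∀ i j, Drow (Function.update (Function.update (baseRow σ A) P (fun r => zc (A r) i)) Q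
      (fun r => zc (A r) j)) = c i * d j - c j * d i := by
  have hPQ : P ≠ Q := by
    rintro rfl
    rw [hP] at hQ
    exact absurd hQ (by simp)
  set H := baseRow σ A with hH
  set B : Fin (n + 1) → Fin (n + 1) → ℝ := fun i j =>
    Drow (Function.update (Function.update H P (fun r => zc (A r) i)) Q (fun r => zc (A r) j)) with hB
  have hexp : ∀ x, Drow (fun s r => Lrow Φ x (σ s) (zc (A r))) =
      ∑ i, Φ 0 i x * ∑ j, Φ 1 j x * B i j := by
    intro x
    have : (fun s r => Lrow Φ x (σ s) (zc (A r))) =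
      Function.update (Function.update H P (∑ j, Φ 0 j x • (fun r => zc (A r) j))) Q
        (∑ j, Φ 1 j x • (fun r => zc (A r) j)) := by
      ext s r
      by_cases hs : s = Q
      · subst hs
        rw [Function.update_self, ← rowU, hQ, Lrow_none]
      · rw [Function.update_of_ne hs]
        by_cases hs' : s = P
        · subst hs'
          rw [Function.update_self, ← rowU, hP, Lrow_zero]
        · rw [Function.update_of_ne hs']
          obtain ⟨h1, h2⟩ := hne s hs' hs
          rw [hH]
          unfold baseRow
          rcases hσ : σ s with _ | i
          · exact absurd hσ h1
          · simp only
            rw [Lrow_ne]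
            rintro rfl
            exact h2 hσ
    rw [this, Function.update_comm hPQ, Drow_update_sum]
    refine Finset.sum_congr rfl fun i _ => ?_
    rw [Function.update_comm hPQ.symm, Drow_update_sum]
  have hcd : ∃ c d : Fin (n + 1) → ℝ, ∀ i j, B i j = c i * d j - c j * d i := by
    by_cases hz : ∀ i j, B i j = 0
    · exact ⟨0, 0, fun i j => by simp [hz]⟩
    push Not at hz
    obtain ⟨i0, j0, h0⟩ := hz
    refine ⟨fun i => B i j0 / B i0 j0, fun j => B i0 j, fun i j => ?_⟩
    have hpl := plucker2 (Function.update (Function.update H P (fun r => zc (A r) i0)) Q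
      (fun r => zc (A r) j0)) P Q hPQ h0 (fun r => zc (A r) i) (fun r => zc (A r) j)
    have s1 : ∀ c1 : Fin k → ℝ, Function.update (Function.update (Function.update H P (fun r => zc (A r) i0)) Q
      (fun r => zc (A r) j0)) P c1 = Function.update (Function.update H P c1) Q (fun r => zc (A r) j0) := by
      intro c1
      rw [Function.update_comm hPQ.symm, Function.update_idem]
    simp only [s1, Function.update_idem] at hpl
    have hpl' : B i0 j0 * B i j = B i j0 * B i0 j - B j j0 * B i0 i := hpl
    field_simp
    linarith
  obtain ⟨c, d, hcd⟩ := hcd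
  refine ⟨c, d, fun x => ?_, hcd⟩
  rw [hexp]
  rw [Gfun, mul_comm (Ufun Φ 1 c x)]
  unfold Ufun
  rw [Finset.sum_mul_sum, Finset.sum_mul_sum, ← Finset.sum_sub_distrib]
  simp only [hcd, Finset.mul_sum]
  refine Finset.sum_congr rfl fun i _ => ?_
  rw [← Finset.sum_sub_distrib]
  refine Finset.sum_congr rfl fun j _ => ?_
  ring

lemma GoodOn.const_mul {C α a b : ℝ} {g : ℝ → ℝ} (h : GoodOn C α a b g) (m : ℝ) :
    GoodOn C α a b (fun x => m * g x) := by
  intro u v hau huv hvb x hx ε hε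
  by_cases hm : m = 0
  · subst hm
    simp
  · refine le_trans (measure_mono ?_) (h u v hau huv hvb x hx ε hε)
    rintro y ⟨hy, hy'⟩
    refine ⟨hy, ?_⟩
    simp only [abs_mul] at hy'
    have hm' : 0 < |m| := abs_pos.mpr hm
    rw [mul_left_comm] at hy'
    exact lt_of_mul_lt_mul_left hy' hm'.le

lemma Ufun_e0 {Φ : ℕ → Fin (n + 1) → ℝ → ℝ} (i : ℕ) (y : ℝ) :
    Ufun Φ i (Pi.single 0 1) y = Φ i 0 y := by
  simp [Ufun, Pi.single_apply]

lemma Loc.good_minor {Φ : ℕ → Fin (n + 1) → ℝ → ℝ} {a b C α κ : ℝ} (h : Loc Φ a b C α κ)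
    (w : Option (Fin (n + 1)) → ℝ) {k : ℕ} (σ : Fin k → Option (Fin (n + 1)))
    (A : Fin k → Fin (n + 1) → ℤ) :
    GoodOn C α a b (fun x => Drow (fun s r => Rrow w Φ x (σ s) (zc (A r)))) := by
  have h1 : ∀ y, Ufun Φ 0 (Pi.single 0 1) y = 1 := fun y => by rw [Ufun_e0, h.one]
  have h2 : ∀ y, Ufun Φ 1 (Pi.single 0 1) y = 0 := fun y => by rw [Ufun_e0, h.zero]
  have hU1 : ∀ c, GoodOn C α a b (Ufun Φ 1 c) := by
    intro c
    have := h.goodG (Pi.single 0 1) c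
    convert this using 1
    ext y
    rw [Gfun, h1, h2]
    ring
  simp only [Drow_R]
  refine GoodOn.const_mul ?_ _
  have hconst : ∀ m : ℝ, GoodOn C α a b (fun _ => m) := by
    intro m
    have := (h.goodU (Pi.single 0 1)).const_mul m
    simpa [h1] using this
  by_cases hinj : Function.Injective σ
  swap
  · have : ∀ x, Drow (fun s r => Lrow Φ x (σ s) (zc (A r))) = 0 := by
      intro x
      apply AlternatingMap.map_eq_zero_of_not_injective
      intro hi
      apply hinj
      intro s s' hss
      apply hi
      simp only [hss]
    simp only [this]
    exact hconst 0
  by_cases hP : ∃ P, σ P = some 0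
  · obtain ⟨P, hP⟩ := hP
    by_cases hQ : ∃ Q, σ Q = none
    · obtain ⟨Q, hQ⟩ := hQ
      obtain ⟨c, d, hcd, -⟩ := Drow_two Φ σ A P Q hP hQ (fun s hs hs' =>
        ⟨fun h0 => hs' (hinj (h0.trans hQ.symm)), fun h0 => hs (hinj (h0.trans hP.symm))⟩)
      simp only [hcd]
      exact h.goodG c d
    · push Not at hQ
      simp only [Drow_one Φ σ A P 0 (fun x v => by rw [hP, Lrow_zero])
        (fun s hs => ⟨hQ s, fun h0 => hs (hinj (h0.trans hP.symm))⟩)]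
      exact h.goodU _
  · push Not at hP
    by_cases hQ : ∃ Q, σ Q = none
    · obtain ⟨Q, hQ⟩ := hQ
      simp only [Drow_one Φ σ A Q 1 (fun x v => by rw [hQ, Lrow_none])
        (fun s hs => ⟨fun h0 => hs (hinj (h0.trans hQ.symm)), hP s⟩)]
      exact hU1 _
    · push Not at hQ
      have : ∀ x, Drow (fun s r => Lrow Φ x (σ s) (zc (A r))) = Drow (baseRow σ A) := by
        intro x
        congr 1
        ext s r
        unfold baseRow
        rcases hσ : σ s with _ | i
        · exact absurd hσ (hQ s)
        · simp only
          rw [Lrow_ne]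
          rintro rfl
          exact hP s hσ
      simp only [this]
      exact hconst _
end

section
open MeasureTheory Set
open scoped ENNReal Topology

lemma prod_ge_one {ι : Type*} [Fintype ι] [DecidableEq ι] {k : ℕ} (w : ι → ℝ) (o j : ι)
    (hpos : ∀ i, 0 < w i) (hle : ∀ i, i ≠ o → w i ≤ 1)
    (hprod : 1 ≤ ∏ i ∈ Finset.univ.erase j, w i) (σ : Fin k → ι) (hσ : Function.Injective σ)
    (ho : ∃ s, σ s = o) (hj : ∀ s, σ s ≠ j) : 1 ≤ ∏ s, w (σ s) := by
  have e : ∏ s, w (σ s) = ∏ i ∈ Finset.univ.image σ, w i := by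
    rw [Finset.prod_image (fun a _ b _ h => hσ h)]
  have hsub : Finset.univ.image σ ⊆ Finset.univ.erase j := by
    intro i hi
    simp only [Finset.mem_image, Finset.mem_univ, true_and] at hi
    obtain ⟨s, rfl⟩ := hi
    simp [hj s]
  have h1 := Finset.prod_sdiff (f := w) hsub
  have h2 : ∏ i ∈ (Finset.univ.erase j) \ (Finset.univ.image σ), w i ≤ 1 := by
    refine Finset.prod_le_one (fun i _ => (hpos i).le) fun i hi => hle i ?_
    rintro rfl
    simp only [Finset.mem_sdiff, Finset.mem_image, Finset.mem_univ, true_and] at hi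
    exact hi.2 ho
  have h3 : 0 < ∏ i ∈ Finset.univ.image σ, w i := Finset.prod_pos fun i _ => hpos i
  rw [e]
  nlinarith

variable {n : ℕ}

lemma Loc.lower {Φ : ℕ → Fin (n + 1) → ℝ → ℝ} {a b C α κ : ℝ} (h : Loc Φ a b C α κ)
    (w : Option (Fin (n + 1)) → ℝ) (hpos : ∀ i, 0 < w i) (hle : ∀ i, i ≠ some 0 → w i ≤ 1)
    (j : Fin (n + 1)) (hj : j ≠ 0) (hprod : 1 ≤ ∏ i ∈ Finset.univ.erase (some j), w i)
    {k : ℕ} (hk : 1 ≤ k) (A : Fin k → Fin (n + 1) → ℤ) (W) (hA : IRep W k A) :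
    ∃ x ∈ Icc a b, κ ≤ nuf (Rrow w Φ x) A := by
  obtain ⟨τ, hτ⟩ := hA.exists_iminor
  have hτ1 : (1 : ℝ) ≤ |(iminor A τ : ℝ)| := by
    rw [← Int.cast_abs]
    exact_mod_cast Int.one_le_abs hτ
  have hκ := h.hκ
  have hinj : Function.Injective τ := by
    by_contra hni
    apply hτ
    have : (iminor A τ : ℝ) = 0 := by
      rw [← iminor_cast]
      apply AlternatingMap.map_eq_zero_of_not_injective
      intro hi
      apply hni
      intro s s' hss
      apply hi
      simp only [hss]
    exact_mod_cast this
  have fin : ∀ (σ : Fin k → Option (Fin (n + 1))) (x : ℝ), 1 ≤ ∏ s, w (σ s) →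
      κ ≤ |Drow (fun s r => Lrow Φ x (σ s) (zc (A r)))| → κ ≤ nuf (Rrow w Φ x) A := by
    intro σ x h1 h2
    have h3 := norm_le_pi_norm (fun σ : Fin k → Option (Fin (n + 1)) =>
      Drow (fun s r => Rrow w Φ x (σ s) (zc (A r)))) σ
    refine le_trans ?_ h3
    rw [Drow_R, Real.norm_eq_abs, abs_mul, abs_of_nonneg (by linarith)]
    nlinarith
  by_cases hP : ∃ P, ∀ s ≠ P, τ s ≠ 0 ∧ τ s ≠ j
  · obtain ⟨P, hP⟩ := hP
    set σ : Fin k → Option (Fin (n + 1)) := fun s => some (Function.update τ P 0 s) with hσ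
    have hσP : σ P = some 0 := by simp [hσ]
    have hσs : ∀ s ≠ P, σ s = some (τ s) := by
      intro s hs
      simp [hσ, hs]
    have hone := Drow_one Φ σ A P 0 (fun x v => by rw [hσP, Lrow_zero]) (fun s hs => by
      rw [hσs s hs]
      simp [(hP s hs).1])
    set c : Fin (n + 1) → ℝ := fun j => Drow (Function.update (baseRow σ A) P (fun r => zc (A r) j))
      with hc
    have hcτ : c (τ P) = (iminor A τ : ℝ) := by
      rw [hc, ← iminor_cast]
      simp only
      congr 1
      ext s r
      by_cases hs : s = P
      · subst hs
        simp
      · rw [Function.update_of_ne hs]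
        simp only [baseRow, hσs s hs]
    have hcn : 1 ≤ ‖c‖ := by
      refine le_trans ?_ (norm_le_pi_norm c (τ P))
      rw [hcτ, Real.norm_eq_abs]
      exact hτ1
    obtain ⟨x, hx, hx'⟩ := h.lowU c
    refine ⟨x, hx, fin σ x (prod_ge_one w (some 0) (some j) hpos hle hprod σ ?_ ⟨P, hσP⟩ ?_) ?_⟩
    · intro s s' hss
      by_cases hs : s = P <;> by_cases hs' : s' = P
      · rw [hs, hs']
      · subst hs
        rw [hσP, hσs s' hs'] at hss
        exact absurd (Option.some.inj hss).symm (hP s' hs').1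
      · subst hs'
        rw [hσP, hσs s hs] at hss
        exact absurd (Option.some.inj hss) (hP s hs).1
      · rw [hσs s hs, hσs s' hs'] at hss
        exact hinj (Option.some.inj hss)
    · intro s hs0
      by_cases hs : s = P
      · subst hs
        rw [hσP] at hs0
        exact hj (Option.some.inj hs0).symm
      · rw [hσs s hs] at hs0
        exact (hP s hs).2 (Option.some.inj hs0)
    · rw [hone x]
      nlinarith
  · push Not at hP
    obtain ⟨s1, -, h1⟩ := hP ⟨0, hk⟩
    have h1' : τ s1 = 0 ∨ τ s1 = j := by tauto
    obtain ⟨s2, hs2, h2⟩ := hP s1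
    have h2' : τ s2 = 0 ∨ τ s2 = j := by tauto
    obtain ⟨P, Q, hPQ, hτP, hτQ⟩ : ∃ P Q, P ≠ Q ∧ τ P = 0 ∧ τ Q = j := by
      rcases h1' with h1' | h1' <;> rcases h2' with h2' | h2'
      · exact absurd (hinj (h2'.trans h1'.symm)) hs2
      · exact ⟨s1, s2, hs2.symm, h1', h2'⟩
      · exact ⟨s2, s1, hs2, h2', h1'⟩
      · exact absurd (hinj (h2'.trans h1'.symm)) hs2
    set σ : Fin k → Option (Fin (n + 1)) := Function.update (fun s => some (τ s)) Q none with hσ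
    have hσQ : σ Q = none := by simp [hσ]
    have hσs : ∀ s ≠ Q, σ s = some (τ s) := by
      intro s hs
      simp [hσ, hs]
    have hσP : σ P = some 0 := by rw [hσs P hPQ, hτP]
    obtain ⟨c, d, hcd, hB⟩ := Drow_two Φ σ A P Q hσP hσQ (fun s hs hs' => by
      rw [hσs s hs']
      simp only [ne_eq, reduceCtorEq, not_false_eq_true, Option.some.injEq, true_and]
      intro h0
      exact hs (hinj (h0.trans hτP.symm)))
    have hBτ := hB 0 j
    have : Drow (Function.update (Function.update (baseRow σ A) P (fun r => zc (A r) 0)) Q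
      (fun r => zc (A r) j)) = (iminor A τ : ℝ) := by
      rw [← iminor_cast]
      congr 1
      ext s r
      by_cases hs : s = Q
      · subst hs
        simp [hτQ]
      · rw [Function.update_of_ne hs]
        by_cases hs' : s = P
        · subst hs'
          simp [hτP]
        · rw [Function.update_of_ne hs']
          simp only [baseRow, hσs s hs]
    rw [this] at hBτ
    obtain ⟨x, hx, hx'⟩ := h.lowG c d 0 j
    rw [← hBτ] at hx'
    refine ⟨x, hx, fin σ x (prod_ge_one w (some 0) (some j) hpos hle hprod σ ?_ ⟨P, hσP⟩ ?_) ?_⟩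
    · intro s s' hss
      by_cases hs : s = Q <;> by_cases hs' : s' = Q
      · rw [hs, hs']
      · subst hs
        rw [hσQ, hσs s' hs'] at hss
        exact absurd hss (by simp)
      · subst hs'
        rw [hσQ, hσs s hs] at hss
        exact absurd hss (by simp)
      · rw [hσs s hs, hσs s' hs'] at hss
        exact hinj (Option.some.inj hss)
    · intro s hs0
      by_cases hs : s = Q
      · subst hs
        rw [hσQ] at hs0
        exact absurd hs0 (by simp)
      · rw [hσs s hs] at hs0
        exact hs (hinj ((Option.some.inj hs0).trans hτQ.symm))
    · rw [hcd x]
      nlinarith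

lemma Loc.cont_L {Φ : ℕ → Fin (n + 1) → ℝ → ℝ} {a b C α κ : ℝ} (h : Loc Φ a b C α κ)
    (o : Option (Fin (n + 1))) (v : Fin (n + 1) → ℝ) :
    ContinuousOn (fun x => Lrow Φ x o v) (Icc a b) := by
  rcases o with _ | i
  · simp only [Lrow_none, Ufun]
    exact continuousOn_finsetSum _ fun j _ => continuousOn_const.mul (h.c1 j)
  · by_cases hi : i = 0
    · subst hi
      simp only [Lrow_zero, Ufun]
      exact continuousOn_finsetSum _ fun j _ => continuousOn_const.mul (h.c0 j)
    · simp only [Lrow_ne _ _ _ _ hi]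
      exact continuousOn_const

lemma Loc.cont_nuf {Φ : ℕ → Fin (n + 1) → ℝ → ℝ} {a b C α κ : ℝ} (h : Loc Φ a b C α κ)
    (w : Option (Fin (n + 1)) → ℝ) {k : ℕ} (A : Fin k → Fin (n + 1) → ℤ) :
    ContinuousOn (fun x => nuf (Rrow w Φ x) A) (Icc a b) := by
  unfold nuf
  refine ContinuousOn.norm (continuousOn_pi.mpr fun σ => ?_)
  simp only [Drow_R]
  simp only [Drow_eq, Matrix.det_apply, Matrix.of_apply]
  refine continuousOn_const.mul (continuousOn_finsetSum _ fun τ _ => ?_)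
  refine ContinuousOn.const_smul (continuousOn_finsetProd _ fun i _ => ?_) _
  exact h.cont_L _ _

lemma Loc.good_nuf {Φ : ℕ → Fin (n + 1) → ℝ → ℝ} {a b C α κ : ℝ} (h : Loc Φ a b C α κ)
    (w : Option (Fin (n + 1)) → ℝ) {k : ℕ} (A : Fin k → Fin (n + 1) → ℤ) (ε ρ : ℝ) (hε : 0 < ε)
    (hρ : 0 < ρ) (u v : ℝ) (hau : a ≤ u) (huv : u < v) (hvb : v ≤ b)
    (hx : ∃ x ∈ Icc u v, ρ ≤ nuf (Rrow w Φ x) A) :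
    volume {y ∈ Icc u v | nuf (Rrow w Φ y) A < ε} ≤ ENNReal.ofReal (C * (ε / ρ) ^ α * (v - u)) := by
  obtain ⟨x, hx, hx'⟩ := hx
  obtain ⟨σ, hσ⟩ : ∃ σ : Fin k → Option (Fin (n + 1)),
      ρ ≤ |Drow (fun s r => Rrow w Φ x (σ s) (zc (A r)))| := by
    by_contra hcon
    push Not at hcon
    have := (pi_norm_lt_iff (x := fun σ : Fin k → Option (Fin (n + 1)) =>
      Drow (fun s r => Rrow w Φ x (σ s) (zc (A r)))) hρ).mpr hcon
    exact absurd hx' (not_le.mpr this)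
  refine le_trans (measure_mono ?_) (h.good_minor w σ A u v hau huv hvb x hx (ε / ρ) (by positivity))
  rintro y ⟨hy, hy'⟩
  refine ⟨hy, ?_⟩
  have h1 := norm_le_pi_norm (fun σ : Fin k → Option (Fin (n + 1)) =>
      Drow (fun s r => Rrow w Φ y (σ s) (zc (A r)))) σ
  calc _ ≤ nuf (Rrow w Φ y) A := h1
    _ < ε := hy'
    _ = ε / ρ * ρ := by field_simp
    _ ≤ _ := by gcongr

lemma chain_card {m : ℕ} (M : Finset (Submodule ℝ (Fin m → ℝ)))
    (hM : IsChain (· ≤ ·) (M : Set (Submodule ℝ (Fin m → ℝ)))) : M.card ≤ m + 1 := by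
  have : M.card ≤ (Finset.range (m + 1)).card := by
    refine Finset.card_le_card_of_injOn (fun W => Module.finrank ℝ W) ?_ ?_
    · intro W _
      simp only [Finset.coe_range, mem_Iio]
      have := Submodule.finrank_le W
      simp at this
      omega
    · intro W hW W' hW' he
      rcases eq_or_ne W W' with h | h
      · exact h
      · rcases hM hW hW' h with h' | h'
        · exact Submodule.eq_of_le_of_finrank_eq h' he
        · exact (Submodule.eq_of_le_of_finrank_eq h' he.symm).symm
  simpa using this

/-- marked points have no small vectors -/
lemma marked_lower {m : ℕ} {ι : Type} [Fintype ι] (R : ℝ → ι → ((Fin m → ℝ) →ₗ[ℝ] ℝ))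
    (V0 : Finset (Fin m → ℤ)) (S : Finset (Submodule ℝ (Fin m → ℝ)))
    (hS : ∀ W, W ∈ S ↔ W ≠ ⊥ ∧ ∃ s : Finset (Fin m → ℤ), s ⊆ V0 ∧ W = Submodule.span ℝ (zc '' (s : Set (Fin m → ℤ))))
    (ε ρ x : ℝ) (hε : 0 < ε) (hρ1 : ρ ≤ 1) (hερ : (m + 1) * ε ≤ ρ)
    (hmark : QMarked S (fun W x => psi (R x) W) ((m + 1) * ε) ρ x) :
    ∀ v ∈ V0, v ≠ 0 → ∃ o, ε ≤ |R x o (zc v)| := by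
  classical
  intro v hv hv0
  by_contra hcon
  push Not at hcon
  -- strictly smaller bound
  obtain ⟨ε', hε'0, hε'1, hε'⟩ : ∃ ε', 0 ≤ ε' ∧ ε' < ε ∧ ∀ o, |R x o (zc v)| ≤ ε' := by
    refine ⟨‖fun o => R x o (zc v)‖, norm_nonneg _, (pi_norm_lt_iff hε).mpr hcon, fun o => ?_⟩
    exact norm_le_pi_norm (fun o => R x o (zc v)) o
  obtain ⟨M, hMS, hchain, hMb, hMax⟩ := hmark
  have hvz : zc v ≠ 0 := by
    intro h0
    apply hv0
    ext i
    have := congrFun h0 i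
    simpa [zc] using this
  -- the key subspace
  obtain ⟨W, hWrep, hWspan, hvW, hWψ, hWmax⟩ : ∃ W : Submodule ℝ (Fin m → ℝ), HasRep W ∧
      (∃ s : Finset (Fin m → ℤ), s ⊆ V0 ∧ W = Submodule.span ℝ (zc '' (s : Set (Fin m → ℤ)))) ∧
      zc v ∉ W ∧ psi (R x) W ≤ 1 ∧ ∀ W' ∈ M, (zc v ∉ W' → W' ≤ W) ∧ (zc v ∈ W' → W ≤ W') := by
    by_cases hT : (M.filter (fun W => zc v ∉ W)).Nonempty
    · obtain ⟨W, hW⟩ := Finset.exists_maximal hT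
      have hWm := hW.1
      simp only [Finset.mem_filter] at hWm
      obtain ⟨hW1, hW2⟩ := hWm
      have hWS := (hS W).mp (hMS hW1)
      obtain ⟨s, hs, hs'⟩ := hWS.2
      refine ⟨W, ?_, ⟨s, hs, hs'⟩, hW2, (hMb W hW1).2.trans hρ1, fun W' hW' => ⟨fun hvW' => ?_, fun hvW' => ?_⟩⟩
      · rw [hs']
        exact hasRep_span _ s.finite_toSet
      · rcases eq_or_ne W' W with h | h
        · exact h.le
        · rcases hchain hW' hW1 h with h' | h'
          · exact h'
          · exact hW.2 (Finset.mem_coe.mpr (Finset.mem_filter.mpr ⟨hW', hvW'⟩)) h'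
      · rcases eq_or_ne W' W with h | h
        · exact h.ge
        · rcases hchain hW' hW1 h with h' | h'
          · exact absurd (h' hvW') hW2
          · exact h'
    · rw [Finset.not_nonempty_iff_eq_empty, Finset.filter_eq_empty_iff] at hT
      refine ⟨⊥, ⟨_, _, rep_bot⟩, ⟨∅, by simp, by simp⟩, by simpa using hvz, psi_bot _,
        fun W' hW' => ⟨fun h => absurd h (hT hW'), fun _ => bot_le⟩⟩
  set W' := W ⊔ Submodule.span ℝ {zc v} with hW'
  have hvW' : zc v ∈ W' := Submodule.mem_sup_right (Submodule.mem_span_singleton_self _)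
  have hW'S : W' ∈ S := by
    rw [hS]
    refine ⟨fun h0 => ?_, ?_⟩
    · rw [h0] at hvW'
      exact hvz (by simpa using hvW')
    · obtain ⟨s, hs, hs'⟩ := hWspan
      refine ⟨insert v s, Finset.insert_subset hv hs, ?_⟩
      rw [Finset.coe_insert, image_insert_eq, Submodule.span_insert, ← hs', hW', sup_comm]
  have hlow : (m + 1) * ε ≤ psi (R x) W' := by
    by_cases hM' : W' ∈ M
    · exact (hMb W' hM').1
    · refine hερ.trans (hMax W' hW'S hM' fun s hs => ?_)
      by_cases hvs : zc v ∈ s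
      · left
        exact sup_le ((hWmax s hs).2 hvs) ((Submodule.span_singleton_le_iff_mem _ _).mpr hvs)
      · right
        exact ((hWmax s hs).1 hvs).trans le_sup_left
  have hup := psi_cons (R x) W hWrep v hvW ε' hε'0 hε'
  have h0 : 0 ≤ psi (R x) W := norm_nonneg _
  have hm : (0 : ℝ) < m + 1 := by positivity
  have h5 : (m + 1) * ε' * psi (R x) W ≤ (m + 1) * ε' * 1 := by gcongr
  have h6 : (m + 1) * ε' < (m + 1) * ε := by gcongr
  rw [← hW'] at hup
  linarith
end

section
open MeasureTheory Set
open scoped ENNReal Topology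

variable {n : ℕ}

theorem Loc.bound {Φ : ℕ → Fin (n + 1) → ℝ → ℝ} {a b C α κ : ℝ} (h : Loc Φ a b C α κ) :
    ∃ C' : ℝ, 0 < C' ∧ ∀ w : Option (Fin (n + 1)) → ℝ, (∀ i, 0 < w i) →
      (∀ i, i ≠ some 0 → w i ≤ 1) → ∀ j : Fin (n + 1), j ≠ 0 →
      1 ≤ ∏ i ∈ Finset.univ.erase (some j), w i → ∀ ε : ℝ, 0 < ε →
      volume {x ∈ Icc a b | ∃ v : Fin (n + 1) → ℤ, v ≠ 0 ∧ ∀ o, |w o * Lrow Φ x o (zc v)| < ε} ≤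
        ENNReal.ofReal (C' * ε ^ α) := by
  classical
  have hC := h.hC
  have hα := h.hα
  have hκ := h.hκ
  have hab := h.hab
  have hba : 0 < b - a := by linarith
  set ρ : ℝ := min κ 1 with hρ
  have hρ0 : 0 < ρ := by positivity
  have hρ1 : ρ ≤ 1 := min_le_right _ _
  have hρκ : ρ ≤ κ := min_le_left _ _
  set E : ℝ := ((((n + 1 : ℕ) : ℝ) + 1) / ρ) ^ α * (b - a) with hE
  have hEpos : 0 < E := by positivity
  set K : ℝ := (2 ^ (n + 1 + 2) - 2) * C + 1 with hK
  have h2 : (2 : ℝ) ≤ 2 ^ (n + 1 + 2) := by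
    calc (2 : ℝ) = 2 ^ 1 := by norm_num
      _ ≤ 2 ^ (n + 1 + 2) := by gcongr <;> [norm_num; omega]
  have h2' : 0 ≤ ((2 : ℝ) ^ (n + 1 + 2) - 2) * C := mul_nonneg (by linarith) hC.le
  have hKpos : 0 < K := by linarith
  refine ⟨K * E, by positivity, ?_⟩
  intro w hpos hle j hj hprod ε hε
  have hresc : ((((n + 1 : ℕ) : ℝ) + 1) * ε / ρ) ^ α * (b - a) = E * ε ^ α := by
    rw [show (((n + 1 : ℕ) : ℝ) + 1) * ε / ρ = (((n + 1 : ℕ) : ℝ) + 1) / ρ * ε by ring,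
      Real.mul_rpow (by positivity) hε.le, hE]
    ring
  have hεα : 0 < ε ^ α := by positivity
  rcases lt_or_ge ρ ((((n + 1 : ℕ) : ℝ) + 1) * ε) with hbig | hερ
  · -- trivial case
    calc _ ≤ volume (Icc a b) := measure_mono (fun x hx => hx.1)
      _ = ENNReal.ofReal (b - a) := Real.volume_Icc
      _ ≤ _ := by
        apply ENNReal.ofReal_le_ofReal
        have h1 : 1 ≤ ((((n + 1 : ℕ) : ℝ) + 1) * ε / ρ) ^ α :=
          Real.one_le_rpow ((one_le_div hρ0).mpr hbig.le) hα.le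
        have h3 : b - a ≤ E * ε ^ α := by
          rw [← hresc]
          nlinarith
        have h4 : 0 < E * ε ^ α := by positivity
        calc b - a ≤ 1 * (E * ε ^ α) := by linarith
          _ ≤ K * (E * ε ^ α) := by
            gcongr
            linarith
          _ = _ := by ring
  -- union over finite sets
  have hU : {x ∈ Icc a b | ∃ v : Fin (n + 1) → ℤ, v ≠ 0 ∧ ∀ o, |w o * Lrow Φ x o (zc v)| < ε} =
      ⋃ V0 : Finset (Fin (n + 1) → ℤ),
        {x ∈ Icc a b | ∃ v ∈ V0, v ≠ 0 ∧ ∀ o, |w o * Lrow Φ x o (zc v)| < ε} := by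
    ext x
    simp only [mem_iUnion]
    constructor
    · rintro ⟨hx, v, hv⟩
      exact ⟨{v}, hx, v, by simp, hv⟩
    · rintro ⟨V0, hx, v, -, hv⟩
      exact ⟨hx, v, hv⟩
  rw [hU, Directed.measure_iUnion]
  swap
  · intro V V'
    refine ⟨V ∪ V', ?_, ?_⟩
    · rintro x ⟨hx, v, hv, hv'⟩
      exact ⟨hx, v, Finset.mem_union_left _ hv, hv'⟩
    · rintro x ⟨hx, v, hv, hv'⟩
      exact ⟨hx, v, Finset.mem_union_right _ hv, hv'⟩
  refine iSup_le fun V0 => ?_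
  set S : Finset (Submodule ℝ (Fin (n + 1) → ℝ)) :=
    (V0.powerset.image fun s : Finset (Fin (n + 1) → ℤ) => Submodule.span ℝ (zc '' (s : Set (Fin (n + 1) → ℤ)))).filter (· ≠ ⊥) with hS
  have hSm : ∀ W, W ∈ S ↔ W ≠ ⊥ ∧ ∃ s : Finset (Fin (n + 1) → ℤ), s ⊆ V0 ∧
      W = Submodule.span ℝ (zc '' (s : Set (Fin (n + 1) → ℤ))) := by
    intro W
    simp only [hS, Finset.mem_filter, Finset.mem_image, Finset.mem_powerset]
    constructor
    · rintro ⟨⟨s, hs, rfl⟩, h0⟩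
      exact ⟨h0, s, hs, rfl⟩
    · rintro ⟨h0, s, hs, rfl⟩
      exact ⟨⟨s, hs, rfl⟩, h0⟩
  have hSrep : ∀ W ∈ S, HasRep W := by
    intro W hW
    obtain ⟨-, s, -, rfl⟩ := (hSm W).mp hW
    exact hasRep_span _ s.finite_toSet
  set θ : ℝ := C * ((((n + 1 : ℕ) : ℝ) + 1) * ε / ρ) ^ α with hθ
  have hθ0 : 0 ≤ θ := by positivity
  have hq := qnd (fun (W : Submodule ℝ (Fin (n + 1) → ℝ)) x => psi (Rrow w Φ x) W) ((((n + 1 : ℕ) : ℝ) + 1) * ε) ρ θ a b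
    hθ0 S (fun W _ => h.cont_nuf w _)
    (fun W _ u v hau huv hvb hx => h.good_nuf w _ _ ρ (by positivity) hρ0 u v hau huv hvb hx)
    (n + 1 + 1) S subset_rfl (fun M _ hM => chain_card M hM) a b le_rfl hab le_rfl (fun W hW => by
      obtain ⟨hr, -⟩ := chosen_spec (Option (Fin (n + 1))) W (hSrep W hW)
      have hk : 1 ≤ (chosen (Option (Fin (n + 1))) W).1 := by
        rw [← hr.finrank]
        have := ((hSm W).mp hW).1
        rw [Nat.one_le_iff_ne_zero]
        intro h0
        exact this (Submodule.finrank_eq_zero.mp h0)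
      obtain ⟨x, hx, hx'⟩ := h.lower w hpos hle j hj hprod hk _ W hr
      exact ⟨x, hx, hρκ.trans hx'⟩)
  refine le_trans (measure_mono ?_) (hq.trans ?_)
  · rintro x ⟨hx, v, hv, hv0, hv'⟩
    refine ⟨hx, fun hmark => ?_⟩
    obtain ⟨o, ho⟩ := marked_lower (fun x => Rrow w Φ x) V0 S hSm ε ρ x hε hρ1 hερ hmark v hv hv0
    have := hv' o
    have e : Rrow w Φ x o (zc v) = w o * Lrow Φ x o (zc v) := rfl
    rw [e] at ho
    linarith
  · apply ENNReal.ofReal_le_ofReal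
    have h4 : 0 < E * ε ^ α := by positivity
    calc (2 ^ (n + 1 + 1 + 1) - 2) * θ * (b - a) =
          ((2 ^ (n + 1 + 2) - 2) * C) * (((((n + 1 : ℕ) : ℝ) + 1) * ε / ρ) ^ α * (b - a)) := by
          rw [hθ]
          ring
      _ = ((2 ^ (n + 1 + 2) - 2) * C) * (E * ε ^ α) := by rw [hresc]
      _ ≤ K * (E * ε ^ α) := by
          gcongr
          linarith
      _ = _ := by ring
end

section
open MeasureTheory Set
open scoped ENNReal Topology

lemma exists_loc_one (Φ : ℕ → Fin (1 + 1) → ℝ → ℝ) (x0 : ℝ)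
    (hd : ∀ᶠ y in 𝓝 x0, ∀ j, HasDerivAt (Φ 0 j) (Φ 1 j y) y)
    (hc : ∀ᶠ y in 𝓝 x0, ∀ j, ContinuousAt (Φ 1 j) y)
    (hne : Φ 1 1 x0 ≠ 0)
    (one : ∀ y, Φ 0 0 y = 1) (zero : ∀ y, Φ 1 0 y = 0) :
    ∃ a b C κ, a < x0 ∧ x0 < b ∧ Loc Φ a b C 1 κ := by
  set p := |Φ 1 1 x0| with hp
  have hp0 : 0 < p := abs_pos.mpr hne
  have hcc : ContinuousAt (fun y => |Φ 1 1 y|) x0 := (hc.self_of_nhds 1).abs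
  have e1 : ∀ᶠ y in 𝓝 x0, p / 2 < |Φ 1 1 y| := hcc.eventually (lt_mem_nhds (by
    change p / 2 < p
    linarith))
  have e2 : ∀ᶠ y in 𝓝 x0, |Φ 1 1 y| < 2 * p := hcc.eventually (gt_mem_nhds (by
    change p < 2 * p
    linarith))
  obtain ⟨δ, hδ, hball⟩ := Metric.eventually_nhds_iff.mp (hd.and (hc.and (e1.and e2)))
  set a := x0 - δ / 2 with ha
  set b := x0 + δ / 2 with hb
  have hab : a < b := by linarith
  have hI : ∀ y ∈ Icc a b, (∀ j, HasDerivAt (Φ 0 j) (Φ 1 j y) y) ∧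
      (∀ j, ContinuousAt (Φ 1 j) y) ∧ p / 2 < |Φ 1 1 y| ∧ |Φ 1 1 y| < 2 * p := by
    intro y hy
    apply hball
    rw [Real.dist_eq, abs_lt]
    constructor <;> linarith [hy.1, hy.2]
  have key : ∀ x ∈ Icc a b, ∀ y ∈ Icc a b, x < y → ∃ z ∈ Icc a b,
      Φ 0 1 y - Φ 0 1 x = Φ 1 1 z * (y - x) := by
    intro x hx y hy hxy
    obtain ⟨z, hz, hz'⟩ := exists_hasDerivAt_eq_slope (Φ 0 1) (Φ 1 1) hxy
      (fun w hw => ((hI w ⟨hx.1.trans hw.1, hw.2.trans hy.2⟩).1 1).continuousAt.continuousWithinAt)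
      (fun w hw => (hI w ⟨hx.1.trans hw.1.le, hw.2.le.trans hy.2⟩).1 1)
    refine ⟨z, ⟨hx.1.trans hz.1.le, hz.2.le.trans hy.2⟩, ?_⟩
    rw [hz']
    have : y - x ≠ 0 := by linarith
    field_simp
  have key2 : ∀ x ∈ Icc a b, ∀ y ∈ Icc a b, p / 2 * |y - x| ≤ |Φ 0 1 y - Φ 0 1 x| ∧
      |Φ 0 1 y - Φ 0 1 x| ≤ 2 * p * |y - x| := by
    have aux : ∀ x ∈ Icc a b, ∀ y ∈ Icc a b, x < y → p / 2 * |y - x| ≤ |Φ 0 1 y - Φ 0 1 x| ∧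
      |Φ 0 1 y - Φ 0 1 x| ≤ 2 * p * |y - x| := by
      intro x hx y hy hxy
      obtain ⟨z, hz, hz'⟩ := key x hx y hy hxy
      rw [hz', abs_mul]
      have := (hI z hz).2.2
      constructor <;> gcongr
      · exact this.1.le
      · exact this.2.le
    intro x hx y hy
    rcases lt_trichotomy x y with h | h | h
    · exact aux x hx y hy h
    · subst h; simp
    · have := aux y hy x hx h
      rw [abs_sub_comm (Φ 0 1 y), abs_sub_comm y x]
      exact this
  have hU : ∀ (c : Fin (1 + 1) → ℝ) y, Ufun Φ 0 c y = c 0 + c 1 * Φ 0 1 y := by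
    intro c y
    simp [Ufun, Fin.sum_univ_succ, one]
  have hU1 : ∀ (c : Fin (1 + 1) → ℝ) y, Ufun Φ 1 c y = c 1 * Φ 1 1 y := by
    intro c y
    simp [Ufun, Fin.sum_univ_succ, zero]
  have hG : ∀ (c d : Fin (1 + 1) → ℝ) y, Gfun Φ c d y = (c 0 * d 1 - c 1 * d 0) * Φ 1 1 y := by
    intro c d y
    rw [Gfun, hU, hU, hU1, hU1]
    ring
  have triv : ∀ (g : ℝ → ℝ) (u v : ℝ), u < v → ∀ x, ∀ ε : ℝ, 1 / 4 ≤ ε →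
      volume {y ∈ Icc u v | |g y| < ε * |g x|} ≤ ENNReal.ofReal (32 * ε ^ (1:ℝ) * (v - u)) := by
    intro g u v huv x ε hε
    calc _ ≤ volume (Icc u v) := measure_mono (fun y hy => hy.1)
      _ = ENNReal.ofReal (v - u) := Real.volume_Icc
      _ ≤ _ := by
        apply ENNReal.ofReal_le_ofReal
        rw [Real.rpow_one]
        nlinarith
  set L := b - a with hL
  have hL0 : 0 < L := by linarith
  set R : ℝ := 1 + 4 / (p * L) * (1 + |Φ 0 1 a|) with hR
  have hR0 : 0 < R := by positivity
  refine ⟨a, b, 32, min R⁻¹ (p / 2), by linarith, by linarith, hab, by norm_num, by norm_num,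
    by positivity, ?_, ?_, one, zero, ?_, ?_, ?_, ?_⟩
  · intro j y hy
    exact ((hI y hy).1 j).continuousAt.continuousWithinAt
  · intro j y hy
    exact ((hI y hy).2.1 j).continuousWithinAt
  · intro c u v hau huv hvb x hx ε hε
    rcases le_or_gt (1 / 4) ε with hε' | hε'
    · exact triv _ u v huv x ε hε'
    have sub : ∀ z ∈ Icc u v, z ∈ Icc a b := fun z hz => ⟨hau.trans hz.1, hz.2.trans hvb⟩
    rcases Set.eq_empty_or_nonempty {y ∈ Icc u v | |Ufun Φ 0 c y| < ε * |Ufun Φ 0 c x|} with h0 | ⟨y, hy, hy'⟩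
    · rw [h0]; simp
    have hxy := key2 x (sub x hx) y (sub y hy)
    have hyx : |y - x| ≤ v - u := by
      rw [abs_le]
      constructor <;> linarith [hx.1, hx.2, hy.1, hy.2]
    have hd1 : |Ufun Φ 0 c x| ≤ |Ufun Φ 0 c y| + |c 1| * |Φ 0 1 y - Φ 0 1 x| := by
      rw [← abs_mul]
      have : Ufun Φ 0 c x = Ufun Φ 0 c y - c 1 * (Φ 0 1 y - Φ 0 1 x) := by
        rw [hU, hU]; ring
      rw [this]
      exact abs_sub _ _
    have hux : |Ufun Φ 0 c x| ≤ 4 * |c 1| * p * (v - u) := by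
      have : |c 1| * |Φ 0 1 y - Φ 0 1 x| ≤ |c 1| * (2 * p * (v - u)) := by
        gcongr
        exact hxy.2.trans (by gcongr)
      have h1 : ε * |Ufun Φ 0 c x| ≤ 1 / 4 * |Ufun Φ 0 c x| := by gcongr
      nlinarith [abs_nonneg (Ufun Φ 0 c x), abs_nonneg (c 1)]
    have hux0 : 0 < |Ufun Φ 0 c x| := by
      rcases (abs_nonneg (Ufun Φ 0 c x)).lt_or_eq with h | h
      · exact h
      · rw [← h, mul_zero] at hy'
        exact absurd hy' (not_lt.mpr (abs_nonneg _))
    have hc1 : 0 < |c 1| := by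
      rcases (abs_nonneg (c 1)).lt_or_eq with h | h
      · exact h
      · rw [← h] at hux
        simp at hux
        simp [hux] at hux0
    calc _ ≤ volume (Icc (y - 16 * ε * (v - u)) (y + 16 * ε * (v - u))) := by
          apply measure_mono
          rintro z ⟨hz, hz'⟩
          have hzy := (key2 y (sub y hy) z (sub z hz)).1
          have : |c 1| * |Φ 0 1 z - Φ 0 1 y| ≤ |Ufun Φ 0 c z| + |Ufun Φ 0 c y| := by
            rw [← abs_mul]
            have : c 1 * (Φ 0 1 z - Φ 0 1 y) = Ufun Φ 0 c z - Ufun Φ 0 c y := by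
              rw [hU, hU]; ring
            rw [this]
            exact abs_sub _ _
          have h3 : |c 1| * (p / 2 * |z - y|) ≤ |c 1| * |Φ 0 1 z - Φ 0 1 y| := by gcongr
          have h4 : |c 1| * (p / 2 * |z - y|) ≤ 2 * (ε * (4 * |c 1| * p * (v - u))) := by
            have : ε * |Ufun Φ 0 c x| ≤ ε * (4 * |c 1| * p * (v - u)) := by gcongr
            linarith
          have h5 : |z - y| ≤ 16 * ε * (v - u) := by
            have hcp : 0 < |c 1| * p / 2 := by positivity
            refine le_of_mul_le_mul_left ?_ hcp
            calc _ = |c 1| * (p / 2 * |z - y|) := by ring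
              _ ≤ _ := h4
              _ = _ := by ring
          rw [abs_le] at h5
          constructor <;> linarith [h5.1, h5.2]
      _ = ENNReal.ofReal (32 * ε ^ (1:ℝ) * (v - u)) := by
          rw [Real.volume_Icc, Real.rpow_one]
          congr 1
          ring
  · intro c d u v hau huv hvb x hx ε hε
    rcases le_or_gt (1 / 4) ε with hε' | hε'
    · exact triv _ u v huv x ε hε'
    have sub : ∀ z ∈ Icc u v, z ∈ Icc a b := fun z hz => ⟨hau.trans hz.1, hz.2.trans hvb⟩
    have : {y ∈ Icc u v | |Gfun Φ c d y| < ε * |Gfun Φ c d x|} = ∅ := by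
      ext y
      simp only [mem_setOf_eq, mem_empty_iff_false, iff_false, not_and, not_lt]
      intro hy
      rw [hG, hG, abs_mul, abs_mul]
      have h1 := (hI y (sub y hy)).2.2.1
      have h2 := (hI x (sub x hx)).2.2.2
      have h3 : ε * |Φ 1 1 x| ≤ |Φ 1 1 y| := by
        have : ε * |Φ 1 1 x| ≤ 1 / 4 * (2 * p) := by gcongr
        linarith
      calc _ = |c 0 * d 1 - c 1 * d 0| * (ε * |Φ 1 1 x|) := by ring
        _ ≤ _ := by gcongr
    rw [this]; simp
  · intro c
    set M := max |Ufun Φ 0 c a| |Ufun Φ 0 c b| with hM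
    have hM0 : 0 ≤ M := (abs_nonneg _).trans (le_max_left _ _)
    have ha1 : |Ufun Φ 0 c a| ≤ M := le_max_left _ _
    have hb1 : |Ufun Φ 0 c b| ≤ M := le_max_right _ _
    have hk := (key2 a (left_mem_Icc.mpr hab.le) b (right_mem_Icc.mpr hab.le)).1
    rw [abs_of_pos (by linarith : 0 < b - a)] at hk
    have h1 : |c 1| * |Φ 0 1 b - Φ 0 1 a| ≤ |Ufun Φ 0 c b| + |Ufun Φ 0 c a| := by
      rw [← abs_mul]
      have : c 1 * (Φ 0 1 b - Φ 0 1 a) = Ufun Φ 0 c b - Ufun Φ 0 c a := by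
        rw [hU, hU]; ring
      rw [this]
      exact abs_sub _ _
    have h2 : |c 1| ≤ 4 / (p * L) * M := by
      have h3 : |c 1| * (p / 2 * L) ≤ |c 1| * |Φ 0 1 b - Φ 0 1 a| := by gcongr
      rw [div_mul_eq_mul_div, le_div_iff₀ (by positivity)]
      linarith
    have h4 : |c 0| ≤ M + |c 1| * |Φ 0 1 a| := by
      have : c 0 = Ufun Φ 0 c a - c 1 * Φ 0 1 a := by rw [hU]; ring
      rw [this, ← abs_mul]
      exact (abs_sub _ _).trans (by gcongr)
    have h5 : ‖c‖ ≤ R * M := by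
      have hq : 0 ≤ 4 / (p * L) * M := by positivity
      have hq' : 0 ≤ 4 / (p * L) * M * |Φ 0 1 a| := by positivity
      refine (pi_norm_le_iff_of_nonneg (by positivity)).mpr fun i => ?_
      rw [Real.norm_eq_abs]
      have e : R * M = M + 4 / (p * L) * M + 4 / (p * L) * M * |Φ 0 1 a| := by rw [hR]; ring
      rw [e]
      fin_cases i
      · have : |c 1| * |Φ 0 1 a| ≤ 4 / (p * L) * M * |Φ 0 1 a| := by gcongr
        change |c 0| ≤ _
        linarith
      · change |c 1| ≤ _
        linarith
    have h6 : min R⁻¹ (p / 2) * ‖c‖ ≤ M := by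
      calc _ ≤ R⁻¹ * (R * M) := by
            gcongr
            exact min_le_left _ _
        _ = M := by field_simp
    rcases max_choice |Ufun Φ 0 c a| |Ufun Φ 0 c b| with h | h
    · exact ⟨a, left_mem_Icc.mpr hab.le, h6.trans (hM.trans h).le⟩
    · exact ⟨b, right_mem_Icc.mpr hab.le, h6.trans (hM.trans h).le⟩
  · intro c d i j
    refine ⟨a, left_mem_Icc.mpr hab.le, ?_⟩
    rw [hG, abs_mul]
    have h1 := (hI a (left_mem_Icc.mpr hab.le)).2.2.1
    have h2 : |c i * d j - c j * d i| ≤ |c 0 * d 1 - c 1 * d 0| := by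
      fin_cases i <;> fin_cases j
      · simp
      · exact le_rfl
      · rw [abs_sub_comm]; exact le_rfl
      · simp
    calc _ ≤ (p / 2) * |c 0 * d 1 - c 1 * d 0| := by
          gcongr
          exact min_le_right _ _
      _ ≤ |Φ 1 1 a| * |c 0 * d 1 - c 1 * d 0| := by gcongr
      _ = _ := by ring
end

section
open MeasureTheory Set
open scoped ENNReal Topology

variable {n : ℕ}

lemma cda_iter {g : ℝ → ℝ} {y : ℝ} {n : ℕ} (h : ContDiffAt ℝ n g y) (i k : ℕ) (hi : k + i ≤ n) :
    ContDiffAt ℝ k (iteratedDeriv i g) y := by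
  induction i generalizing k with
  | zero => 
    rw [iteratedDeriv_zero]
    exact h.of_le (by exact_mod_cast hi)
  | succ i ih =>
    rw [iteratedDeriv_succ]
    exact (ih (k + 1) (by omega)).derivWithin (by push_cast; exact le_rfl)

lemma hda_iter {g : ℝ → ℝ} {y : ℝ} {n : ℕ} (h : ContDiffAt ℝ n g y) (i : ℕ) (hi : i < n) :
    HasDerivAt (iteratedDeriv i g) (iteratedDeriv (i + 1) g y) y := by
  rw [iteratedDeriv_succ]
  exact ((cda_iter h i 1 (by omega)).differentiableAt (by norm_num)).hasDerivAt

noncomputable def PhiF (f : ℝ → Fin n → ℝ) (i : ℕ) : Fin (n + 1) → ℝ → ℝ :=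
  Fin.cons (fun _ => if i = 0 then 1 else 0) (fun j => iteratedDeriv i (fun y => f y j))

lemma PhiF_zero (f : ℝ → Fin n → ℝ) (i : ℕ) : PhiF f i 0 = fun _ => if i = 0 then 1 else 0 := rfl
lemma PhiF_succ (f : ℝ → Fin n → ℝ) (i : ℕ) (j : Fin n) :
    PhiF f i j.succ = iteratedDeriv i (fun y => f y j) := rfl

lemma NondegAt.ev {f : ℝ → Fin n → ℝ} {x0 : ℝ} (h : NondegAt f x0) :
    ∀ᶠ y in 𝓝 x0, ∀ j, ContDiffAt ℝ n (fun x => f x j) y := by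
  obtain ⟨⟨U, hU, hf⟩, -⟩ := h
  have h2 : ∀ j, ContDiffAt ℝ n (fun x => f x j) x0 := fun j => (hf j).contDiffAt hU
  rw [Filter.eventually_all]
  intro j
  exact (h2 j).eventually (by simp)

lemma nondeg_loc (hn : 1 ≤ n) {f : ℝ → Fin n → ℝ} {x0 : ℝ} (h : NondegAt f x0) :
    ∃ a b C κ, a < x0 ∧ x0 < b ∧ Loc (PhiF f) a b C (2 * (n : ℝ) - 1)⁻¹ κ := by
  have hev := h.ev
  have hdet := h.2
  have hd : ∀ᶠ y in 𝓝 x0, ∀ i < n, ∀ j, HasDerivAt (PhiF f i j) (PhiF f (i + 1) j y) y := by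
    filter_upwards [hev] with y hy i hi j
    refine Fin.cases ?_ (fun j => ?_) j
    · rw [PhiF_zero, PhiF_zero]
      simpa using hasDerivAt_const y _
    · rw [PhiF_succ, PhiF_succ]
      exact hda_iter (hy j) i hi
  have hcc : ∀ᶠ y in 𝓝 x0, ∀ i ≤ n, ∀ j, ContinuousAt (PhiF f i j) y := by
    filter_upwards [hev] with y hy i hi j
    refine Fin.cases ?_ (fun j => ?_) j
    · rw [PhiF_zero]
      exact continuousAt_const
    · rw [PhiF_succ]
      exact (cda_iter (hy j) i 0 (by omega)).continuousAt
  have one : ∀ y, PhiF f 0 0 y = 1 := fun y => by simp [PhiF_zero]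
  have zero : ∀ y, PhiF f 1 0 y = 0 := fun y => by simp [PhiF_zero]
  rcases Nat.lt_or_ge n 2 with h1 | h2
  · obtain rfl : n = 1 := by omega
    obtain ⟨a, b, C, κ, ha, hb, hl⟩ := exists_loc_one (PhiF f) x0
      (hd.mono fun y hy j => hy 0 (by norm_num) j) (hcc.mono fun y hy j => hy 1 le_rfl j)
      (by
        rw [Matrix.det_fin_one] at hdet
        exact hdet) one zero
    refine ⟨a, b, C, κ, ha, hb, ?_⟩
    norm_num
    exact hl
  · refine exists_loc h2 (PhiF f) x0 hd (fun i j => hcc.self_of_nhds i (by omega) j) ?_ one zero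
    rw [Matrix.det_succ_column_zero, Fin.sum_univ_succ]
    have : ∀ i : Fin n, (Matrix.of fun (i j : Fin (n + 1)) => PhiF f i j x0) i.succ 0 = 0 := by
      intro i
      simp [PhiF_zero]
    simp only [this]
    simp only [mul_zero, zero_mul, Finset.sum_const_zero, add_zero]
    have e : (Matrix.of fun (i j : Fin (n + 1)) => PhiF f i j x0).submatrix (Fin.succAbove 0) Fin.succ =
      Matrix.of fun i j : Fin n => iteratedDeriv (i.1 + 1) (fun x => f x j) x0 := by
      ext i j
      simp [PhiF_succ]
    rw [e]
    simpa [PhiF_zero] using hdet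
end

section
open MeasureTheory Set
open scoped ENNReal Topology

variable {n : ℕ}

def MBound (Φ : ℕ → Fin (n + 1) → ℝ → ℝ) (s : Set ℝ) (α C : ℝ) : Prop :=
  ∀ w : Option (Fin (n + 1)) → ℝ, (∀ i, 0 < w i) →
      (∀ i, i ≠ some 0 → w i ≤ 1) → ∀ j : Fin (n + 1), j ≠ 0 →
      1 ≤ ∏ i ∈ Finset.univ.erase (some j), w i → ∀ ε : ℝ, 0 < ε →
      volume {x ∈ s | ∃ v : Fin (n + 1) → ℤ, v ≠ 0 ∧ ∀ o, |w o * Lrow Φ x o (zc v)| < ε} ≤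
        ENNReal.ofReal (C * ε ^ α)

lemma MBound.mono_C {Φ : ℕ → Fin (n + 1) → ℝ → ℝ} {s : Set ℝ} {α C C' : ℝ} (h : MBound Φ s α C)
    (hC : C ≤ C') : MBound Φ s α C' := by
  intro w h1 h2 j hj hp ε hε
  refine (h w h1 h2 j hj hp ε hε).trans (ENNReal.ofReal_le_ofReal ?_)
  gcongr

lemma f_bound (hn : 1 ≤ n) (f : ℝ → Fin n → ℝ) (ia ib : ℝ)
    (hnd : ∀ x ∈ Icc ia ib, NondegAt f x) :
    ∃ C : ℝ, 0 < C ∧ MBound (PhiF f) (Icc ia ib) (2 * (n : ℝ) - 1)⁻¹ C := by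
  refine isCompact_Icc.induction_on (p := fun s => ∃ C : ℝ, 0 < C ∧
    MBound (PhiF f) s (2 * (n : ℝ) - 1)⁻¹ C) ?_ ?_ ?_ ?_
  · refine ⟨1, one_pos, ?_⟩
    intro w h1 h2 j hj hp ε hε
    simp
  · rintro s t hst ⟨C, hC, h⟩
    refine ⟨C, hC, ?_⟩
    intro w h1 h2 j hj hp ε hε
    refine le_trans (measure_mono ?_) (h w h1 h2 j hj hp ε hε)
    rintro x ⟨hx, hx'⟩
    exact ⟨hst hx, hx'⟩
  · rintro s t ⟨C, hC, h⟩ ⟨C', hC', h'⟩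
    refine ⟨C + C', by positivity, ?_⟩
    intro w h1 h2 j hj hp ε hε
    rw [add_mul, ENNReal.ofReal_add (by positivity) (by positivity)]
    refine le_trans ?_ (add_le_add (h w h1 h2 j hj hp ε hε) (h' w h1 h2 j hj hp ε hε))
    refine le_trans (measure_mono ?_) (measure_union_le _ _)
    rintro x ⟨hx | hx, hx'⟩
    · exact Or.inl ⟨hx, hx'⟩
    · exact Or.inr ⟨hx, hx'⟩
  · intro x hx
    obtain ⟨a, b, C, κ, ha, hb, hl⟩ := nondeg_loc hn (hnd x hx)
    obtain ⟨C', hC', h⟩ := hl.bound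
    exact ⟨Icc a b, mem_nhdsWithin_of_mem_nhds (Icc_mem_nhds ha hb), C', hC', h⟩

lemma fam_bound (hn : 1 ≤ n) (F : Set (ℝ → Fin n → ℝ)) (hF : F.Finite) (ia ib : ℝ)
    (hnd : ∀ f ∈ F, ∀ x ∈ Icc ia ib, NondegAt f x) :
    ∃ C : ℝ, 0 < C ∧ ∀ f ∈ F, MBound (PhiF f) (Icc ia ib) (2 * (n : ℝ) - 1)⁻¹ C := by
  have : ∀ f : ℝ → Fin n → ℝ, ∃ C : ℝ, f ∈ F →
      MBound (PhiF f) (Icc ia ib) (2 * (n : ℝ) - 1)⁻¹ C := by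
    intro f
    by_cases h : f ∈ F
    · obtain ⟨C, -, hC⟩ := f_bound hn f ia ib (hnd f h)
      exact ⟨C, fun _ => hC⟩
    · exact ⟨0, fun h' => absurd h' h⟩
  choose g hg using this
  obtain ⟨M, hM⟩ := (hF.image g).bddAbove
  refine ⟨max M 1, by positivity, fun f hf => ?_⟩
  exact (hg f hf).mono_C ((hM (mem_image_of_mem g hf)).trans (le_max_left _ _))

lemma grid (ia ib δ V : ℝ) (hδ : 0 < δ) (hδL : δ ≤ ib - ia) (S Dp : Set ℝ)
    (hS : S ⊆ Icc ia ib) (hV : 0 ≤ V)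
    (hth : ∀ x ∈ S, ∀ y ∈ Icc ia ib, |y - x| ≤ δ → y ∈ Dp)
    (hvol : volume Dp ≤ ENNReal.ofReal V) :
    ∃ D : Finset (Set ℝ), (∀ Δ ∈ D, ∃ u v : ℝ, Δ = Icc u v ∧ v - u ≤ δ) ∧
      (D.card : ℝ) ≤ 2 * V / δ ∧ S ⊆ ⋃ Δ ∈ D, Δ := by
  classical
  set L := ib - ia with hL
  have hL0 : 0 < L := by linarith
  set N := ⌈L / δ⌉₊ with hN
  have hN1 : L / δ ≤ N := Nat.le_ceil _
  have hN2 : (N : ℝ) < L / δ + 1 := Nat.ceil_lt_add_one (by positivity)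
  have hLδ : 1 ≤ L / δ := (one_le_div hδ).mpr hδL
  have hN0 : (0 : ℝ) < N := by linarith
  set h := L / N with hh
  have hh0 : 0 < h := by positivity
  have hhδ : h ≤ δ := by
    rw [hh, div_le_iff₀ hN0]
    rw [div_le_iff₀ hδ] at hN1
    linarith
  have hhδ2 : δ / 2 ≤ h := by
    rw [hh, le_div_iff₀ hN0]
    have : (N : ℝ) ≤ 2 * (L / δ) := by linarith
    calc δ / 2 * N ≤ δ / 2 * (2 * (L / δ)) := by gcongr
      _ = L := by field_simp
  set cell : ℕ → Set ℝ := fun i => Icc (ia + i * h) (ia + (i + 1) * h) with hcell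
  set T := (Finset.range N).filter fun i => (cell i ∩ S).Nonempty with hT
  refine ⟨T.image cell, ?_, ?_, ?_⟩
  · intro Δ hΔ
    obtain ⟨i, -, rfl⟩ := Finset.mem_image.mp hΔ
    exact ⟨_, _, rfl, by linarith⟩
  · have hNh : N * h = L := by
      rw [hh]; field_simp
    have hsub : (⋃ i ∈ T, Ioo (ia + i * h) (ia + (i + 1) * h)) ⊆ Dp := by
      intro y hy
      simp only [mem_iUnion] at hy
      obtain ⟨i, hi, hy⟩ := hy
      rw [hT, Finset.mem_filter, Finset.mem_range] at hi
      obtain ⟨hiN, x, hx, hxS⟩ := hi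
      have hi' : (i : ℝ) + 1 ≤ N := by exact_mod_cast hiN
      have h1 : ((i : ℝ) + 1) * h ≤ L := by
        rw [← hNh]; gcongr
      have h0 : 0 ≤ (i : ℝ) * h := by positivity
      refine hth x hxS y ⟨by linarith [hy.1], by linarith [hy.2]⟩ ?_
      rw [abs_le]
      constructor <;> linarith [hy.1, hy.2, hx.1, hx.2]
    have hdisj : (T : Set ℕ).PairwiseDisjoint
        (fun i : ℕ => Ioo (ia + (i : ℝ) * h) (ia + ((i : ℝ) + 1) * h)) := by
      intro i _ j _ hij
      rw [Function.onFun, Set.disjoint_left]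
      intro y hy hy'
      apply hij
      have h1 : (i : ℝ) < j + 1 := by
        by_contra hc
        push Not at hc
        have := mul_le_mul_of_nonneg_right hc hh0.le
        linarith [hy.1, hy'.2]
      have h2 : (j : ℝ) < i + 1 := by
        by_contra hc
        push Not at hc
        have := mul_le_mul_of_nonneg_right hc hh0.le
        linarith [hy.2, hy'.1]
      have h1' : i < j + 1 := by exact_mod_cast h1
      have h2' : j < i + 1 := by exact_mod_cast h2
      omega
    have hm := (measure_mono hsub).trans hvol
    rw [measure_biUnion_finset hdisj (fun i _ => measurableSet_Ioo)] at hm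
    have hs : ∑ i ∈ T, volume (Ioo (ia + (i : ℝ) * h) (ia + ((i : ℝ) + 1) * h)) =
        ENNReal.ofReal (T.card * h) := by
      rw [ENNReal.ofReal_mul (by positivity), ENNReal.ofReal_natCast, ← nsmul_eq_mul,
        ← Finset.sum_const]
      refine Finset.sum_congr rfl fun i _ => ?_
      rw [Real.volume_Ioo]
      congr 1
      ring
    rw [hs, ENNReal.ofReal_le_ofReal_iff hV] at hm
    have hc : ((T.image cell).card : ℝ) ≤ T.card := by exact_mod_cast Finset.card_image_le
    rw [le_div_iff₀ hδ]
    have : (T.card : ℝ) * (δ / 2) ≤ T.card * h := by gcongr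
    have : ((T.image cell).card : ℝ) * (δ / 2) ≤ T.card * (δ / 2) := by gcongr
    linarith
  · intro x hx
    have hxI := hS hx
    have hxa : 0 ≤ (x - ia) / h := div_nonneg (by linarith [hxI.1]) hh0.le
    have hNh : N * h = L := by
      rw [hh]; field_simp
    have hN1' : 1 ≤ N := by
      have : 0 < N := by exact_mod_cast hN0
      omega
    have : ∃ i < N, x ∈ cell i := by
      rcases lt_or_ge ⌊(x - ia) / h⌋₊ N with hlt | hge
      · refine ⟨_, hlt, ?_, ?_⟩
        · have := Nat.floor_le hxa
          rw [le_div_iff₀ hh0] at this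
          linarith
        · have := Nat.lt_floor_add_one ((x - ia) / h)
          rw [div_lt_iff₀ hh0] at this
          linarith
      · have h1 : (N : ℝ) ≤ (x - ia) / h := (Nat.cast_le.mpr hge).trans (Nat.floor_le hxa)
        rw [le_div_iff₀ hh0] at h1
        refine ⟨N - 1, by omega, ?_⟩
        have e : ((N - 1 : ℕ) : ℝ) = N - 1 := by push_cast [hN1']; ring
        rw [hcell]
        simp only [e]
        constructor <;> nlinarith [hxI.1, hxI.2]
    obtain ⟨i, hi, hxi⟩ := this
    simp only [mem_iUnion]
    refine ⟨cell i, Finset.mem_image_of_mem _ ?_, hxi⟩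
    rw [hT, Finset.mem_filter, Finset.mem_range]
    exact ⟨hi, x, hxi, hx⟩
end

section
open MeasureTheory Set
open scoped ENNReal Topology

variable {n : ℕ}

lemma U0_cons (f : ℝ → Fin n → ℝ) (a₀ : ℤ) (a : Fin n → ℤ) (y : ℝ) :
    Ufun (PhiF f) 0 (zc (Fin.cons a₀ a : Fin (n + 1) → ℤ)) y = (a₀ : ℝ) + ∑ j, (a j : ℝ) * f y j := by
  simp [Ufun, Fin.sum_univ_succ, PhiF_zero, PhiF_succ, zc]

lemma U1_cons (f : ℝ → Fin n → ℝ) (a₀ : ℤ) (a : Fin n → ℤ) (y : ℝ) :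
    Ufun (PhiF f) 1 (zc (Fin.cons a₀ a : Fin (n + 1) → ℤ)) y =
      ∑ j, (a j : ℝ) * deriv (fun z => f z j) y := by
  simp [Ufun, Fin.sum_univ_succ, PhiF_zero, PhiF_succ, zc]

/-- first-derivative stability -/
lemma deriv_near (hn : 1 ≤ n) {F : Set (ℝ → Fin n → ℝ)} {ia ib c₀ c₁ : ℝ}
    (hPF : PropertyF F (Icc ia ib) c₀ c₁) {f : ℝ → Fin n → ℝ} (hf : f ∈ F)
    (hnd : ∀ x ∈ Icc ia ib, NondegAt f x) (a : Fin n → ℤ) (A B δ : ℝ) (hA : 1 ≤ A)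
    (hBδ : B * δ ≤ 1) (hB : ∀ i, |(a i : ℝ)| ≤ B) (hB0 : 0 ≤ B)
    {x y : ℝ} (hx : x ∈ Icc ia ib) (hy : y ∈ Icc ia ib) (hxy : |y - x| ≤ δ)
    (h1 : |∑ j, (a j : ℝ) * deriv (fun z => f z j) x| < (n : ℝ) * c₁ * A) :
    |∑ j, (a j : ℝ) * deriv (fun z => f z j) y| < (2 * n * c₁ + n * c₁ ^ 2 / c₀) * A := by
  obtain ⟨hc0, hc0', hc1, H⟩ := hPF
  have hnpos : (0 : ℝ) < n := by exact_mod_cast hn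
  have hc1' : 0 < c₁ := by linarith
  rcases Nat.lt_or_ge n 2 with hn1 | hn2
  · obtain rfl : n = 1 := by omega
    simp only [Finset.univ_unique, Finset.sum_singleton, abs_mul] at h1 ⊢
    have hx1 := ((H f hf x hx).2 default).1
    have hy1 := ((H f hf y hy).2 default).2 default
    have e : iteratedDeriv ((default : Fin 1).1 + 1) (fun z => f z default) y =
        deriv (fun z => f z default) y := by
      simp
    rw [e] at hy1
    have h3 : |((a default : ℤ) : ℝ)| * c₀ ≤ ((1 : ℕ) : ℝ) * c₁ * A :=
      (mul_le_mul_of_nonneg_left hx1.le (abs_nonneg _)).trans h1.le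
    have h4 : |((a default : ℤ) : ℝ)| ≤ ((1 : ℕ) : ℝ) * c₁ * A / c₀ := by
      rw [le_div_iff₀ hc0]; exact h3
    calc _ ≤ (((1 : ℕ) : ℝ) * c₁ * A / c₀) * c₁ := by gcongr
      _ = (((1 : ℕ) : ℝ) * c₁ ^ 2 / c₀) * A := by ring
      _ < _ := by
        have : 0 < 2 * ((1 : ℕ) : ℝ) * c₁ * A := by positivity
        rw [add_mul]
        exact lt_add_of_pos_left _ this
  · have hder : ∀ z ∈ Icc ia ib, HasDerivWithinAt
        (fun z => ∑ j, (a j : ℝ) * deriv (fun z => f z j) z)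
        (∑ j, (a j : ℝ) * iteratedDeriv 2 (fun z => f z j) z) (Icc ia ib) z := by
      intro z hz
      apply HasDerivAt.hasDerivWithinAt
      apply HasDerivAt.fun_sum
      intro j _
      apply HasDerivAt.const_mul
      have := hda_iter ((hnd z hz).ev.self_of_nhds j) 1 (by omega)
      rw [iteratedDeriv_one] at this
      exact this
    have hbd : ∀ z ∈ Icc ia ib, ‖∑ j, (a j : ℝ) * iteratedDeriv 2 (fun z => f z j) z‖ ≤ n * (B * c₁) := by
      intro z hz
      refine (norm_sum_le _ _).trans ?_
      calc _ ≤ ∑ j : Fin n, B * c₁ := by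
            refine Finset.sum_le_sum fun j _ => ?_
            rw [norm_mul, Real.norm_eq_abs, Real.norm_eq_abs]
            have := ((H f hf z hz).2 j).2 ⟨1, by omega⟩
            exact mul_le_mul (hB j) this.le (abs_nonneg _) hB0
        _ = _ := by simp
    have := (convex_Icc ia ib).norm_image_sub_le_of_norm_hasDerivWithin_le hder hbd hx hy
    rw [Real.norm_eq_abs, Real.norm_eq_abs] at this
    have h5 : n * (B * c₁) * |y - x| ≤ n * c₁ := by
      calc _ ≤ n * (B * c₁) * δ := by gcongr
        _ = n * c₁ * (B * δ) := by ring
        _ ≤ n * c₁ * 1 := by gcongr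
        _ = _ := by ring
    have h6 := abs_sub_abs_le_abs_sub (∑ j, (a j : ℝ) * deriv (fun z => f z j) y)
      (∑ j, (a j : ℝ) * deriv (fun z => f z j) x)
    have h7 : n * c₁ ≤ n * c₁ * A := le_mul_of_one_le_right (by positivity) hA
    have h8 : 0 < n * c₁ ^ 2 / c₀ * A := by positivity
    have h9 : (2 * n * c₁ + n * c₁ ^ 2 / c₀) * A = 2 * (n * c₁ * A) + n * c₁ ^ 2 / c₀ * A := by ring
    rw [h9]
    linarith

lemma val_near (hn : 1 ≤ n) {F : Set (ℝ → Fin n → ℝ)} {ia ib c₀ c₁ : ℝ}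
    (hPF : PropertyF F (Icc ia ib) c₀ c₁) {f : ℝ → Fin n → ℝ} (hf : f ∈ F)
    (hnd : ∀ x ∈ Icc ia ib, NondegAt f x) (a₀ : ℤ) (a : Fin n → ℤ) (A B δ : ℝ) (hA : 1 ≤ A)
    (hBδ : B * δ ≤ 1) (hB : ∀ i, |(a i : ℝ)| ≤ B) (hB0 : 0 ≤ B)
    {x y : ℝ} (hx : x ∈ Icc ia ib) (hy : y ∈ Icc ia ib) (hxy : |y - x| ≤ δ)
    (h0 : |(a₀ : ℝ) + ∑ j, (a j : ℝ) * f x j| < A * δ)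
    (h1 : |∑ j, (a j : ℝ) * deriv (fun z => f z j) x| < (n : ℝ) * c₁ * A) :
    |(a₀ : ℝ) + ∑ j, (a j : ℝ) * f y j| < (1 + (2 * n * c₁ + n * c₁ ^ 2 / c₀)) * (A * δ) := by
  set K := 2 * n * c₁ + n * c₁ ^ 2 / c₀ with hK
  have hc0 := hPF.1
  have hc1 : 0 < c₁ := by linarith [hPF.2.2.1]
  have hK0 : 0 ≤ K := by positivity
  have hsub : uIcc x y ⊆ Icc ia ib := (convex_Icc ia ib).ordConnected.uIcc_subset hx hy
  have hder : ∀ z ∈ uIcc x y, HasDerivWithinAt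
      (fun z => (a₀ : ℝ) + ∑ j, (a j : ℝ) * f z j)
      (∑ j, (a j : ℝ) * deriv (fun z => f z j) z) (uIcc x y) z := by
    intro z hz
    apply HasDerivAt.hasDerivWithinAt
    apply HasDerivAt.const_add
    apply HasDerivAt.fun_sum
    intro j _
    apply HasDerivAt.const_mul
    have := hda_iter ((hnd z (hsub hz)).ev.self_of_nhds j) 0 (by omega)
    rw [iteratedDeriv_zero, iteratedDeriv_one] at this
    exact this
  have hbd : ∀ z ∈ uIcc x y, ‖∑ j, (a j : ℝ) * deriv (fun z => f z j) z‖ ≤ K * A := by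
    intro z hz
    refine (deriv_near hn hPF hf hnd a A B δ hA hBδ hB hB0 hx (hsub hz) ?_ h1).le
    exact (abs_sub_left_of_mem_uIcc hz).trans hxy
  have := (convex_uIcc x y).norm_image_sub_le_of_norm_hasDerivWithin_le hder hbd
    left_mem_uIcc right_mem_uIcc
  rw [Real.norm_eq_abs, Real.norm_eq_abs] at this
  have h6 := abs_sub_abs_le_abs_sub ((a₀ : ℝ) + ∑ j, (a j : ℝ) * f y j)
      ((a₀ : ℝ) + ∑ j, (a j : ℝ) * f x j)
  have h5 : K * A * |y - x| ≤ K * (A * δ) := by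
    calc _ ≤ K * A * δ := by gcongr
      _ = _ := by ring
  have e : (1 + K) * (A * δ) = A * δ + K * (A * δ) := by ring
  rw [e]
  linarith
end

section
open MeasureTheory Set
open scoped ENNReal Topology

variable {n : ℕ}

theorem main_aux (n : ℕ) (hn : 1 ≤ n)
    (F : Set (ℝ → Fin n → ℝ)) (hFfin : F.Finite)
    (ia ib : ℝ) (hab : ia < ib)
    (hnd : ∀ f ∈ F, ∀ x ∈ Icc ia ib, NondegAt f x)
    (c₀ c₁ : ℝ) (hPF : PropertyF F (Icc ia ib) c₀ c₁) :
    ∃ K₀ : ℝ, 0 < K₀ ∧ ∃ κ₀ : ℝ, 0 < κ₀ ∧ κ₀ < 1 ∧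
      ∀ f ∈ F, ∀ r ∈ Weights n, ∀ t : ℕ, 1 ≤ t → ∀ ε : ℝ, 0 ≤ ε → ε < gammaW r →
      ∀ b : ℝ, 1 < b → ∀ κ : ℝ, 0 < κ → κ < κ₀ →
      ∃ D : Finset (Set ℝ),
        (∀ Δ ∈ D, ∃ u v : ℝ, Δ = Set.Icc u v ∧
          v - u ≤ κ * b ^ (-(t : ℝ) * (1 + gammaW r - ε))) ∧
        ((D.card : ℝ) ≤
          K₀ * (κ * b ^ (-ε * (t : ℝ))) ^ ((((n : ℝ) + 1) * (2 * (n : ℝ) - 1))⁻¹) /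
            (κ * b ^ (-(t : ℝ) * (1 + gammaW r - ε)))) ∧
        {x ∈ Icc ia ib | ∃ a : Fin n → ℤ, a ≠ 0 ∧ ∃ a₀ : ℤ,
          |(a₀ : ℝ) + ∑ j, (a j : ℝ) * f x j| < κ * b ^ (-(t : ℝ)) ∧
          |∑ j, (a j : ℝ) * deriv (fun y => f y j) x| <
            (n : ℝ) * c₁ * b ^ ((gammaW r - ε) * (t : ℝ)) ∧
          ∀ i, |(a i : ℝ)| < b ^ (r i * (t : ℝ))} ⊆ ⋃ Δ ∈ D, Δ := by
  classical
  obtain ⟨C, hC, hM⟩ := fam_bound hn F hFfin ia ib hnd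
  have hc0 := hPF.1
  have hc1 : 0 < c₁ := by linarith [hPF.2.2.1]
  have hn1 : (1 : ℝ) ≤ n := by exact_mod_cast hn
  set K := 2 * n * c₁ + n * c₁ ^ 2 / c₀ with hK
  have hK0 : 0 < K := by positivity
  set C1 := 1 + K with hC1
  have hC1' : 1 ≤ C1 := by linarith
  set β := (((n : ℝ) + 1) * (2 * (n : ℝ) - 1))⁻¹ with hβ
  refine ⟨2 * C * (C1 ^ 2) ^ β, by positivity, min (1 / 2) (min (C1 ^ 2)⁻¹ (ib - ia)), ?_, ?_, ?_⟩
  · have : 0 < ib - ia := by linarith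
    positivity
  · exact (min_le_left _ _).trans_lt (by norm_num)
  intro f hf r hr t ht ε hε hεγ b hb κ hκ hκ₀
  have hκ1 : κ < 1 := hκ₀.trans_le ((min_le_left _ _).trans (by norm_num))
  have hκ2 : κ < (C1 ^ 2)⁻¹ := hκ₀.trans_le ((min_le_right _ _).trans (min_le_left _ _))
  have hκ3 : κ < ib - ia := hκ₀.trans_le ((min_le_right _ _).trans (min_le_right _ _))
  have hb0 : 0 < b := by linarith
  -- the maximal weight
  have : Nonempty (Fin n) := ⟨⟨0, hn⟩⟩
  have hfin : (Set.range r).Finite := Set.finite_range r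
  obtain ⟨j0, hj0⟩ : ∃ j, r j = gammaW r := (Set.range_nonempty r).csSup_mem hfin
  have hγ : ∀ i, r i ≤ gammaW r := fun i => le_csSup hfin.bddAbove (mem_range_self i)
  set γ := gammaW r with hγdef
  have hγ1 : γ ≤ 1 := by
    rw [← hj0, ← hr.1]
    exact Finset.single_le_sum (fun i _ => hr.2 i) (Finset.mem_univ j0)
  have ht0 : (0 : ℝ) < t := by exact_mod_cast ht
  set A := b ^ ((γ - ε) * (t : ℝ)) with hA
  set B := b ^ (γ * (t : ℝ)) with hB
  set δ := κ * b ^ (-(t : ℝ) * (1 + γ - ε)) with hδ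
  have hA0 : 0 < A := Real.rpow_pos_of_pos hb0 _
  have hB0 : 0 < B := Real.rpow_pos_of_pos hb0 _
  have hA1 : 1 ≤ A := Real.one_le_rpow hb.le (by nlinarith)
  have hpowle : ∀ s : ℝ, s ≤ 0 → b ^ s ≤ 1 := fun s hs =>
    Real.rpow_le_one_of_one_le_of_nonpos hb.le hs
  have hδ0 : 0 < δ := by positivity
  have hδκ : δ ≤ κ := by
    have := hpowle (-(t : ℝ) * (1 + γ - ε)) (by nlinarith)
    exact mul_le_of_le_one_right hκ.le this
  have hAδ : A * δ = κ * b ^ (-(t : ℝ)) := by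
    rw [hA, hδ, mul_left_comm, ← Real.rpow_add hb0]
    congr 2
    ring
  have hBδ : B * δ ≤ 1 := by
    rw [hB, hδ, mul_left_comm, ← Real.rpow_add hb0]
    have := hpowle (γ * (t : ℝ) + -(t : ℝ) * (1 + γ - ε)) (by nlinarith)
    exact (mul_le_of_le_one_right hκ.le this).trans hκ1.le
  set q := κ * b ^ (-ε * (t : ℝ)) with hq
  have hq0 : 0 < q := by positivity
  have hq1 : C1 ^ 2 * q ≤ 1 := by
    have := hpowle (-ε * (t : ℝ)) (by nlinarith)
    have h1 : q ≤ κ := mul_le_of_le_one_right hκ.le this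
    have h2 : q ≤ (C1 ^ 2)⁻¹ := h1.trans hκ2.le
    rw [← one_div, le_div_iff₀ (by positivity)] at h2
    linarith
  set Q := C1 ^ 2 * q with hQ
  have hQ0 : 0 < Q := by positivity
  set η := Q ^ (((n : ℝ) + 1)⁻¹) with hη
  have hη0 : 0 < η := by positivity
  have hη1 : η ≤ 1 := Real.rpow_le_one hQ0.le hq1 (by positivity)
  have hηpow : η ^ (n + 1) = Q := by
    have : (((n : ℝ) + 1)⁻¹) = (((n + 1 : ℕ) : ℝ))⁻¹ := by push_cast; rfl
    rw [hη, this, Real.rpow_inv_natCast_pow hQ0.le (by omega)]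
  set w : Option (Fin (n + 1)) → ℝ := fun o => o.elim (η / (C1 * A))
    (Fin.cons (η / (C1 * (A * δ))) (fun p => η / b ^ (r p * (t : ℝ)))) with hw
  have w_none : w none = η / (C1 * A) := rfl
  have w_zero : w (some 0) = η / (C1 * (A * δ)) := rfl
  have w_succ : ∀ p : Fin n, w (some p.succ) = η / b ^ (r p * (t : ℝ)) := fun p => rfl
  have hT1 : ∀ p : Fin n, 1 ≤ b ^ (r p * (t : ℝ)) := fun p =>
    Real.one_le_rpow hb.le (mul_nonneg (hr.2 p) ht0.le)
  have hT0 : ∀ p : Fin n, 0 < b ^ (r p * (t : ℝ)) := fun p => Real.rpow_pos_of_pos hb0 _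
  have hwpos : ∀ o, 0 < w o := by
    intro o
    rcases o with _ | p
    · rw [w_none]; positivity
    · refine Fin.cases ?_ (fun p => ?_) p
      · rw [w_zero]; positivity
      · rw [w_succ]; exact div_pos hη0 (hT0 p)
  have hwle : ∀ o, o ≠ some 0 → w o ≤ 1 := by
    intro o ho
    rcases o with _ | p
    · rw [w_none, div_le_one (by positivity)]
      exact hη1.trans (one_le_mul_of_one_le_of_one_le hC1' hA1)
    · revert ho
      refine Fin.cases ?_ (fun p => ?_) p
      · intro ho; exact absurd rfl ho
      · intro _
        rw [w_succ, div_le_one (hT0 p)]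
        exact hη1.trans (hT1 p)
  have hprodT : ∏ p : Fin n, b ^ (r p * (t : ℝ)) = b ^ (t : ℝ) := by
    rw [← Real.rpow_sum_of_pos hb0, ← Finset.sum_mul, hr.1, one_mul]
  have hprod : 1 ≤ ∏ i ∈ Finset.univ.erase (some j0.succ), w i := by
    have h1 := Finset.mul_prod_erase Finset.univ w (Finset.mem_univ (some j0.succ))
    rw [Fintype.prod_option, Fin.prod_univ_succ, w_none, w_zero] at h1
    simp only [w_succ] at h1
    rw [Finset.prod_div_distrib, hprodT, hj0, Finset.prod_const, Finset.card_univ,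
      Fintype.card_fin, ← hB] at h1
    have hbt : 0 < b ^ (t : ℝ) := Real.rpow_pos_of_pos hb0 _
    have h2 : η / (C1 * A) * (η / (C1 * (A * δ)) * (η ^ n / b ^ (t : ℝ))) = η / B := by
      have h3 : C1 * A * (C1 * (A * δ)) * b ^ (t : ℝ) = B * Q := by
        rw [hAδ, hQ, hq]
        have e1 : A * (b ^ (-(t : ℝ))) * b ^ (t : ℝ) = A := by
          rw [mul_assoc, ← Real.rpow_add hb0]
          simp
        have e2 : A = B * b ^ (-ε * (t : ℝ)) := by
          rw [hA, hB, ← Real.rpow_add hb0]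
          congr 1
          ring
        calc _ = C1 ^ 2 * κ * (A * (b ^ (-(t : ℝ))) * b ^ (t : ℝ)) := by ring
          _ = C1 ^ 2 * κ * (B * b ^ (-ε * (t : ℝ))) := by rw [e1, e2]
          _ = _ := by ring
      calc _ = η * η ^ (n + 1) / (C1 * A * (C1 * (A * δ)) * b ^ (t : ℝ)) := by
            field_simp
            try ring
        _ = η * Q / (B * Q) := by rw [h3, hηpow]
        _ = η / B := by field_simp
    rw [h2] at h1
    have h4 : η / B ≠ 0 := by positivity
    exact (mul_left_cancel₀ h4 (h1.trans (mul_one _).symm)).ge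
  have hvol := hM f hf w hwpos hwle j0.succ (Fin.succ_ne_zero _) hprod η hη0
  have hVeq : C * η ^ (2 * (n : ℝ) - 1)⁻¹ = C * ((C1 ^ 2) ^ β * q ^ β) := by
    rw [hη, ← Real.rpow_mul hQ0.le, hQ, hβ, mul_inv, Real.mul_rpow (by positivity) hq0.le]
  rw [hVeq] at hvol
  set S : Set ℝ := {x ∈ Icc ia ib | ∃ a : Fin n → ℤ, a ≠ 0 ∧ ∃ a₀ : ℤ,
          |(a₀ : ℝ) + ∑ j, (a j : ℝ) * f x j| < κ * b ^ (-(t : ℝ)) ∧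
          |∑ j, (a j : ℝ) * deriv (fun y => f y j) x| <
            (n : ℝ) * c₁ * A ∧
          ∀ i, |(a i : ℝ)| < b ^ (r i * (t : ℝ))} with hS
  have hth : ∀ x ∈ S, ∀ y ∈ Icc ia ib, |y - x| ≤ δ → y ∈ {x ∈ Icc ia ib |
      ∃ v : Fin (n + 1) → ℤ, v ≠ 0 ∧ ∀ o, |w o * Lrow (PhiF f) x o (zc v)| < η} := by
    rintro x ⟨hx, a, ha, a₀, h0, h1, h2⟩ y hy hxy
    rw [← hAδ] at h0
    have hBi : ∀ i, |(a i : ℝ)| ≤ B := fun i => (h2 i).le.trans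
      (Real.rpow_le_rpow_of_exponent_le hb.le (mul_le_mul_of_nonneg_right (hγ i) ht0.le))
    have hd := deriv_near hn hPF hf (hnd f hf) a A B δ hA1 hBδ hBi hB0.le hx hy hxy h1
    have hv := val_near hn hPF hf (hnd f hf) a₀ a A B δ hA1 hBδ hBi hB0.le hx hy hxy h0 h1
    have fin : ∀ (T z : ℝ), 0 < T → |z| < T → |η / T * z| < η := by
      intro T z hT hz
      rw [abs_mul, abs_of_pos (by positivity), div_mul_eq_mul_div, div_lt_iff₀ hT]
      gcongr
    refine ⟨hy, Fin.cons a₀ a, ?_, ?_⟩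
    · intro h
      apply ha
      ext i
      exact congrFun h i.succ
    · intro o
      rcases o with _ | p
      · rw [Lrow_none, U1_cons, w_none]
        refine fin _ _ (by positivity) (hd.trans_le ?_)
        gcongr
        linarith
      · refine Fin.cases ?_ (fun p => ?_) p
        · rw [Lrow_zero, U0_cons, w_zero]
          exact fin _ _ (by positivity) hv
        · rw [Lrow_ne _ _ _ _ (Fin.succ_ne_zero _), w_succ]
          exact fin _ _ (hT0 p) (by simpa [zc] using h2 p)
  obtain ⟨D, hD1, hD2, hD3⟩ := grid ia ib δ _ hδ0 (by linarith) S _ (fun x hx => hx.1)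
    (by positivity) hth hvol
  refine ⟨D, hD1, ?_, hD3⟩
  refine hD2.trans (le_of_eq ?_)
  ring
end

theorem stmt15 (n : ℕ) (hn : 1 ≤ n) (I : Set ℝ)
    (F : Set (ℝ → Fin n → ℝ)) (hFfin : F.Finite)
    (ia ib : ℝ) (hab : ia < ib) (I₀ : Set ℝ) (hI₀ : I₀ = Set.Icc ia ib)
    (hsub : I₀ ⊆ I) (hnd : ∀ f ∈ F, ∀ x ∈ I₀, NondegAt f x)
    (c₀ c₁ : ℝ) (hPF : PropertyF F I₀ c₀ c₁) :
    ∃ K₀ : ℝ, 0 < K₀ ∧ ∃ κ₀ : ℝ, 0 < κ₀ ∧ κ₀ < 1 ∧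
      ∀ f ∈ F, ∀ r ∈ Weights n, ∀ t : ℕ, 1 ≤ t → ∀ ε : ℝ, 0 ≤ ε → ε < gammaW r →
      ∀ b : ℝ, 1 < b → ∀ κ : ℝ, 0 < κ → κ < κ₀ →
      ∃ D : Finset (Set ℝ),
        (∀ Δ ∈ D, ∃ u v : ℝ, Δ = Set.Icc u v ∧
          v - u ≤ κ * b ^ (-(t : ℝ) * (1 + gammaW r - ε))) ∧
        ((D.card : ℝ) ≤
          K₀ * (κ * b ^ (-ε * (t : ℝ))) ^ ((((n : ℝ) + 1) * (2 * (n : ℝ) - 1))⁻¹) /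
            (κ * b ^ (-(t : ℝ) * (1 + gammaW r - ε)))) ∧
        {x ∈ I₀ | ∃ a : Fin n → ℤ, a ≠ 0 ∧ ∃ a₀ : ℤ,
          |(a₀ : ℝ) + ∑ j, (a j : ℝ) * f x j| < κ * b ^ (-(t : ℝ)) ∧
          |∑ j, (a j : ℝ) * deriv (fun y => f y j) x| <
            (n : ℝ) * c₁ * b ^ ((gammaW r - ε) * (t : ℝ)) ∧
          ∀ i, |(a i : ℝ)| < b ^ (r i * (t : ℝ))} ⊆ ⋃ Δ ∈ D, Δ := by
  subst hI₀
  exact main_aux n hn F hFfin ia ib hab hnd c₀ c₁ hPF
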